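/- arXiv:2001.07200 — 6 statements merged into one kernel-verified Lean document; each statement's English description precedes it below -/
import Mathlib

section
/- With the notation of the context, for every p ∈ U, every t ∈ [0,t₀) and all 1 ≤ i,j ≤ d, the induced metric satisfies the evolution equation ∂_t g_{ij}(p,t) = −2 A_{ij}(p,t) / ‖∇r(𝓕(p,t))‖. -/
open Set
open scoped RealInnerProductSpace

/-- First partial derivative `∂_{p_i} 𝓕(p,t)` of a parametrized family of level-set
parametrizations, in the `i`-th coordinate direction of `p`. -/
noncomputable def partialP {d m : ℕ}
    (F : EuclideanSpace ℝ (Fin d) → ℝ → EuclideanSpace ℝ (Fin m))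
    (i : Fin d) (p : EuclideanSpace ℝ (Fin d)) (t : ℝ) : EuclideanSpace ℝ (Fin m) :=
  fderiv ℝ (fun q => F q t) p (EuclideanSpace.single i 1)

/-- Second partial derivative `∂_{p_i} ∂_{p_j} 𝓕(p,t)`. -/
noncomputable def partialP2 {d m : ℕ}
    (F : EuclideanSpace ℝ (Fin d) → ℝ → EuclideanSpace ℝ (Fin m))
    (i j : Fin d) (p : EuclideanSpace ℝ (Fin d)) (t : ℝ) : EuclideanSpace ℝ (Fin m) :=
  fderiv ℝ (fun q => partialP F j q t) p (EuclideanSpace.single i 1)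

/-- Induced metric `g_{ij}(p,t) = ⟨∂_{p_i}𝓕(p,t), ∂_{p_j}𝓕(p,t)⟩`. -/
noncomputable def inducedMetric {d m : ℕ}
    (F : EuclideanSpace ℝ (Fin d) → ℝ → EuclideanSpace ℝ (Fin m))
    (i j : Fin d) (p : EuclideanSpace ℝ (Fin d)) (t : ℝ) : ℝ :=
  ⟪partialP F i p t, partialP F j p t⟫

/-- Second fundamental form `A_{ij}(p,t) = -⟨ν(p,t), ∂_{p_i}∂_{p_j}𝓕(p,t)⟩`, where
`ν = ∇r/‖∇r‖` is the unit normal. -/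
noncomputable def secondFF {d m : ℕ} (r : EuclideanSpace ℝ (Fin m) → ℝ)
    (F : EuclideanSpace ℝ (Fin d) → ℝ → EuclideanSpace ℝ (Fin m))
    (i j : Fin d) (p : EuclideanSpace ℝ (Fin d)) (t : ℝ) : ℝ :=
  -⟪‖gradient r (F p t)‖⁻¹ • gradient r (F p t), partialP2 F i j p t⟫

section Slices

variable {E G H : Type*} [NormedAddCommGroup E] [NormedSpace ℝ E]
  [NormedAddCommGroup G] [NormedSpace ℝ G] [NormedAddCommGroup H] [NormedSpace ℝ H]

/-- The slice in the first variable of a map differentiable within `U ×ˢ I`, with `U` open. -/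
theorem HasFDerivWithinAt.hasFDerivAt_slice_left {f : E × G → H} {f' : E × G →L[ℝ] H}
    {U : Set E} {I : Set G} {p : E} {t : G} (h : HasFDerivWithinAt f f' (U ×ˢ I) (p, t))
    (hU : IsOpen U) (hp : p ∈ U) (ht : t ∈ I) :
    HasFDerivAt (fun q => f (q, t)) (f'.comp (ContinuousLinearMap.inl ℝ E G)) p := by
  have h1 : HasFDerivWithinAt (fun q : E => (q, t)) (ContinuousLinearMap.inl ℝ E G) U p :=
    (hasFDerivAt_prodMk_left p t).hasFDerivWithinAt
  exact (h.comp p h1 fun _ hq => mk_mem_prod hq ht).hasFDerivAt (hU.mem_nhds hp)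

/-- The slice in a real second variable of a map differentiable within `U ×ˢ I`. -/
theorem HasFDerivWithinAt.hasDerivWithinAt_slice_right {f : E × ℝ → H} {f' : E × ℝ →L[ℝ] H}
    {U : Set E} {I : Set ℝ} {p : E} {t : ℝ} (h : HasFDerivWithinAt f f' (U ×ˢ I) (p, t))
    (hp : p ∈ U) : HasDerivWithinAt (fun s => f (p, s)) (f' (0, 1)) I t :=
  h.comp_hasDerivWithinAt t
    ((hasDerivWithinAt_const t I p).prodMk (hasDerivWithinAt_id t I))
    fun _ hs => mk_mem_prod hp hs

end Slices

theorem prod_Ico_subset_closure_interior {X : Type*} [TopologicalSpace X] {U : Set X}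
    (hU : IsOpen U) {a b : ℝ} (hab : a < b) :
    U ×ˢ Ico a b ⊆ closure (interior (U ×ˢ Ico a b)) := by
  rw [interior_prod_eq, hU.interior_eq, interior_Ico, closure_prod_eq, closure_Ioo hab.ne]
  exact prod_mono subset_closure Ico_subset_Icc_self

/-- The gradient of `r` is orthogonal to any parametrized
piece of a level set of `r`. -/
theorem inner_gradient_fderiv_eq_zero {E V : Type*} [NormedAddCommGroup E] [NormedSpace ℝ E]
    [NormedAddCommGroup V] [InnerProductSpace ℝ V] [CompleteSpace V] {r : V → ℝ} {f : E → V}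
    {f' : E →L[ℝ] V} {U : Set E} {p : E} (hr : DifferentiableAt ℝ r (f p))
    (hf : HasFDerivAt f f' p) (hU : IsOpen U) (hp : p ∈ U)
    (hconst : ∀ q ∈ U, r (f q) = r (f p)) (v : E) : ⟪gradient r (f p), f' v⟫ = 0 := by
  have h1 := hr.hasGradientAt.hasFDerivAt.comp p hf
  have h2 : HasFDerivAt (r ∘ f) (0 : E →L[ℝ] ℝ) p :=
    (hasFDerivAt_const (r (f p)) p).congr_of_eventuallyEq
      (Filter.eventuallyEq_of_mem (hU.mem_nhds hp) hconst)
  simpa using DFunLike.congr_fun (h1.unique h2) v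

/-- The induced metric of the level sets of `r` evolving under the negative
normalized gradient flow satisfies `∂_t g_{ij}(p,t) = -2 A_{ij}(p,t) / ‖∇r(𝓕(p,t))‖`. -/
theorem metric_evolution (m d : ℕ) (hm : 1 ≤ m) (hd : 1 ≤ d)
    (U : Set (EuclideanSpace ℝ (Fin d))) (hU : IsOpen U)
    (t₀ : ℝ) (ht₀ : 0 < t₀)
    (r : EuclideanSpace ℝ (Fin m) → ℝ) (hr : ContDiff ℝ 2 r)
    (F : EuclideanSpace ℝ (Fin d) → ℝ → EuclideanSpace ℝ (Fin m))
    (hF : ContDiffOn ℝ 2 (fun q : EuclideanSpace ℝ (Fin d) × ℝ => F q.1 q.2)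
      (U ×ˢ Set.Ico 0 t₀))
    (hgrad : ∀ p ∈ U, ∀ t ∈ Set.Ico (0 : ℝ) t₀, gradient r (F p t) ≠ 0)
    (hODE : ∀ p ∈ U, ∀ t ∈ Set.Ico (0 : ℝ) t₀,
      HasDerivWithinAt (fun s => F p s)
        (-(‖gradient r (F p t)‖ ^ 2)⁻¹ • gradient r (F p t)) (Set.Ico 0 t₀) t)
    (hlevel : ∀ t ∈ Set.Ico (0 : ℝ) t₀, ∀ p ∈ U, ∀ q ∈ U, r (F p t) = r (F q t)) :
    ∀ p ∈ U, ∀ t ∈ Set.Ico (0 : ℝ) t₀, ∀ i j : Fin d,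
      HasDerivWithinAt (fun s => inducedMetric F i j p s)
        (-2 * secondFF r F i j p t / ‖gradient r (F p t)‖) (Set.Ico 0 t₀) t := by
  intro p hp t ht i j
  set S := U ×ˢ Ico (0 : ℝ) t₀
  set f := fun q : EuclideanSpace ℝ (Fin d) × ℝ => F q.1 q.2
  set D := fderivWithin ℝ f S
  have hS : UniqueDiffOn ℝ S := hU.uniqueDiffOn.prod (uniqueDiffOn_Ico 0 t₀)
  have hmem : ∀ q ∈ U, ∀ s ∈ Ico (0 : ℝ) t₀, (q, s) ∈ S := fun q hq s hs => ⟨hq, hs⟩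
  have hfD : ∀ q ∈ U, ∀ s ∈ Ico (0 : ℝ) t₀, HasFDerivWithinAt f (D (q, s)) S (q, s) :=
    fun q hq s hs =>
      (hF.differentiableOn two_ne_zero _ (hmem q hq s hs)).hasFDerivWithinAt
  have hspace : ∀ q ∈ U, ∀ s ∈ Ico (0 : ℝ) t₀, HasFDerivAt (fun q => F q s)
      ((D (q, s)).comp (ContinuousLinearMap.inl ℝ _ ℝ)) q :=
    fun q hq s hs => (hfD q hq s hs).hasFDerivAt_slice_left hU hq hs
  have hpartial : ∀ k : Fin d, ∀ q ∈ U, ∀ s ∈ Ico (0 : ℝ) t₀,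
      partialP F k q s = D (q, s) (EuclideanSpace.single k 1, 0) := by
    intro k q hq s hs
    simp [partialP, (hspace q hq s hs).fderiv]
  have htime : ∀ q ∈ U, D (q, t) (0, 1)
      = -(‖gradient r (F q t)‖ ^ 2)⁻¹ • gradient r (F q t) := fun q hq =>
    (uniqueDiffOn_Ico 0 t₀ t ht).eq_deriv _
      ((hfD q hq t ht).hasDerivWithinAt_slice_right hq) (hODE q hq t ht)
  have horth : ∀ k : Fin d, ∀ q ∈ U,
      ⟪D (q, t) (0, 1), D (q, t) (EuclideanSpace.single k 1, 0)⟫ = 0 := by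
    intro k q hq
    have h := inner_gradient_fderiv_eq_zero (r := r)
      (hr.differentiable two_ne_zero _) (hspace q hq t ht) hU hq
      (fun q' hq' => hlevel t ht q' hq' q hq) (EuclideanSpace.single k 1)
    simp only [ContinuousLinearMap.comp_apply, ContinuousLinearMap.inl_apply] at h
    rw [htime q hq, real_inner_smul_left, h, mul_zero]
  obtain ⟨B, hB⟩ : DifferentiableWithinAt ℝ D S (p, t) :=
    (hF.fderivWithin hS (m := 1) (by norm_num)).differentiableOn one_ne_zero _ (hmem p hp t ht)
  have hsymm : ∀ v w, B v w = B w v := by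
    have h := (hF _ (hmem p hp t ht)).isSymmSndFDerivWithinAt (by simp) hS
      (prod_Ico_subset_closure_interior hU ht₀ (hmem p hp t ht)) (hmem p hp t ht)
    intro v w
    have hB' : fderivWithin ℝ D S (p, t) = B := hB.fderivWithin (hS _ (hmem p hp t ht))
    rw [← hB']
    exact h v w
  have hBspace := hB.hasFDerivAt_slice_left hU hp ht
  have hBtime := hB.hasDerivWithinAt_slice_right hp
  have hsnd : ∀ k l : Fin d, partialP2 F k l p t
      = B (EuclideanSpace.single k 1, 0) (EuclideanSpace.single l 1, 0) := by
    intro k l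
    have h : HasFDerivAt (fun q => partialP F l q t) _ p :=
      (hBspace.clm_apply (hasFDerivAt_const (EuclideanSpace.single l (1 : ℝ), (0 : ℝ)) p)
        ).congr_of_eventuallyEq
        (Filter.eventuallyEq_of_mem (hU.mem_nhds hp) fun q hq => hpartial l q hq t ht)
    simp [partialP2, h.fderiv]
  have hmixed : ∀ k l : Fin d,
      ⟪B (0, 1) (EuclideanSpace.single k 1, 0), partialP F l p t⟫
        = -secondFF r F k l p t / ‖gradient r (F p t)‖ := by
    intro k l
    have h1 := (hBspace.clm_apply (hasFDerivAt_const ((0 : EuclideanSpace ℝ (Fin d)), (1 : ℝ)) p)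
      ).inner ℝ (hBspace.clm_apply
        (hasFDerivAt_const (EuclideanSpace.single l (1 : ℝ), (0 : ℝ)) p))
    have h2 := (hasFDerivAt_const (𝕜 := ℝ) (0 : ℝ) p).congr_of_eventuallyEq
      (Filter.eventuallyEq_of_mem (hU.mem_nhds hp) fun q hq => horth l q hq)
    have h3 := DFunLike.congr_fun (h1.unique h2) (EuclideanSpace.single k 1)
    simp [fderivInnerCLM_apply] at h3
    have hn : ‖gradient r (F p t)‖ ≠ 0 := norm_ne_zero_iff.mpr (hgrad p hp t ht)
    rw [htime p hp, real_inner_smul_left, hsymm _ (0, 1), ← hpartial l p hp t ht,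
      ← hsnd k l] at h3
    rw [secondFF, real_inner_smul_left]
    field_simp
    field_simp at h3
    linarith
  have hpartialTime : ∀ k : Fin d, HasDerivWithinAt (fun s => partialP F k p s)
      (B (0, 1) (EuclideanSpace.single k 1, 0)) (Ico 0 t₀) t := by
    intro k
    have h := hBtime.clm_apply
      (hasDerivWithinAt_const t (Ico 0 t₀) (EuclideanSpace.single k (1 : ℝ), (0 : ℝ)))
    rw [map_zero, add_zero] at h
    exact h.congr (fun s hs => hpartial k p hp s hs) (hpartial k p hp t ht)
  have hA : secondFF r F j i p t = secondFF r F i j p t := by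
    rw [secondFF, secondFF, hsnd, hsnd, hsymm]
  refine ((hpartialTime i).inner ℝ (hpartialTime j)).congr_deriv ?_
  rw [real_inner_comm, hmixed, hmixed, hA]
  ring
end

section
/- There exists a constant C > 0 depending only on m such that the following holds. Let V ⊆ ℝ^m be open and let r : V → ℝ be twice continuously differentiable with ‖∇r(x)‖ ≥ c₀ > 0 and with the operator norm of the Hessian of r bounded by K at every x ∈ V. Let U ⊆ ℝ^{m−1} be open and let F : U → V be a twice continuously differentiable immersion (the vectors ∂_1 F(p), …, ∂_{m−1} F(p) are linearly independent for each p) such that r ∘ F is constant on U. Define g_{ij}(p) = ⟨∂_i F(p), ∂_j F(p)⟩, ν(p) = ∇r(F(p))/‖∇r(F(p))‖, A_{ij}(p) = −⟨ν(p), ∂_i ∂_j F(p)⟩, and the mean curvature H(p) = trace(g(p)^{-1} A(p)). Then |H(p)| ≤ C·K/c₀ for every p ∈ U. -/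
open Set
open scoped RealInnerProductSpace

/-- First partial derivative `∂_i F(p)`. -/
noncomputable def partialF {d m : ℕ}
    (F : EuclideanSpace ℝ (Fin d) → EuclideanSpace ℝ (Fin m))
    (i : Fin d) (p : EuclideanSpace ℝ (Fin d)) : EuclideanSpace ℝ (Fin m) :=
  fderiv ℝ F p (EuclideanSpace.single i 1)

/-- Second partial derivative `∂_i ∂_j F(p)`. -/
noncomputable def partialF2 {d m : ℕ}
    (F : EuclideanSpace ℝ (Fin d) → EuclideanSpace ℝ (Fin m))
    (i j : Fin d) (p : EuclideanSpace ℝ (Fin d)) : EuclideanSpace ℝ (Fin m) :=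
  fderiv ℝ (fun q => partialF F j q) p (EuclideanSpace.single i 1)

/-- Mean curvature `H(p) = trace (g(p)⁻¹ A(p))` of the immersed level-set parametrization
`F`, where `g_{ij} = ⟨∂_i F, ∂_j F⟩` is the induced metric and
`A_{ij} = -⟨∇r/‖∇r‖ ∘ F, ∂_i ∂_j F⟩` is the second fundamental form with respect to the
unit normal `ν = ∇r/‖∇r‖`. -/
noncomputable def meanCurvOf {d m : ℕ} (r : EuclideanSpace ℝ (Fin m) → ℝ)
    (F : EuclideanSpace ℝ (Fin d) → EuclideanSpace ℝ (Fin m))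
    (p : EuclideanSpace ℝ (Fin d)) : ℝ :=
  Matrix.trace
    ((Matrix.of fun i j => ⟪partialF F i p, partialF F j p⟫)⁻¹ *
      Matrix.of fun i j =>
        -⟪‖gradient r (F p)‖⁻¹ • gradient r (F p), partialF2 F i j p⟫)

/-- If `v` is linearly independent with Gram matrix `g`, then the compression of an operator `S` to
the span of `v`, whose trace is `∑ (g⁻¹)ᵢⱼ ⟪S vⱼ, vᵢ⟫`, has trace at most `m ‖S‖` in absolute
value. -/
theorem abs_trace_inv_gram_mul_le {d m : ℕ} (v : Fin d → EuclideanSpace ℝ (Fin m))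
    (hv : LinearIndependent ℝ v) (S : EuclideanSpace ℝ (Fin m) →L[ℝ] EuclideanSpace ℝ (Fin m)) :
    |Matrix.trace ((Matrix.of fun i j => ⟪v i, v j⟫)⁻¹ * Matrix.of fun i j => ⟪S (v i), v j⟫)|
      ≤ m * ‖S‖ := by
  set g : Matrix (Fin d) (Fin d) ℝ := Matrix.of fun i j => ⟪v i, v j⟫ with hg
  have hunit : IsUnit g.det := by
    have h : (Matrix.gram ℝ v).PosDef := Matrix.posDef_gram_of_linearIndependent hv
    exact h.det_pos.ne'.isUnit
  have hinv : g⁻¹ * g = 1 := Matrix.nonsing_inv_mul g hunit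
  -- `u k` is the orthogonal projection of the `k`-th basis vector to the span of `v`.
  let u : Fin m → EuclideanSpace ℝ (Fin m) := fun k => ∑ i, ∑ j, (g⁻¹ i j * v i k) • v j
  have hu_inner (k : Fin m) (a : Fin d) : ⟪v a, u k⟫ = v a k := by
    have h (i : Fin d) : ∑ j, g⁻¹ i j * ⟪v j, v a⟫ = (1 : Matrix (Fin d) (Fin d) ℝ) i a := by
      rw [← hinv, Matrix.mul_apply]
      rfl
    calc ⟪v a, u k⟫ = ∑ i, v i k * ∑ j, g⁻¹ i j * ⟪v j, v a⟫ := by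
          simp only [u, inner_sum, inner_smul_right, Finset.mul_sum]
          refine Finset.sum_congr rfl fun i _ => Finset.sum_congr rfl fun j _ => ?_
          rw [real_inner_comm]
          ring
      _ = v a k := by simp [h, Matrix.one_apply]
  have hu_norm (k : Fin m) : ‖u k‖ ≤ 1 := by
    have h : ⟪u k, u k⟫ = u k k := by
      calc ⟪u k, u k⟫ = ∑ i, ∑ j, (g⁻¹ i j * v i k) * ⟪v j, u k⟫ := by
            simp only [u, sum_inner, real_inner_smul_left]
        _ = u k k := by simp [hu_inner, u]
    have h_le : u k k ≤ ‖u k‖ := (le_abs_self _).trans (PiLp.norm_apply_le (u k) k)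
    rw [real_inner_self_eq_norm_sq] at h
    by_contra! hlt
    nlinarith
  have htrace : Matrix.trace (g⁻¹ * Matrix.of fun i j => ⟪S (v i), v j⟫) = ∑ k, S (u k) k := by
    simp only [Matrix.trace, Matrix.diag_apply, Matrix.mul_apply, Matrix.of_apply, u, map_sum,
      map_smul, WithLp.ofLp_sum, WithLp.ofLp_smul, Finset.sum_apply, Pi.smul_apply, smul_eq_mul]
    rw [Finset.sum_comm (s := (Finset.univ : Finset (Fin m)))]
    refine Finset.sum_congr rfl fun i _ => ?_
    rw [Finset.sum_comm]
    refine Finset.sum_congr rfl fun j _ => ?_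
    rw [PiLp.inner_apply, Finset.mul_sum]
    refine Finset.sum_congr rfl fun k _ => ?_
    simp
    ring
  rw [htrace]
  calc |∑ k, S (u k) k| ≤ ∑ k : Fin m, |S (u k) k| := Finset.abs_sum_le_sum_abs _ _
    _ ≤ ∑ _k : Fin m, ‖S‖ := Finset.sum_le_sum fun k _ =>
        (PiLp.norm_apply_le (S (u k)) k).trans (S.unit_le_opNorm _ (hu_norm k))
    _ = m * ‖S‖ := by simp

/-- The gradient of a `C²` function is differentiable. -/
theorem ContDiffAt.differentiableAt_gradient {E : Type*} [NormedAddCommGroup E]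
    [InnerProductSpace ℝ E] [CompleteSpace E] {r : E → ℝ} {x : E} (hr : ContDiffAt ℝ 2 r x) :
    DifferentiableAt ℝ (gradient r) x := by
  have h : DifferentiableAt ℝ (fderiv ℝ r) x :=
    (hr.fderiv_right (m := 1) (by norm_num)).differentiableAt (by norm_num)
  exact (InnerProductSpace.toDual ℝ E).symm.toContinuousLinearEquiv.differentiableAt.comp x h

/-- Differentiating `⟪∇r ∘ F, ∂ⱼF⟫ = 0` along a level set relates the Hessian of `r` to the second
partial derivatives of `F`. -/
theorem inner_gradient_partialF2 {d m : ℕ} {r : EuclideanSpace ℝ (Fin m) → ℝ}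
    {F : EuclideanSpace ℝ (Fin d) → EuclideanSpace ℝ (Fin m)}
    {V : Set (EuclideanSpace ℝ (Fin m))} {U : Set (EuclideanSpace ℝ (Fin d))}
    (hV : IsOpen V) (hr : ContDiffOn ℝ 2 r V) (hU : IsOpen U) (hF : ContDiffOn ℝ 2 F U)
    (hFV : ∀ p ∈ U, F p ∈ V) (hconst : ∀ p ∈ U, ∀ q ∈ U, r (F p) = r (F q))
    {p : EuclideanSpace ℝ (Fin d)} (hp : p ∈ U) (i j : Fin d) :
    -⟪gradient r (F p), partialF2 F i j p⟫ =
      ⟪fderiv ℝ (gradient r) (F p) (partialF F i p), partialF F j p⟫ := by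
  have hr_at (q) (hq : q ∈ U) : ContDiffAt ℝ 2 r (F q) :=
    hr.contDiffAt (hV.mem_nhds (hFV q hq))
  have hF_at (q) (hq : q ∈ U) : ContDiffAt ℝ 2 F q := hF.contDiffAt (hU.mem_nhds hq)
  have horth : ∀ q ∈ U, ⟪gradient r (F q), partialF F j q⟫ = 0 := by
    intro q hq
    have hrd : DifferentiableAt ℝ r (F q) := (hr_at q hq).differentiableAt (by norm_num)
    have hFd : DifferentiableAt ℝ F q := (hF_at q hq).differentiableAt (by norm_num)
    have hzero : fderiv ℝ (r ∘ F) q = 0 := by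
      have : (r ∘ F) =ᶠ[nhds q] fun _ => r (F q) :=
        Filter.eventually_of_mem (hU.mem_nhds hq) fun x hx => hconst x hx q hq
      rw [this.fderiv_eq, fderiv_fun_const, Pi.zero_apply]
    rw [fderiv_comp q hrd hFd] at hzero
    have h := congrArg (fun L => L (EuclideanSpace.single j 1)) hzero
    simpa [gradient, partialF] using h
  have hgrad : DifferentiableAt ℝ (gradient r) (F p) := (hr_at p hp).differentiableAt_gradient
  have hFd : DifferentiableAt ℝ F p := (hF_at p hp).differentiableAt (by norm_num)
  have hpart : DifferentiableAt ℝ (fun q => partialF F j q) p := by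
    have h : DifferentiableAt ℝ (fderiv ℝ F) p :=
      ((hF_at p hp).fderiv_right (m := 1) (by norm_num)).differentiableAt (by norm_num)
    exact h.clm_apply (differentiableAt_const _)
  have hzero : fderiv ℝ (fun q => ⟪gradient r (F q), partialF F j q⟫) p = 0 := by
    have : (fun q => ⟪gradient r (F q), partialF F j q⟫) =ᶠ[nhds p] fun _ => (0 : ℝ) :=
      Filter.eventually_of_mem (hU.mem_nhds hp) horth
    rw [this.fderiv_eq, fderiv_fun_const, Pi.zero_apply]
  have h := fderiv_inner_apply ℝ (hgrad.comp p hFd) hpart (EuclideanSpace.single i 1)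
  rw [fderiv_comp p hgrad hFd] at h
  simp only [Function.comp_def] at h
  rw [hzero] at h
  change (0 : ℝ) = ⟪gradient r (F p), partialF2 F i j p⟫ +
    ⟪fderiv ℝ (gradient r) (F p) (partialF F i p), partialF F j p⟫ at h
  linarith

/-- Uniform mean curvature bound for level sets of a defining function with
nondegenerate gradient: there is `C = C(m) > 0` such that whenever `‖∇r‖ ≥ c₀ > 0` and the
Hessian of `r` has operator norm at most `K` on `V`, any `C²` immersed parametrization `F` of
a level set of `r` has mean curvature bounded by `C·K/c₀`. -/
theorem mean_curvature_bound (m : ℕ) (hm : 1 ≤ m) :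
    ∃ C : ℝ, 0 < C ∧
      ∀ (V : Set (EuclideanSpace ℝ (Fin m))), IsOpen V →
      ∀ (r : EuclideanSpace ℝ (Fin m) → ℝ), ContDiffOn ℝ 2 r V →
      ∀ (c₀ K : ℝ), 0 < c₀ →
      (∀ x ∈ V, c₀ ≤ ‖gradient r x‖) →
      (∀ x ∈ V, ‖fderiv ℝ (gradient r) x‖ ≤ K) →
      ∀ (U : Set (EuclideanSpace ℝ (Fin (m - 1)))), IsOpen U →
      ∀ (F : EuclideanSpace ℝ (Fin (m - 1)) → EuclideanSpace ℝ (Fin m)),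
        ContDiffOn ℝ 2 F U →
        (∀ p ∈ U, F p ∈ V) →
        (∀ p ∈ U, LinearIndependent ℝ (fun i : Fin (m - 1) => partialF F i p)) →
        (∀ p ∈ U, ∀ q ∈ U, r (F p) = r (F q)) →
        ∀ p ∈ U, |meanCurvOf r F p| ≤ C * K / c₀ := by
  refine ⟨m, by exact_mod_cast hm, ?_⟩
  intro V hV r hr c₀ K hc₀ hgrad hhess U hU F hF hFV hindep hconst p hp
  have hFp := hFV p hp
  set S := fderiv ℝ (gradient r) (F p)
  have hS : ‖S‖ ≤ K := hhess _ hFp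
  have hc : c₀ ≤ ‖gradient r (F p)‖ := hgrad _ hFp
  have hcurv : meanCurvOf r F p = ‖gradient r (F p)‖⁻¹ *
      Matrix.trace ((Matrix.of fun i j => ⟪partialF F i p, partialF F j p⟫)⁻¹ *
        Matrix.of fun i j => ⟪S (partialF F i p), partialF F j p⟫) := by
    rw [← smul_eq_mul, ← Matrix.trace_smul, ← Matrix.mul_smul, meanCurvOf]
    congr 2
    ext i j
    simp only [Matrix.of_apply, Matrix.smul_apply, smul_eq_mul, real_inner_smul_left,
      ← inner_gradient_partialF2 hV hr hU hF hFV hconst hp, S]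
    ring
  rw [hcurv, abs_mul, abs_of_nonneg (by positivity), inv_mul_eq_div]
  have htrace := abs_trace_inv_gram_mul_le (fun i => partialF F i p) (hindep p hp) S
  have hmK : (m : ℝ) * ‖S‖ ≤ m * K := by gcongr
  have hK : 0 ≤ K := (norm_nonneg S).trans hS
  exact div_le_div₀ (by positivity) (htrace.trans hmK) hc₀ hc
end

section
/- With the notation of the context, suppose moreover that 2/3 ≤ ‖∇r(𝓕(p,t))‖ ≤ 3/2 for all (p,t) and that the operator norm of the Hessian of r is bounded by K on an open set containing the image of 𝓕, and that the matrix g(p,t) is positive definite for all (p,t). Then there exists a constant C > 0, depending only on m and K (in particular independent of U and of the parametrization 𝓕), such that for all p ∈ U and t ∈ [0,t₀): e^{−Ct} √(det g(p,0)) ≤ √(det g(p,t)) ≤ e^{Ct} √(det g(p,0)). -/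
open Set
open scoped RealInnerProductSpace

/-- Induced metric matrix `g(p,t) = (g_{ij}(p,t))`, `g_{ij} = ⟨∂_{p_i}𝓕, ∂_{p_j}𝓕⟩`. -/
noncomputable def inducedMetricMatrix {d m : ℕ}
    (F : EuclideanSpace ℝ (Fin d) → ℝ → EuclideanSpace ℝ (Fin m))
    (p : EuclideanSpace ℝ (Fin d)) (t : ℝ) : Matrix (Fin d) (Fin d) ℝ :=
  Matrix.of fun i j => ⟪partialP F i p t, partialP F j p t⟫

section Determinants

open scoped Matrix MatrixOrder

lemma Matrix.PosSemidef.det_le_one {n : Type*} [Fintype n] [DecidableEq n]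
    {M : Matrix n n ℝ} (hM : M.PosSemidef) (h : (1 - M).PosSemidef) : M.det ≤ 1 := by
  rw [hM.isHermitian.det_eq_prod_eigenvalues]
  refine Finset.prod_le_one (fun i _ => hM.eigenvalues_nonneg i) fun i _ => ?_
  have hv := h.dotProduct_mulVec_nonneg (hM.isHermitian.eigenvectorBasis i)
  have h1 : star (⇑(hM.isHermitian.eigenvectorBasis i)) ⬝ᵥ
      ⇑(hM.isHermitian.eigenvectorBasis i) = 1 := by
    have := hM.isHermitian.eigenvectorBasis.orthonormal.1 i
    rw [EuclideanSpace.norm_eq, Real.sqrt_eq_one] at this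
    simpa [dotProduct, sq] using this
  have h2 := hM.isHermitian.mulVec_eigenvectorBasis i
  rw [Matrix.sub_mulVec, Matrix.one_mulVec, h2, dotProduct_sub, dotProduct_smul, h1] at hv
  simpa using hv

lemma Matrix.PosDef.det_le_det {n : Type*} [Fintype n] [DecidableEq n]
    {A B : Matrix n n ℝ} (hA : A.PosDef) (hB : B.PosSemidef) (h : (A - B).PosSemidef) :
    B.det ≤ A.det := by
  set S := CFC.sqrt A
  have hA0 : 0 ≤ A := hA.posSemidef.nonneg
  have hSA : S * S = A := CFC.sqrt_mul_sqrt_self A hA0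
  have hS : S.PosSemidef := Matrix.nonneg_iff_posSemidef.1 (CFC.sqrt_nonneg A)
  have hdet : IsUnit S.det := by
    rw [isUnit_iff_ne_zero]
    intro h0
    have := hA.det_pos
    rw [← hSA, Matrix.det_mul, h0] at this
    simp at this
  have hQ : (S⁻¹)ᴴ = S⁻¹ := hS.inv.isHermitian
  have hM := hB.conjTranspose_mul_mul_same S⁻¹
  have hM1 := h.conjTranspose_mul_mul_same S⁻¹
  rw [hQ] at hM hM1
  have hone : S⁻¹ * A * S⁻¹ = 1 := by
    rw [← hSA, ← Matrix.mul_assoc, Matrix.nonsing_inv_mul _ hdet, Matrix.one_mul,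
      Matrix.mul_nonsing_inv _ hdet]
  rw [Matrix.mul_sub, Matrix.sub_mul, hone] at hM1
  have hle := hM.det_le_one hM1
  have hmul : B.det = (S⁻¹ * B * S⁻¹).det * A.det := by
    have : S.det * S⁻¹.det = 1 := by
      rw [← Matrix.det_mul, Matrix.mul_nonsing_inv _ hdet, Matrix.det_one]
    rw [← hSA, Matrix.det_mul, Matrix.det_mul, Matrix.det_mul]
    linear_combination (-B.det * (S.det * S⁻¹.det + 1)) * this
  rw [hmul]
  exact mul_le_of_le_one_left hA.det_pos.le hle

lemma Matrix.det_gram_le {n E : Type*} [Fintype n] [DecidableEq n]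
    [NormedAddCommGroup E] [InnerProductSpace ℝ E] {v w : n → E} {c : ℝ} (hc : 0 < c)
    (hw : (Matrix.gram ℝ w).PosDef)
    (h : ∀ x : n → ℝ, ‖∑ i, x i • v i‖ ^ 2 ≤ c * ‖∑ i, x i • w i‖ ^ 2) :
    (Matrix.gram ℝ v).det ≤ c ^ Fintype.card n * (Matrix.gram ℝ w).det := by
  rw [← Matrix.det_smul]
  refine (hw.smul hc).det_le_det (Matrix.posSemidef_gram ℝ v) ?_
  refine Matrix.PosSemidef.of_dotProduct_mulVec_nonneg
    ((hw.smul hc).isHermitian.sub (Matrix.isHermitian_gram ℝ v)) fun x => ?_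
  rw [Matrix.sub_mulVec, Matrix.smul_mulVec, dotProduct_sub, dotProduct_smul,
    Matrix.star_dotProduct_gram_mulVec, Matrix.star_dotProduct_gram_mulVec,
    real_inner_self_eq_norm_sq, real_inner_self_eq_norm_sq, smul_eq_mul]
  exact sub_nonneg.2 (h x)

end Determinants

section Flow

variable {E H : Type*} [NormedAddCommGroup E] [NormedSpace ℝ E]

lemma HasFDerivWithinAt.hasFDerivAt_prod_slice [NormedAddCommGroup H] [NormedSpace ℝ H]
    {Φ : E × ℝ → H} {Φ' : E × ℝ →L[ℝ] H} {U : Set E} {I : Set ℝ} {p : E} {t : ℝ}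
    (h : HasFDerivWithinAt Φ Φ' (U ×ˢ I) (p, t)) (hU : U ∈ nhds p) (ht : t ∈ I) :
    HasFDerivAt (fun q => Φ (q, t)) (Φ'.comp (.inl ℝ E ℝ)) p := by
  have hmaps : Set.MapsTo (fun q => (q, t)) U (U ×ˢ I) := fun q hq => ⟨hq, ht⟩
  exact (HasFDerivWithinAt.comp p h
    (hasFDerivAt_prodMk_left p t).hasFDerivWithinAt hmaps).hasFDerivAt hU

lemma HasFDerivWithinAt.hasDerivWithinAt_prod_slice [NormedAddCommGroup H] [NormedSpace ℝ H]
    {Φ : E × ℝ → H} {Φ' : E × ℝ →L[ℝ] H} {U : Set E} {I : Set ℝ} {p : E} {t : ℝ}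
    (h : HasFDerivWithinAt Φ Φ' (U ×ˢ I) (p, t)) (hp : p ∈ U) :
    HasDerivWithinAt (fun s => Φ (p, s)) (Φ' (0, 1)) I t := by
  have hmaps : Set.MapsTo (fun s => (p, s)) I (U ×ˢ I) := fun s hs => ⟨hp, hs⟩
  have := (HasFDerivWithinAt.comp t h
    (hasFDerivAt_prodMk_right p t).hasFDerivWithinAt hmaps).hasDerivWithinAt
  rwa [ContinuousLinearMap.comp_apply, ContinuousLinearMap.inr_apply] at this

/-- The space derivative of a `C²` flow of a vector field `X` solves the linearized equation. -/
lemma hasDerivWithinAt_fderiv_flow [NormedAddCommGroup H] [NormedSpace ℝ H]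
    {U : Set E} (hU : IsOpen U) {t₀ : ℝ} {F : E → ℝ → H}
    (hF : ContDiffOn ℝ 2 (fun q : E × ℝ => F q.1 q.2) (U ×ˢ Set.Ico 0 t₀)) {X : H → H}
    (hX : ∀ p ∈ U, ∀ t ∈ Set.Ico (0 : ℝ) t₀,
      HasDerivWithinAt (fun s => F p s) (X (F p t)) (Set.Ico 0 t₀) t)
    {p : E} (hp : p ∈ U) {t : ℝ} (ht : t ∈ Set.Ico 0 t₀) {X' : H →L[ℝ] H}
    (hX' : HasFDerivAt X X' (F p t)) (ξ : E) :
    HasDerivWithinAt (fun s => fderiv ℝ (fun q => F q s) p ξ)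
      (X' (fderiv ℝ (fun q => F q t) p ξ)) (Set.Ico 0 t₀) t := by
  set S : Set (E × ℝ) := U ×ˢ Set.Ico 0 t₀ with hSdef
  set G : E × ℝ → H := fun q => F q.1 q.2
  have hS : UniqueDiffOn ℝ S := hU.uniqueDiffOn.prod (uniqueDiffOn_Ico 0 t₀)
  have hpt : (p, t) ∈ S := ⟨hp, ht⟩
  have hG : ∀ z ∈ S, HasFDerivWithinAt G (fderivWithin ℝ G S z) S z := fun z hz =>
    ((hF.differentiableOn (by norm_num)) z hz).hasFDerivWithinAt
  have hslice : ∀ q ∈ U, ∀ s ∈ Set.Ico 0 t₀, HasFDerivAt (fun q => F q s)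
      ((fderivWithin ℝ G S (q, s)).comp (.inl ℝ E ℝ)) q := fun q hq s hs =>
    (hG (q, s) ⟨hq, hs⟩).hasFDerivAt_prod_slice (hU.mem_nhds hq) hs
  have htime : ∀ q ∈ U, ∀ s ∈ Set.Ico 0 t₀, fderivWithin ℝ G S (q, s) (0, 1) = X (F q s) := by
    intro q hq s hs
    have h1 := (hG (q, s) ⟨hq, hs⟩).hasDerivWithinAt_prod_slice hq
    exact (uniqueDiffOn_Ico 0 t₀ s hs).eq_deriv _ h1 (hX q hq s hs)
  have hsymm : IsSymmSndFDerivWithinAt ℝ G S (p, t) := by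
    refine (hF _ hpt).isSymmSndFDerivWithinAt (by simp) hS ?_ hpt
    rw [hSdef, interior_prod_eq, closure_prod_eq, hU.interior_eq]
    exact ⟨subset_closure hp, Ico_subset_closure_interior 0 t₀ ht⟩
  have hD2 : HasFDerivWithinAt (fderivWithin ℝ G S)
      (fderivWithin ℝ (fderivWithin ℝ G S) S (p, t)) S (p, t) :=
    ((hF.fderivWithin hS (m := 1) (by norm_num)).differentiableOn (by norm_num)
      _ hpt).hasFDerivWithinAt
  set D := fderivWithin ℝ (fderivWithin ℝ G S) S (p, t)
  have hcross : D (ξ, 0) (0, 1) = X' (fderiv ℝ (fun q => F q t) p ξ) := by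
    have h1 := hD2.hasFDerivAt_prod_slice (hU.mem_nhds hp) ht
    have h2 := h1.clm_apply (hasFDerivAt_const ((0 : E), (1 : ℝ)) p)
    have h3 : HasFDerivAt (fun q => X (F q t)) (X'.comp (fderiv ℝ (fun q => F q t) p)) p :=
      HasFDerivAt.comp p hX' (hslice p hp t ht).differentiableAt.hasFDerivAt
    have h4 := h3.congr_of_eventuallyEq
      (Filter.eventually_of_mem (hU.mem_nhds hp) fun q hq => htime q hq t ht)
    simpa using DFunLike.congr_fun (h2.unique h4) ξ
  rw [← hcross, hsymm.eq]
  have h1 := hD2.hasDerivWithinAt_prod_slice hp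
  have h2 := h1.clm_apply (hasDerivWithinAt_const t (Set.Ico 0 t₀) (ξ, (0 : ℝ)))
  simp only [map_zero, add_zero] at h2
  refine h2.congr (fun s hs => ?_) ?_
  · simp [(hslice p hp s hs).fderiv]
  · simp [(hslice p hp t ht).fderiv]

variable [NormedAddCommGroup H] [InnerProductSpace ℝ H]

lemma exists_hasFDerivAt_inv_norm_sq_smul {n : H → H} {N : H →L[ℝ] H} {x : H}
    (hn : HasFDerivAt n N x) (h0 : n x ≠ 0) :
    ∃ X' : H →L[ℝ] H, HasFDerivAt (fun y => -(‖n y‖ ^ 2)⁻¹ • n y) X' x ∧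
      ∀ ξ, ‖X' ξ‖ ≤ 3 * (‖n x‖ ^ 2)⁻¹ * ‖N‖ * ‖ξ‖ := by
  have hpos : 0 < ‖n x‖ := norm_pos_iff.2 h0
  have h1 := (hasDerivAt_inv (pow_pos hpos 2).ne').comp_hasFDerivAt x hn.norm_sq
  refine ⟨_, h1.neg.smul hn, fun ξ => ?_⟩
  have hN : ‖N ξ‖ ≤ ‖N‖ * ‖ξ‖ := N.le_opNorm ξ
  have hinner : |⟪n x, N ξ⟫| ≤ ‖n x‖ * ‖N ξ‖ := abs_real_inner_le_norm _ _
  have hle : ‖-(‖n x‖ ^ 2)⁻¹ • N ξ‖ + ‖(2 * ((‖n x‖ ^ 2) ^ 2)⁻¹ * ⟪n x, N ξ⟫) • n x‖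
      ≤ 3 * (‖n x‖ ^ 2)⁻¹ * ‖N ξ‖ := by
    rw [norm_smul, norm_smul, norm_neg, norm_mul, norm_mul]
    simp only [Real.norm_eq_abs, abs_inv, abs_pow, abs_norm, abs_two]
    calc _ ≤ (‖n x‖ ^ 2)⁻¹ * ‖N ξ‖ + 2 * ((‖n x‖ ^ 2) ^ 2)⁻¹ * (‖n x‖ * ‖N ξ‖) * ‖n x‖ := by gcongr
      _ = _ := by field_simp; ring
  calc _ = ‖-(‖n x‖ ^ 2)⁻¹ • N ξ + (2 * ((‖n x‖ ^ 2) ^ 2)⁻¹ * ⟪n x, N ξ⟫) • n x‖ := by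
        congr 1
        simp [mul_left_comm, mul_assoc]
    _ ≤ 3 * (‖n x‖ ^ 2)⁻¹ * ‖N ξ‖ := (norm_add_le _ _).trans hle
    _ ≤ 3 * (‖n x‖ ^ 2)⁻¹ * (‖N‖ * ‖ξ‖) := by gcongr
    _ = _ := by ring

/-- Two-sided Grönwall estimate for the squared norm. -/
lemma norm_sq_le_exp_mul_norm_sq {v v' : ℝ → H} {L t₀ : ℝ}
    (hv : ∀ t ∈ Set.Ico 0 t₀, HasDerivWithinAt v (v' t) (Set.Ico 0 t₀) t)
    (hL : ∀ t ∈ Set.Ico 0 t₀, ‖v' t‖ ≤ L * ‖v t‖) {t : ℝ} (ht : t ∈ Set.Ico 0 t₀) :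
    ‖v t‖ ^ 2 ≤ Real.exp (2 * L * t) * ‖v 0‖ ^ 2 ∧
      ‖v 0‖ ^ 2 ≤ Real.exp (2 * L * t) * ‖v t‖ ^ 2 := by
  have h0 : (0 : ℝ) ∈ Set.Ico 0 t₀ := ⟨le_rfl, ht.1.trans_lt ht.2⟩
  have hder : ∀ a : ℝ, ∀ s ∈ Set.Ico 0 t₀, HasDerivWithinAt (fun s => Real.exp (a * s) * ‖v s‖ ^ 2)
      (Real.exp (a * s) * (a * ‖v s‖ ^ 2 + 2 * ⟪v s, v' s⟫)) (Set.Ico 0 t₀) s := by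
    intro a s hs
    have h1 := (((hasDerivAt_id s).const_mul a).exp.hasDerivWithinAt (s := Set.Ico 0 t₀)).mul
      (hv s hs).norm_sq
    refine h1.congr_deriv ?_
    simp
    ring
  have hcont := fun a s hs => (hder a s hs).continuousWithinAt
  have hint : ∀ a, ∀ s ∈ interior (Set.Ico 0 t₀), HasDerivAt
      (fun s => Real.exp (a * s) * ‖v s‖ ^ 2)
      (Real.exp (a * s) * (a * ‖v s‖ ^ 2 + 2 * ⟪v s, v' s⟫)) s := fun a s hs =>
    (hder a s (interior_subset hs)).hasDerivAt (mem_interior_iff_mem_nhds.1 hs)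
  have hbound : ∀ s ∈ Set.Ico 0 t₀, |⟪v s, v' s⟫| ≤ L * ‖v s‖ ^ 2 := fun s hs =>
    (abs_real_inner_le_norm _ _).trans <| by
      nlinarith [hL s hs, norm_nonneg (v s)]
  have hanti := antitoneOn_of_deriv_nonpos (convex_Ico 0 t₀) (hcont (-(2 * L)))
    (fun s hs => (hint _ s hs).differentiableAt.differentiableWithinAt) (fun s hs => by
      rw [(hint _ s hs).deriv]
      refine mul_nonpos_of_nonneg_of_nonpos (Real.exp_pos _).le ?_
      linarith [(abs_le.1 (hbound s (interior_subset hs))).2]) h0 ht ht.1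
  have hmono := monotoneOn_of_deriv_nonneg (convex_Ico 0 t₀) (hcont (2 * L))
    (fun s hs => (hint _ s hs).differentiableAt.differentiableWithinAt) (fun s hs => by
      rw [(hint _ s hs).deriv]
      refine mul_nonneg (Real.exp_pos _).le ?_
      linarith [(abs_le.1 (hbound s (interior_subset hs))).1]) h0 ht ht.1
  simp only [mul_zero, Real.exp_zero, one_mul] at hanti hmono
  refine ⟨?_, hmono⟩
  rwa [neg_mul, Real.exp_neg, inv_mul_le_iff₀ (Real.exp_pos _)] at hanti

end Flow

lemma inducedMetricMatrix_eq_gram {d m : ℕ}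
    (F : EuclideanSpace ℝ (Fin d) → ℝ → EuclideanSpace ℝ (Fin m)) (p : EuclideanSpace ℝ (Fin d))
    (t : ℝ) : inducedMetricMatrix F p t = Matrix.gram ℝ fun i => partialP F i p t :=
  rfl

lemma sum_smul_partialP {d m : ℕ}
    (F : EuclideanSpace ℝ (Fin d) → ℝ → EuclideanSpace ℝ (Fin m)) (p : EuclideanSpace ℝ (Fin d))
    (t : ℝ) (x : Fin d → ℝ) :
    ∑ i, x i • partialP F i p t =
      fderiv ℝ (fun q => F q t) p (∑ i, x i • EuclideanSpace.single i 1) := by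
  simp [partialP]

lemma sqrt_le_exp_mul_sqrt {a b x y : ℝ} {d : ℕ} (hx : 0 ≤ x) (hab : d * a ≤ b)
    (h : y ≤ Real.exp (2 * a) ^ d * x) : √y ≤ Real.exp b * √x := by
  refine Real.sqrt_le_iff.2 ⟨by positivity, h.trans ?_⟩
  rw [mul_pow, Real.sq_sqrt hx, ← Real.exp_nat_mul, ← Real.exp_nat_mul]
  refine mul_le_mul_of_nonneg_right (Real.exp_le_exp.2 ?_) hx
  push_cast
  linarith

/-- Uniform two-sided bound `e^{-Ct}√(det g(p,0)) ≤ √(det g(p,t)) ≤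
e^{Ct}√(det g(p,0))` for the evolution of the area element along the negative normalized
gradient flow, with `C` depending only on the dimension `m` and the Hessian bound `K`. -/
theorem area_element_comparison (m : ℕ) (hm : 1 ≤ m) (K : ℝ) :
    ∃ C : ℝ, 0 < C ∧
      ∀ (d : ℕ), 1 ≤ d →
      ∀ (U : Set (EuclideanSpace ℝ (Fin d))), IsOpen U →
      ∀ (t₀ : ℝ), 0 < t₀ →
      ∀ (r : EuclideanSpace ℝ (Fin m) → ℝ), ContDiff ℝ 2 r →
      ∀ (F : EuclideanSpace ℝ (Fin d) → ℝ → EuclideanSpace ℝ (Fin m)),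
        ContDiffOn ℝ 2 (fun q : EuclideanSpace ℝ (Fin d) × ℝ => F q.1 q.2)
          (U ×ˢ Set.Ico 0 t₀) →
        (∀ p ∈ U, ∀ t ∈ Set.Ico (0 : ℝ) t₀, gradient r (F p t) ≠ 0) →
        (∀ p ∈ U, ∀ t ∈ Set.Ico (0 : ℝ) t₀,
          HasDerivWithinAt (fun s => F p s)
            (-(‖gradient r (F p t)‖ ^ 2)⁻¹ • gradient r (F p t)) (Set.Ico 0 t₀) t) →
        (∀ t ∈ Set.Ico (0 : ℝ) t₀, ∀ p ∈ U, ∀ q ∈ U, r (F p t) = r (F q t)) →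
        (∀ p ∈ U, ∀ t ∈ Set.Ico (0 : ℝ) t₀,
          ‖gradient r (F p t)‖ ∈ Set.Icc (2 / 3 : ℝ) (3 / 2)) →
        (∃ W : Set (EuclideanSpace ℝ (Fin m)), IsOpen W ∧
          (∀ p ∈ U, ∀ t ∈ Set.Ico (0 : ℝ) t₀, F p t ∈ W) ∧
          ∀ x ∈ W, ‖fderiv ℝ (gradient r) x‖ ≤ K) →
        (∀ p ∈ U, ∀ t ∈ Set.Ico (0 : ℝ) t₀, (inducedMetricMatrix F p t).PosDef) →
        ∀ p ∈ U, ∀ t ∈ Set.Ico (0 : ℝ) t₀,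
          Real.exp (-C * t) * Real.sqrt (inducedMetricMatrix F p 0).det ≤
              Real.sqrt (inducedMetricMatrix F p t).det ∧
            Real.sqrt (inducedMetricMatrix F p t).det ≤
              Real.exp (C * t) * Real.sqrt (inducedMetricMatrix F p 0).det := by
  refine ⟨27 / 4 * |K| * m + 1, by positivity, ?_⟩
  intro d _ U hU t₀ _ r hr F hF hne hflow _ hbound hW hpos p hp t ht
  obtain ⟨W, -, hFW, hHess⟩ := hW
  set L : ℝ := 27 / 4 * |K| with hLdef
  have hgrad : Differentiable ℝ (gradient r) :=
    (InnerProductSpace.toDual ℝ (EuclideanSpace ℝ (Fin m))).symm.differentiable.comp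
      ((hr.fderiv_right (m := 1) (by norm_num)).differentiable (by norm_num))
  have hlin : ∀ s ∈ Set.Ico (0 : ℝ) t₀, ∃ X' : EuclideanSpace ℝ (Fin m) →L[ℝ] _,
      HasFDerivAt (fun y => -(‖gradient r y‖ ^ 2)⁻¹ • gradient r y) X' (F p s) ∧
        ∀ η, ‖X' η‖ ≤ L * ‖η‖ := by
    intro s hs
    obtain ⟨X', hX', hle⟩ := exists_hasFDerivAt_inv_norm_sq_smul
      (hgrad (F p s)).hasFDerivAt (hne p hp s hs)
    refine ⟨X', hX', fun η => (hle η).trans ?_⟩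
    have hinv : (‖gradient r (F p s)‖ ^ 2)⁻¹ ≤ 9 / 4 := by
      refine inv_le_of_inv_le₀ (by norm_num) ?_
      nlinarith [(hbound p hp s hs).1]
    have hK : ‖fderiv ℝ (gradient r) (F p s)‖ ≤ |K| :=
      (hHess _ (hFW p hp s hs)).trans (le_abs_self K)
    calc _ ≤ 3 * (9 / 4) * |K| * ‖η‖ := by gcongr
      _ = L * ‖η‖ := by rw [hLdef]; ring
  choose! X' hX' hX'L using hlin
  have hgrowth := fun ξ => norm_sq_le_exp_mul_norm_sq
    (fun s hs => hasDerivWithinAt_fderiv_flow hU hF hflow hp hs (hX' s hs) ξ)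
    (fun s hs => hX'L s hs _) ht
  have h0 : (0 : ℝ) ∈ Set.Ico 0 t₀ := ⟨le_rfl, ht.1.trans_lt ht.2⟩
  have hdm : d ≤ m := by
    simpa using (Matrix.linearIndependent_of_posDef_gram
      (v := fun i => partialP F i p t) (hpos p hp t ht)).fintype_card_le_finrank
  have hC : d * (L * t) ≤ (L * m + 1) * t := by
    have hdm' : (d : ℝ) ≤ m := by exact_mod_cast hdm
    have hLt : 0 ≤ L * t := mul_nonneg (by positivity) ht.1
    nlinarith [ht.1, mul_le_mul_of_nonneg_right hdm' hLt]
  have hup : (inducedMetricMatrix F p t).det ≤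
      Real.exp (2 * (L * t)) ^ d * (inducedMetricMatrix F p 0).det := by
    simpa only [Fintype.card_fin, inducedMetricMatrix_eq_gram] using Matrix.det_gram_le (v := fun i => partialP F i p t)
      (w := fun i => partialP F i p 0) (Real.exp_pos _) (hpos p hp 0 h0) fun x => by
        rw [sum_smul_partialP, sum_smul_partialP, ← mul_assoc]
        exact (hgrowth _).1
  have hlow : (inducedMetricMatrix F p 0).det ≤
      Real.exp (2 * (L * t)) ^ d * (inducedMetricMatrix F p t).det := by
    simpa only [Fintype.card_fin, inducedMetricMatrix_eq_gram] using Matrix.det_gram_le (v := fun i => partialP F i p 0)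
      (w := fun i => partialP F i p t) (Real.exp_pos _) (hpos p hp t ht) fun x => by
        rw [sum_smul_partialP, sum_smul_partialP, ← mul_assoc]
        exact (hgrowth _).2
  refine ⟨?_, sqrt_le_exp_mul_sqrt (hpos p hp 0 h0).det_pos.le hC hup⟩
  rw [neg_mul, Real.exp_neg, inv_mul_le_iff₀ (Real.exp_pos _)]
  exact sqrt_le_exp_mul_sqrt (hpos p hp t ht).det_pos.le hC hlow
end

section
/- With the notation of the context, there exists τ₁ ∈ (0, t₀], depending only on r, such that for every Borel set Q ⊆ Σ, every δ ∈ (0,1), and every t ∈ (0, τ₁): Vol( φ(Q × [0,t)) ) ≤ (4/(1−δ)) · Vol( φ(Q × [δt, t)) ). -/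
open Set MeasureTheory
open scoped ENNReal

section VolumeDistortion

variable {ι E : Type*} [NormedAddCommGroup E] [NormedSpace ℝ E] [FiniteDimensional ℝ E]
  [MeasurableSpace E] [BorelSpace E]

/-- A `K`-Lipschitz map between subsets of a finite-dimensional space increases an additive Haar
measure by a factor of at most `K ^ dim E`. -/
theorem LipschitzOnWith.addHaar_image_le (μ : Measure E) [μ.IsAddHaarMeasure] {K : NNReal}
    {f : E → E} {s : Set E} (hf : LipschitzOnWith K f s) :
    μ (f '' s) ≤ (K : ℝ≥0∞) ^ Module.finrank ℝ E * μ s := by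
  have h := hf.hausdorffMeasure_image_le (d := (Module.finrank ℝ E : ℝ)) (Nat.cast_nonneg _)
  rw [ENNReal.rpow_natCast] at h
  rw [Measure.isAddLeftInvariant_eq_smul μ (Measure.hausdorffMeasure (Module.finrank ℝ E : ℝ))]
  simp only [Measure.smul_apply, ENNReal.smul_def, smul_eq_mul]
  calc _ ≤ _ := mul_le_mul_right h _
    _ = _ := by ring

/-- If the distances between values of `f` are at most `K` times those between values of `g`, then
the image under `f` has measure at most `K ^ dim E` times that of the image under `g`. -/
theorem addHaar_image_le_of_dist_le (μ : Measure E) [μ.IsAddHaarMeasure] {K : NNReal}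
    {f g : ι → E} {s : Set ι} (h : ∀ i ∈ s, ∀ j ∈ s, dist (f i) (f j) ≤ K * dist (g i) (g j)) :
    μ (f '' s) ≤ (K : ℝ≥0∞) ^ Module.finrank ℝ E * μ (g '' s) := by
  rcases s.eq_empty_or_nonempty with rfl | ⟨i₀, -⟩
  · simp
  have : Nonempty ι := ⟨i₀⟩
  set k : E → ι := Function.invFunOn g s
  have hmem : ∀ y ∈ g '' s, k y ∈ s := fun y hy => Function.invFunOn_mem hy
  have heq : ∀ y ∈ g '' s, g (k y) = y := fun y hy => Function.invFunOn_eq hy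
  have hlip : LipschitzOnWith K (f ∘ k) (g '' s) := by
    refine LipschitzOnWith.of_dist_le_mul fun x hx y hy => ?_
    simpa only [Function.comp_apply, heq x hx, heq y hy] using h _ (hmem x hx) _ (hmem y hy)
  have himg : (f ∘ k) '' (g '' s) = f '' s := by
    rw [image_image]
    refine image_congr fun i hi => ?_
    have hgi := mem_image_of_mem g hi
    have := h _ (hmem _ hgi) _ hi
    rw [heq _ hgi, dist_self, mul_zero] at this
    exact dist_le_zero.1 this
  rw [← himg]
  exact hlip.addHaar_image_le μ

end VolumeDistortion

section BackwardGronwall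

variable {E : Type*} [NormedAddCommGroup E] [NormedSpace ℝ E]

/-- Grönwall's inequality backwards in time: two trajectories of a `K`-Lipschitz autonomous vector
field were at most `exp (K h)` times farther apart a time `h` ago. -/
theorem dist_le_of_trajectories_backward {X : E → E} {K : NNReal} {S : Set E}
    (hX : LipschitzOnWith K X S) {T : ℝ} {u v : ℝ → E}
    (hu : ∀ t ∈ Ico 0 T, HasDerivWithinAt u (X (u t)) (Ico 0 T) t)
    (hv : ∀ t ∈ Ico 0 T, HasDerivWithinAt v (X (v t)) (Ico 0 T) t)
    (huS : ∀ t ∈ Ico 0 T, u t ∈ S) (hvS : ∀ t ∈ Ico 0 T, v t ∈ S)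
    {a b h : ℝ} (ha : 0 ≤ a) (hb : 0 ≤ b) (hh : 0 ≤ h) (haT : a + h < T) (hbT : b + h < T) :
    dist (u a) (v b) ≤ Real.exp (K * h) * dist (u (a + h)) (v (b + h)) := by
  have maps : ∀ c : ℝ, 0 ≤ c → c + h < T → ∀ σ ∈ Icc 0 h, c + h - σ ∈ Ico 0 T :=
    fun c hc hcT σ hσ => ⟨by linarith [hσ.2], by linarith [hσ.1]⟩
  have cont : ∀ w : ℝ → E, (∀ t ∈ Ico 0 T, HasDerivWithinAt w (X (w t)) (Ico 0 T) t) →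
      ∀ c : ℝ, 0 ≤ c → c + h < T → ContinuousOn (fun σ => w (c + h - σ)) (Icc 0 h) :=
    fun w hw c hc hcT => ContinuousOn.comp (g := w) (t := Ico 0 T)
      (fun t ht => (hw t ht).continuousWithinAt) (by fun_prop) (maps c hc hcT)
  have deriv : ∀ w : ℝ → E, (∀ t ∈ Ico 0 T, HasDerivWithinAt w (X (w t)) (Ico 0 T) t) →
      ∀ c : ℝ, 0 ≤ c → c + h < T → ∀ σ ∈ Ico 0 h,
        HasDerivWithinAt (fun σ => w (c + h - σ)) (-X (w (c + h - σ))) (Ici σ) σ := by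
    intro w hw c hc hcT σ hσ
    have hd : HasDerivAt w (X (w (c + h - σ))) (c + h - σ) :=
      (hw _ (maps c hc hcT σ (Ico_subset_Icc_self hσ))).hasDerivAt
        (Ico_mem_nhds (by linarith [hσ.2]) (by linarith [hσ.1]))
    exact (hd.comp_const_sub (c + h) σ).hasDerivWithinAt
  have := dist_le_of_trajectories_ODE_of_mem (v := fun _ x => -X x) (s := fun _ => S) (K := K)
    (fun _ _ => hX.neg) (cont u hu a ha haT) (deriv u hu a ha haT)
    (fun σ hσ => huS _ (maps a ha haT σ (Ico_subset_Icc_self hσ)))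
    (cont v hv b hb hbT) (deriv v hv b hb hbT)
    (fun σ hσ => hvS _ (maps b hb hbT σ (Ico_subset_Icc_self hσ))) le_rfl h ⟨hh, le_rfl⟩
  simpa [mul_comm] using this

end BackwardGronwall

section NormalizedGradient

variable {E : Type*} [NormedAddCommGroup E] [InnerProductSpace ℝ E] [CompleteSpace E]

/-- The negative normalized gradient `-∇r / ‖∇r‖²`. -/
noncomputable def negNormalizedGradient (r : E → ℝ) (x : E) : E :=
  -(‖gradient r x‖ ^ 2)⁻¹ • gradient r x

theorem contDiffAt_negNormalizedGradient {r : E → ℝ} (hr : ContDiff ℝ (⊤ : ℕ∞) r) {x : E}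
    (hx : gradient r x ≠ 0) : ContDiffAt ℝ 1 (negNormalizedGradient r) x := by
  have hg : ContDiffAt ℝ 1 (gradient r) x :=
    ((InnerProductSpace.toDual ℝ E).symm.contDiff.comp
      (hr.fderiv_right (m := 1) (by norm_cast))).contDiffAt
  exact ((hg.norm_sq ℝ).inv (by simpa using hx)).neg.smul hg

theorem norm_negNormalizedGradient_le {r : E → ℝ} {c : ℝ} (hc : 0 < c) {x : E}
    (hx : c ≤ ‖gradient r x‖) : ‖negNormalizedGradient r x‖ ≤ c⁻¹ := by
  have hpos : 0 < ‖gradient r x‖ := hc.trans_le hx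
  have : ‖negNormalizedGradient r x‖ = ‖gradient r x‖⁻¹ := by
    rw [negNormalizedGradient, norm_smul, norm_neg, norm_inv, norm_pow, norm_norm]
    field_simp
  rw [this]
  gcongr

theorem exists_lipschitzOnWith_negNormalizedGradient {r : E → ℝ} (hr : ContDiff ℝ (⊤ : ℕ∞) r)
    {S : Set E} (hS : IsCompact S) (hgrad : ∀ x ∈ S, gradient r x ≠ 0) :
    ∃ K, LipschitzOnWith K (negNormalizedGradient r) S := by
  refine LocallyLipschitzOn.exists_lipschitzOnWith_of_compact hS fun x hx => ?_
  obtain ⟨K, t, ht, hK⟩ :=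
    (contDiffAt_negNormalizedGradient hr (hgrad x hx)).exists_lipschitzOnWith
  exact ⟨K, t, mem_nhdsWithin_of_mem_nhds ht, hK⟩

end NormalizedGradient

/-- A trajectory with speed at most `C` has moved by at most `C t` at time `t`. -/
theorem dist_le_of_speed_le {E : Type*} [NormedAddCommGroup E] [NormedSpace ℝ E] {u u' : ℝ → E}
    {T C : ℝ} (hu : ∀ t ∈ Ico 0 T, HasDerivWithinAt u (u' t) (Ico 0 T) t)
    (hC : ∀ t ∈ Ico 0 T, ‖u' t‖ ≤ C) {t : ℝ} (ht : t ∈ Ico 0 T) :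
    dist (u t) (u 0) ≤ C * t := by
  have hsub : Icc 0 t ⊆ Ico 0 T := fun s hs => ⟨hs.1, hs.2.trans_lt ht.2⟩
  have := norm_image_sub_le_of_norm_deriv_le_segment'
    (fun s hs => (hu s (hsub hs)).mono hsub)
    (fun s hs => hC s (hsub (Ico_subset_Icc_self hs))) t ⟨ht.1, le_rfl⟩
  simpa [dist_eq_norm] using this

/-- The interval `[0, t)` is covered by `⌈1 / (1 - δ)⌉` intervals of length `(1 - δ) t` that lie
in `[0, t)`. -/
theorem Ico_subset_iUnion_Ico_mul {δ t : ℝ} (hδ : δ < 1) (ht : 0 < t) :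
    Ico 0 t ⊆ ⋃ k ∈ Finset.range ⌈1 / (1 - δ)⌉₊,
      Ico (min (k * ((1 - δ) * t)) (δ * t)) (min (k * ((1 - δ) * t)) (δ * t) + (1 - δ) * t) := by
  intro s hs
  have hL : 0 < (1 - δ) * t := mul_pos (by linarith) ht
  have hk0 := Nat.floor_le (div_nonneg hs.1 hL.le)
  have hk1 := Nat.lt_floor_add_one (s / ((1 - δ) * t))
  rw [le_div_iff₀ hL] at hk0
  rw [div_lt_iff₀ hL] at hk1
  simp only [mem_iUnion, Finset.mem_range, exists_prop]
  refine ⟨⌊s / ((1 - δ) * t)⌋₊, ?_, (min_le_left _ _).trans hk0, ?_⟩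
  · refine Nat.floor_lt_ceil_of_lt_of_pos ?_ (one_div_pos.2 (by linarith))
    rw [div_lt_div_iff₀ hL (by linarith)]
    nlinarith [hs.2]
  · rcases min_choice (⌊s / ((1 - δ) * t)⌋₊ * ((1 - δ) * t)) (δ * t) with h | h <;> rw [h]
    · linarith
    · linarith [hs.2]

/-- Sparseness of the flow tents: for `t` small (uniformly in `Q`), the flow
tent of depth `t` over a Borel set `Q ⊆ Σ = r⁻¹(0)` has volume at most `4/(1-δ)` times the
volume of its upper Whitney flow region `φ(Q × [δt, t))`. -/
theorem flow_tent_sparse (m : ℕ) (hm : 2 ≤ m)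
    (r : EuclideanSpace ℝ (Fin m) → ℝ) (hr : ContDiff ℝ (⊤ : ℕ∞) r)
    (hScompact : IsCompact (r ⁻¹' {0})) (hSne : (r ⁻¹' {0}).Nonempty)
    (hSgrad : ∀ x ∈ r ⁻¹' {0}, gradient r x ≠ 0)
    (V : Set (EuclideanSpace ℝ (Fin m))) (hV : IsOpen V) (hSV : r ⁻¹' {0} ⊆ V)
    (hnorm : ∀ x ∈ V, ‖gradient r x‖ ∈ Set.Icc (2 / 3 : ℝ) (3 / 2))
    (t₀ : ℝ) (ht₀ : 0 < t₀)
    (φ : EuclideanSpace ℝ (Fin m) → ℝ → EuclideanSpace ℝ (Fin m))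
    (hφ0 : ∀ x ∈ r ⁻¹' {0}, φ x 0 = x)
    (hφV : ∀ x ∈ r ⁻¹' {0}, ∀ t ∈ Set.Ico (0 : ℝ) t₀, φ x t ∈ V)
    (hODE : ∀ x ∈ r ⁻¹' {0}, ∀ t ∈ Set.Ico (0 : ℝ) t₀,
      HasDerivWithinAt (fun s => φ x s)
        (-(‖gradient r (φ x t)‖ ^ 2)⁻¹ • gradient r (φ x t)) (Set.Ico 0 t₀) t) :
    ∃ τ₁ : ℝ, 0 < τ₁ ∧ τ₁ ≤ t₀ ∧
      ∀ Q : Set (EuclideanSpace ℝ (Fin m)), MeasurableSet Q → Q ⊆ r ⁻¹' {0} →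
        ∀ δ : ℝ, 0 < δ → δ < 1 →
          ∀ t : ℝ, 0 < t → t < τ₁ →
            volume ((fun q : EuclideanSpace ℝ (Fin m) × ℝ => φ q.1 q.2) ''
                (Q ×ˢ Set.Ico 0 t)) ≤
              ENNReal.ofReal (4 / (1 - δ)) *
                volume ((fun q : EuclideanSpace ℝ (Fin m) × ℝ => φ q.1 q.2) ''
                  (Q ×ˢ Set.Ico (δ * t) t)) := by
  obtain ⟨ε, hε, hεV⟩ := hScompact.exists_cthickening_subset_open hV hSV
  set S := Metric.cthickening ε (r ⁻¹' {0})
  have hpos : ∀ x ∈ V, 0 < ‖gradient r x‖ := fun x hx => by linarith [(hnorm x hx).1]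
  obtain ⟨K, hK⟩ := exists_lipschitzOnWith_negNormalizedGradient hr hScompact.cthickening
    fun x hx => norm_pos_iff.1 (hpos x (hεV hx))
  have hlim : Filter.Tendsto (fun s : ℝ => Real.exp (K * s) ^ m) (nhds 0) (nhds 1) := by
    have : Continuous fun s : ℝ => Real.exp (K * s) ^ m := by fun_prop
    simpa using this.tendsto 0
  obtain ⟨η, hη, hηm⟩ := Metric.eventually_nhds_iff.1 (hlim.eventually_lt_const one_lt_two)
  refine ⟨min t₀ (min η (2 / 3 * ε)), by positivity, min_le_left _ _, ?_⟩
  intro Q _ hQ δ hδ0 hδ1 t ht0 htτ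
  obtain ⟨htt₀, htη, htε⟩ : t < t₀ ∧ t < η ∧ t < 2 / 3 * ε := by simpa using htτ
  have hsub : Ico 0 t ⊆ Ico 0 t₀ := Ico_subset_Ico_right htt₀.le
  have hODE' : ∀ x ∈ Q, ∀ s ∈ Ico 0 t,
      HasDerivWithinAt (φ x) (negNormalizedGradient r (φ x s)) (Ico 0 t) s :=
    fun x hx s hs => (hODE x (hQ hx) s (hsub hs)).mono hsub
  have hstay : ∀ x ∈ Q, ∀ s ∈ Ico 0 t, φ x s ∈ S := by
    intro x hx s hs
    have hd := dist_le_of_speed_le (hODE' x hx) (C := (2 / 3)⁻¹) (fun s hs =>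
      norm_negNormalizedGradient_le (by norm_num) (hnorm _ (hφV x (hQ hx) s (hsub hs))).1) hs
    rw [hφ0 x (hQ hx)] at hd
    exact Metric.mem_cthickening_of_dist_le _ x _ _ (hQ hx) (by linarith [hs.2])
  set F : EuclideanSpace ℝ (Fin m) × ℝ → EuclideanSpace ℝ (Fin m) := fun q => φ q.1 q.2
  set B := volume (F '' (Q ×ˢ Ico (δ * t) t))
  have hpiece : ∀ c : ℝ, 0 ≤ c → c ≤ δ * t →
      volume (F '' (Q ×ˢ Ico c (c + (1 - δ) * t))) ≤ 2 * B := by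
    intro c hc0 hc1
    set h := δ * t - c
    have hh0 : 0 ≤ h := by linarith
    have hhη : h < η := by nlinarith
    obtain ⟨M, hM⟩ : ∃ M : NNReal, (M : ℝ) = Real.exp (K * h) :=
      ⟨_, Real.coe_toNNReal _ (Real.exp_pos _).le⟩
    have hle := addHaar_image_le_of_dist_le volume (K := M)
      (f := F) (g := fun q => φ q.1 (q.2 + h)) (s := Q ×ˢ Ico c (c + (1 - δ) * t))
      (fun p hp q hq => hM ▸ dist_le_of_trajectories_backward hK (hODE' p.1 hp.1) (hODE' q.1 hq.1)
        (hstay p.1 hp.1) (hstay q.1 hq.1) (hc0.trans hp.2.1) (hc0.trans hq.2.1) hh0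
        (by linarith [hp.2.2]) (by linarith [hq.2.2]))
    rw [finrank_euclideanSpace_fin] at hle
    refine hle.trans (mul_le_mul' ?_ (measure_mono ?_))
    · have h2 := hηm (y := h) (by rwa [Real.dist_eq, sub_zero, abs_of_nonneg hh0])
      rw [← hM] at h2
      exact_mod_cast h2.le
    · rintro _ ⟨q, hq, rfl⟩
      exact ⟨(q.1, q.2 + h), ⟨hq.1, by linarith [hq.2.1], by linarith [hq.2.2]⟩, rfl⟩
  set N := ⌈1 / (1 - δ)⌉₊
  have hN : (N : ℝ) * 2 ≤ 4 / (1 - δ) := by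
    have h1 : (N : ℝ) < 1 / (1 - δ) + 1 :=
      Nat.ceil_lt_add_one (one_div_nonneg.2 (by linarith))
    have h2 : 1 ≤ 1 / (1 - δ) := by rw [le_div_iff₀ (by linarith)]; linarith
    have h3 : 4 / (1 - δ) = 4 * (1 / (1 - δ)) := by ring
    linarith
  set c : ℕ → ℝ := fun k => min (k * ((1 - δ) * t)) (δ * t)
  have hc0 : ∀ k, 0 ≤ c k := fun k =>
    le_min (mul_nonneg k.cast_nonneg (mul_nonneg (by linarith) ht0.le)) (by positivity)
  have hcover : F '' (Q ×ˢ Ico 0 t) ⊆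
      ⋃ k ∈ Finset.range N, F '' (Q ×ˢ Ico (c k) (c k + (1 - δ) * t)) := by
    rintro _ ⟨q, hq, rfl⟩
    obtain ⟨k, hk, hqk⟩ := mem_iUnion₂.1 (Ico_subset_iUnion_Ico_mul hδ1 ht0 hq.2)
    exact mem_iUnion₂.2 ⟨k, hk, q, ⟨hq.1, hqk⟩, rfl⟩
  calc volume (F '' (Q ×ˢ Ico 0 t))
      ≤ ∑ k ∈ Finset.range N, volume (F '' (Q ×ˢ Ico (c k) (c k + (1 - δ) * t))) :=
        (measure_mono hcover).trans (measure_biUnion_finset_le _ _)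
    _ ≤ ∑ _k ∈ Finset.range N, 2 * B :=
        Finset.sum_le_sum fun k _ => hpiece _ (hc0 k) (min_le_right _ _)
    _ = ENNReal.ofReal (N * 2) * B := by
        rw [ENNReal.ofReal_mul N.cast_nonneg]
        simp [mul_assoc]
    _ ≤ ENNReal.ofReal (4 / (1 - δ)) * B := by gcongr
end

section
/- With the notation of the context, there exist constants C₁ > 1 and τ₂ > 0, depending only on r and n (and in particular independent of the chosen extremal bases), such that for every ζ ∈ bΩ and every ε ∈ (0, τ₂): T_ε^{flow}(ζ) ⊆ T_{C₁ε}(ζ) and T_ε(ζ) ⊆ T_{C₁ε}^{flow}(ζ). -/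
open Set
open scoped RealInnerProductSpace ComplexInnerProductSpace

/-- `τ(ξ,u,ε)`: the distance one can travel from `ξ` in the complex direction `u` while
changing the value of `r` by at most `ε`. -/
noncomputable def tauWidth {n : ℕ} (r : EuclideanSpace ℂ (Fin n) → ℝ)
    (ξ u : EuclideanSpace ℂ (Fin n)) (ε : ℝ) : ℝ :=
  sSup {c : ℝ | 0 < c ∧ ∀ lam : ℂ, ‖lam‖ ≤ c → |r (ξ + lam • u) - r ξ| ≤ ε}

/-- `u` is an `ε`-extremal basis at `ξ` for the defining function `r`: an orthonormal basis
whose first vector spans the complex line of the gradient of `r` at `ξ`, and whose `k`-th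
vector maximizes `τ(ξ,·,ε)` among unit vectors orthogonal to the previous ones. -/
def IsExtremalBasis {n : ℕ} (r : EuclideanSpace ℂ (Fin n) → ℝ)
    (ξ : EuclideanSpace ℂ (Fin n)) (ε : ℝ) (u : Fin n → EuclideanSpace ℂ (Fin n)) : Prop :=
  Orthonormal ℂ u ∧
  (∃ c : ℂ, c ≠ 0 ∧ ∀ i : Fin n, (i : ℕ) = 0 → gradient r ξ = c • u i) ∧
  ∀ k : Fin n, (k : ℕ) ≠ 0 →
    tauWidth r ξ (u k) ε =
      sSup {t : ℝ | ∃ v : EuclideanSpace ℂ (Fin n), ‖v‖ = 1 ∧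
        (∀ j : Fin n, j < k → inner (𝕜 := ℂ) (u j) v = 0) ∧ t = tauWidth r ξ v ε}

/-- The McNeal polydisc `P_ε(ξ)` associated with the basis `u` and the widths `τ(ξ,u_k,ε)`. -/
def polydisc {n : ℕ} (r : EuclideanSpace ℂ (Fin n) → ℝ)
    (ξ : EuclideanSpace ℂ (Fin n)) (ε : ℝ) (u : Fin n → EuclideanSpace ℂ (Fin n)) :
    Set (EuclideanSpace ℂ (Fin n)) :=
  {z | ∃ lam : Fin n → ℂ, (∀ k, ‖lam k‖ ≤ tauWidth r ξ (u k) ε) ∧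
    z = ξ + ∑ k, lam k • u k}

section Symmetry

variable {E F : Type*} [NormedAddCommGroup E] [NormedSpace ℝ E]
  [NormedAddCommGroup F] [NormedSpace ℝ F]

theorem contDiffOn_iteratedFDeriv_of_isOpen {f : E → F} {W : Set E} (hW : IsOpen W)
    (hf : ContDiffOn ℝ (⊤ : ℕ∞) f W) (k : ℕ) :
    ContDiffOn ℝ (⊤ : ℕ∞) (iteratedFDeriv ℝ k f) W := by
  intro x hx
  refine ContDiffAt.contDiffWithinAt ?_
  exact (hf.contDiffAt (hW.mem_nhds hx)).iteratedFDeriv_right (m := ((⊤ : ℕ∞) : WithTop ℕ∞))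
    (by exact_mod_cast le_top)

theorem differentiableAt_iteratedFDeriv_of_isOpen {f : E → F} {W : Set E} (hW : IsOpen W)
    (hf : ContDiffOn ℝ (⊤ : ℕ∞) f W) (k : ℕ) {x : E} (hx : x ∈ W) :
    DifferentiableAt ℝ (iteratedFDeriv ℝ k f) x :=
  ((contDiffOn_iteratedFDeriv_of_isOpen hW hf k).contDiffAt
    (hW.mem_nhds hx)).differentiableAt (by simp)

theorem iteratedFDeriv_comp_swap_zero_one {f : E → F} {W : Set E} (hW : IsOpen W)
    (hfW : ContDiffOn ℝ (⊤ : ℕ∞) f W) {x : E} (hx : x ∈ W) (n : ℕ) (v : Fin (n + 2) → E) :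
    iteratedFDeriv ℝ (n + 2) f x (v ∘ Equiv.swap 0 1) = iteratedFDeriv ℝ (n + 2) f x v := by
  have hf : ContDiffAt ℝ 2 (iteratedFDeriv ℝ n f) x :=
    ((contDiffOn_iteratedFDeriv_of_isOpen hW hfW n).contDiffAt (hW.mem_nhds hx)).of_le
      (WithTop.coe_le_coe.2 (le_top : (2 : ℕ∞) ≤ ⊤))
  have hd : DifferentiableAt ℝ (fderiv ℝ (iteratedFDeriv ℝ n f)) x :=
    (hf.fderiv_right (m := 1) (by norm_num)).differentiableAt one_ne_zero
  have hd' := differentiableAt_iteratedFDeriv_of_isOpen hW hfW (n + 1) hx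
  have key : ∀ w : Fin (n + 2) → E, iteratedFDeriv ℝ (n + 2) f x w =
      (fderiv ℝ (fderiv ℝ (iteratedFDeriv ℝ n f)) x (w 0) (w 1)) (Fin.tail (Fin.tail w)) := by
    intro w
    have h1 : (fun y ↦ iteratedFDeriv ℝ (n + 1) f y (Fin.tail w)) =
        fun y ↦ (fderiv ℝ (iteratedFDeriv ℝ n f) y (w 1)) (Fin.tail (Fin.tail w)) := rfl
    have h2 : DifferentiableAt ℝ (fun y ↦ fderiv ℝ (iteratedFDeriv ℝ n f) y (w 1)) x :=
      hd.clm_apply (differentiableAt_const _)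
    rw [iteratedFDeriv_succ_apply_left, ← fderiv_continuousMultilinear_apply_const_apply hd', h1,
      fderiv_continuousMultilinear_apply_const_apply h2,
      fderiv_clm_apply hd (differentiableAt_const _)]
    simp
  have hsymm : IsSymmSndFDerivAt ℝ (iteratedFDeriv ℝ n f) x :=
    hf.isSymmSndFDerivAt (by simp)
  rw [key, key]
  have h0 : (v ∘ Equiv.swap 0 1) 0 = v 1 := by simp
  have h1 : (v ∘ Equiv.swap 0 1) 1 = v 0 := by simp
  have h2 : Fin.tail (Fin.tail (v ∘ Equiv.swap 0 1)) = Fin.tail (Fin.tail v) := by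
    ext i
    simp only [Fin.tail, Function.comp]
    rw [Equiv.swap_apply_of_ne_of_ne (Fin.succ_ne_zero _)]
    intro h
    have := congrArg Fin.val h
    simp at this
  rw [h0, h1, h2, hsymm.eq]

/-- Iterated derivatives of a smooth function are symmetric. -/
theorem iteratedFDeriv_comp_perm_of_contDiffOn {f : E → F} {W : Set E} (hW : IsOpen W)
    (hf : ContDiffOn ℝ (⊤ : ℕ∞) f W) (n : ℕ) :
    ∀ x ∈ W, ∀ (v : Fin n → E) (σ : Equiv.Perm (Fin n)),
      iteratedFDeriv ℝ n f x (v ∘ σ) = iteratedFDeriv ℝ n f x v := by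
  induction n with
  | zero => intro x _ v σ; congr 1; exact Subsingleton.elim _ _
  | succ n ih =>
    intro x hx v σ
    have hσ : σ ∈ Submonoid.closure
        (Set.range fun i : Fin n ↦ Equiv.swap i.castSucc i.succ) := by
      rw [Equiv.Perm.mclosure_swap_castSucc_succ]; trivial
    induction hσ using Submonoid.closure_induction generalizing v with
    | one => rfl
    | mul a b _ _ ha hb =>
      have : v ∘ ⇑(a * b) = (v ∘ a) ∘ b := rfl
      rw [this, hb, ha]
    | mem a ha =>
      obtain ⟨i, rfl⟩ := ha
      rcases n with _ | n
      · exact i.elim0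
      induction i using Fin.cases with
      | zero =>
        exact iteratedFDeriv_comp_swap_zero_one hW hf hx n v
      | succ j =>
        have hd := differentiableAt_iteratedFDeriv_of_isOpen hW hf (n + 1) hx
        have hap : ∀ w : Fin (n + 1) → E, ∀ u : E,
            fderiv ℝ (iteratedFDeriv ℝ (n + 1) f) x u w =
              fderiv ℝ (fun y ↦ iteratedFDeriv ℝ (n + 1) f y w) x u := by
          intro w u
          rw [fderiv_continuousMultilinear_apply_const_apply hd]
        rw [iteratedFDeriv_succ_apply_left, iteratedFDeriv_succ_apply_left]
        have h0 : (v ∘ Equiv.swap j.succ.castSucc j.succ.succ) 0 = v 0 := by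
          simp only [Function.comp]
          rw [Equiv.swap_apply_of_ne_of_ne]
          · exact fun h ↦ by simpa using congrArg Fin.val h
          · exact (Fin.succ_ne_zero _).symm
        have ht : Fin.tail (v ∘ Equiv.swap j.succ.castSucc j.succ.succ) =
            Fin.tail v ∘ Equiv.swap j.castSucc j.succ := by
          ext i
          simp only [Fin.tail, Function.comp]
          congr 1
          rw [← Fin.succ_castSucc]
          exact ((Fin.succ_injective _).swap_apply _ _ _).symm ▸ rfl
        rw [h0, ht, hap, hap]
        have : (fun y ↦ iteratedFDeriv ℝ (n + 1) f y
            (Fin.tail v ∘ Equiv.swap j.castSucc j.succ)) =ᶠ[nhds x]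
            fun y ↦ iteratedFDeriv ℝ (n + 1) f y (Fin.tail v) := by
          filter_upwards [hW.mem_nhds hx] with y hy
          exact ih y hy _ _
        rw [this.fderiv_eq]

/-- A smooth function whose `n`-th derivative vanishes on the diagonal has vanishing
`n`-th derivative. -/
theorem iteratedFDeriv_eq_zero_of_diagonal {f : E → F} {W : Set E} (hW : IsOpen W)
    (hf : ContDiffOn ℝ (⊤ : ℕ∞) f W) (n : ℕ) {x : E} (hx : x ∈ W)
    (h : ∀ v : E, iteratedFDeriv ℝ n f x (fun _ ↦ v) = 0) : iteratedFDeriv ℝ n f x = 0 := by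
  ext v
  have h1 := (iteratedFDeriv ℝ n f x).iteratedFDeriv_comp_diagonal 0 v
  have h2 : (fun y : E ↦ iteratedFDeriv ℝ n f x fun _ ↦ y) = fun _ ↦ 0 := funext h
  have h3 : ∀ σ : Equiv.Perm (Fin n),
      (iteratedFDeriv ℝ n f x fun i ↦ v (σ i)) = iteratedFDeriv ℝ n f x v :=
    fun σ ↦ iteratedFDeriv_comp_perm_of_contDiffOn hW hf n x hx v σ
  rw [h2, Finset.sum_congr rfl fun σ _ ↦ h3 σ, Finset.sum_const, Finset.card_univ,
    Fintype.card_perm, Fintype.card_fin] at h1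
  have h4 : iteratedFDeriv ℝ n (fun _ : E ↦ (0 : F)) 0 = 0 := by
    rw [iteratedFDeriv_fun_zero]; rfl
  rw [h4] at h1
  have h5 : (n.factorial : ℝ) • iteratedFDeriv ℝ n f x v = 0 := by
    rw [Nat.cast_smul_eq_nsmul]; exact h1.symm
  exact (smul_eq_zero.1 h5).resolve_left (by positivity)

end Symmetry

section Polynomial

/-- The coefficients of a real polynomial are controlled by its size on `[0, 1]`. -/
theorem exists_coeff_bound (m : ℕ) : ∃ C : ℝ, 0 < C ∧ ∀ (a : Fin m → ℝ) (S : ℝ),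
    (∀ t ∈ Icc (0 : ℝ) 1, |∑ k, a k * t ^ (k : ℕ)| ≤ S) → ∀ k, |a k| ≤ C * S := by
  set x : Fin m → ℝ := fun i ↦ (i : ℝ) / m with hx
  set V := Matrix.vandermonde x
  have hV : IsUnit V.det := by
    rw [isUnit_iff_ne_zero, Matrix.det_vandermonde_ne_zero_iff]
    intro i j hij
    have hm : (m : ℝ) ≠ 0 := by
      have : 0 < m := i.pos
      positivity
    have : (i : ℝ) = j := by simpa [hx, div_left_inj' hm] using hij
    exact Fin.ext (by exact_mod_cast this)
  refine ⟨1 + ∑ k, ∑ i, |V⁻¹ k i|, by positivity, fun a S hS k ↦ ?_⟩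
  have ha : a = V⁻¹.mulVec (V.mulVec a) := by
    rw [Matrix.mulVec_mulVec, Matrix.nonsing_inv_mul _ hV, Matrix.one_mulVec]
  have hS0 : 0 ≤ S := (abs_nonneg _).trans (hS 0 (by simp))
  have hb : ∀ i, |V.mulVec a i| ≤ S := by
    intro i
    have hm : (0 : ℝ) < m := by exact_mod_cast i.pos
    have := hS (x i) ⟨by positivity, by
      rw [hx]; simp only; rw [div_le_one hm]; exact_mod_cast i.is_lt.le⟩
    convert this using 2
    simp [V, Matrix.mulVec, dotProduct, Matrix.vandermonde_apply, mul_comm]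
  calc |a k| = |∑ i, V⁻¹ k i * V.mulVec a i| := by
        conv_lhs => rw [ha]
        rfl
    _ ≤ ∑ i, |V⁻¹ k i| * S := by
        refine (Finset.abs_sum_le_sum_abs _ _).trans (Finset.sum_le_sum fun i _ ↦ ?_)
        rw [abs_mul]
        exact mul_le_mul_of_nonneg_left (hb i) (abs_nonneg _)
    _ = (∑ i, |V⁻¹ k i|) * S := by rw [Finset.sum_mul]
    _ ≤ (1 + ∑ k, ∑ i, |V⁻¹ k i|) * S := by
        refine mul_le_mul_of_nonneg_right ?_ hS0
        have := Finset.single_le_sum (f := fun k ↦ ∑ i, |V⁻¹ k i|)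
          (fun k _ ↦ Finset.sum_nonneg fun i _ ↦ abs_nonneg _) (Finset.mem_univ k)
        linarith

/-- Taylor's formula for a sequence of successive derivatives on an interval. -/
theorem taylor_bound_of_hasDerivAt {ρ L : ℝ} (N : ℕ) :
    ∀ G : ℕ → ℝ → ℝ, (∀ k, ∀ t ∈ Icc 0 ρ, HasDerivAt (G k) (G (k + 1) t) t) →
      (∀ t ∈ Icc 0 ρ, |G N t| ≤ L) → ∀ t ∈ Icc 0 ρ,
        |G 0 t - ∑ k ∈ Finset.range N, G k 0 / k.factorial * t ^ k| ≤ L * t ^ N := by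
  induction N with
  | zero => intro G _ hL t ht; simpa using hL t ht
  | succ N ih =>
    intro G hG hL t ht
    have ih' := ih (fun k ↦ G (k + 1)) (fun k ↦ hG (k + 1)) hL
    have hderiv : ∀ s ∈ Icc 0 ρ, HasDerivAt
        (fun s ↦ G 0 s - ∑ k ∈ Finset.range (N + 1), G k 0 / k.factorial * s ^ k)
        (G 1 s - ∑ k ∈ Finset.range N, G (k + 1) 0 / k.factorial * s ^ k) s := by
      intro s hs
      refine (hG 0 s hs).sub ?_
      have : ∀ k ∈ Finset.range (N + 1), HasDerivAt (fun s : ℝ ↦ G k 0 / k.factorial * s ^ k)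
          (G k 0 / k.factorial * (k * s ^ (k - 1))) s :=
        fun k _ ↦ (hasDerivAt_pow k s).const_mul _
      convert HasDerivAt.fun_sum this using 1
      rw [Finset.sum_range_succ']
      simp only [Nat.cast_zero, zero_mul, mul_zero, add_zero, Nat.add_sub_cancel]
      refine Finset.sum_congr rfl fun k _ ↦ ?_
      rw [Nat.factorial_succ]
      have h1 : (k.factorial : ℝ) ≠ 0 := by positivity
      have h2 : ((k : ℝ) + 1) ≠ 0 := by positivity
      push_cast
      field_simp
    have hL0 : 0 ≤ L := (abs_nonneg _).trans (hL t ht)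
    have hsub : Icc 0 t ⊆ Icc 0 ρ := Icc_subset_Icc_right ht.2
    refine image_norm_le_of_norm_deriv_right_le_deriv_boundary (a := 0) (b := t)
      (f := fun s ↦ G 0 s - ∑ k ∈ Finset.range (N + 1), G k 0 / k.factorial * s ^ k)
      (B := fun s ↦ L * s ^ (N + 1)) (B' := fun s ↦ L * ((N + 1 : ℕ) * s ^ N))
      (fun s hs ↦ (hderiv s (hsub hs)).continuousAt.continuousWithinAt)
      (fun s hs ↦ (hderiv s (hsub (Ico_subset_Icc_self hs))).hasDerivWithinAt) ?_
      (fun s ↦ by simpa using (hasDerivAt_pow (N + 1) s).const_mul L) ?_ ⟨ht.1, le_rfl⟩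
    · simp [Finset.sum_range_succ']
    · intro s hs
      refine (ih' s (hsub (Ico_subset_Icc_self hs))).trans ?_
      have : 0 ≤ s ^ N := pow_nonneg hs.1 _
      refine mul_le_mul_of_nonneg_left ?_ hL0
      push_cast
      nlinarith [mul_nonneg (Nat.cast_nonneg (α := ℝ) N) this]

end Polynomial

section Doubling

/-- The Hermitian space `ℂ^n`. -/
abbrev Cn (n : ℕ) := EuclideanSpace ℂ (Fin n)

variable {n : ℕ}

theorem exists_iteratedFDeriv_smul_ne_zero {r : Cn n → ℝ} {W : Set (Cn n)} (hW : IsOpen W)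
    (hr : ContDiffOn ℝ (⊤ : ℕ∞) r W) {p : Cn n} (hp : p ∈ W) (v : Cn n) (k : ℕ)
    (hk : iteratedFDeriv ℝ k (fun lam : ℂ ↦ r (p + lam • v)) 0 ≠ 0) :
    ∃ θ : ℂ, ‖θ‖ = 1 ∧ iteratedFDeriv ℝ k r p (fun _ ↦ θ • v) ≠ 0 := by
  by_contra! hcon
  refine hk ?_
  set g : ℂ →L[ℝ] (Cn n) := (ContinuousLinearMap.toSpanSingleton ℂ v).restrictScalars ℝ with hg
  have hgapp : ∀ z : ℂ, g z = z • v := fun z ↦ by simp [hg]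
  set W' : Set (Cn n) := (fun y ↦ p + y) ⁻¹' W
  have hW' : IsOpen W' := hW.preimage (by fun_prop)
  have hr' : ContDiffOn ℝ (⊤ : ℕ∞) (fun y ↦ r (p + y)) W' :=
    hr.comp (by fun_prop) fun y hy ↦ hy
  have hgW : IsOpen (g ⁻¹' W') := hW'.preimage g.continuous
  have hf : (fun lam : ℂ ↦ r (p + lam • v)) = (fun y ↦ r (p + y)) ∘ g := by
    ext z; simp [hgapp]
  have h0 : (0 : ℂ) ∈ g ⁻¹' W' := by simpa [W'] using hp
  refine iteratedFDeriv_eq_zero_of_diagonal hgW (hf ▸ hr'.comp g.contDiff.contDiffOn fun y hy ↦ hy)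
    k h0 fun z ↦ ?_
  have hcomp := g.iteratedFDerivWithin_comp_right hr' hW'.uniqueDiffOn hgW.uniqueDiffOn h0
    (i := k) (by exact_mod_cast le_top)
  rw [iteratedFDerivWithin_of_isOpen k hgW h0,
    iteratedFDerivWithin_of_isOpen k hW' h0, iteratedFDeriv_comp_add_left] at hcomp
  rw [hf, hcomp]
  simp only [zero_smul, add_zero, ContinuousMultilinearMap.compContinuousLinearMap_apply, hgapp]
  obtain ⟨θ, hθ, hz⟩ : ∃ θ : ℂ, ‖θ‖ = 1 ∧ z = ((‖z‖ : ℝ) : ℂ) * θ := by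
    rcases eq_or_ne z 0 with rfl | hz
    · exact ⟨1, by simp, by simp⟩
    · have : (‖z‖ : ℂ) ≠ 0 := by simpa using hz
      exact ⟨z / ‖z‖, by simp [hz], by field_simp⟩
  have : (fun _ : Fin k ↦ z • v) = fun _ ↦ ‖z‖ • (θ • v) := by
    funext _
    rw [← Complex.coe_smul, smul_smul, ← hz]
  rw [this, ContinuousMultilinearMap.map_smul_univ _ (fun _ ↦ ‖z‖) (fun _ ↦ θ • v), hcon θ hθ,
    smul_zero]

/-- Uniform lower bound for the jets of `r` along complex lines, over a compact set of
points of finite type. -/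
theorem exists_uniform_type_bound {r : Cn n → ℝ} {W K : Set (Cn n)} (hW : IsOpen W)
    (hr : ContDiffOn ℝ (⊤ : ℕ∞) r W) (hK : IsCompact K) (hKW : K ⊆ W) (M : ℕ)
    (hfin : ∀ p ∈ K, ∀ v : Cn n, ‖v‖ = 1 →
      ∃ k ≤ M, iteratedFDeriv ℝ k (fun lam : ℂ ↦ r (p + lam • v)) 0 ≠ 0) :
    ∃ c : ℝ, 0 < c ∧ ∀ p ∈ K, ∀ v : Cn n, ‖v‖ = 1 → ∃ θ : ℂ, ‖θ‖ = 1 ∧ ∃ k ≤ M,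
      c ≤ |iteratedFDeriv ℝ k r p (fun _ ↦ θ • v)| := by
  have hcpt : IsCompact (K ×ˢ Metric.sphere (0 : Cn n) 1) := hK.prod (isCompact_sphere _ _)
  suffices ∃ c : ℝ, 0 < c ∧ ∀ q ∈ K ×ˢ Metric.sphere (0 : Cn n) 1, ∃ θ : ℂ, ‖θ‖ = 1 ∧ ∃ k ≤ M,
      c ≤ |iteratedFDeriv ℝ k r q.1 (fun _ ↦ θ • q.2)| by
    obtain ⟨c, hc, h⟩ := this
    exact ⟨c, hc, fun p hp v hv ↦ h (p, v) ⟨hp, by simpa using hv⟩⟩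
  refine hcpt.induction_on (p := fun s ↦ ∃ c : ℝ, 0 < c ∧ ∀ q ∈ s, ∃ θ : ℂ, ‖θ‖ = 1 ∧ ∃ k ≤ M,
      c ≤ |iteratedFDeriv ℝ k r q.1 (fun _ ↦ θ • q.2)|) ⟨1, one_pos, by simp⟩ ?_ ?_ ?_
  · rintro s t hst ⟨c, hc, h⟩
    exact ⟨c, hc, fun q hq ↦ h q (hst hq)⟩
  · rintro s t ⟨c, hc, h⟩ ⟨c', hc', h'⟩
    refine ⟨min c c', lt_min hc hc', ?_⟩
    rintro q (hq | hq)
    · obtain ⟨θ, hθ, k, hk, hb⟩ := h q hq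
      exact ⟨θ, hθ, k, hk, (min_le_left _ _).trans hb⟩
    · obtain ⟨θ, hθ, k, hk, hb⟩ := h' q hq
      exact ⟨θ, hθ, k, hk, (min_le_right _ _).trans hb⟩
  · rintro ⟨p, v⟩ ⟨hp, hv⟩
    obtain ⟨k, hk, hne⟩ := hfin p hp v (by simpa using hv)
    obtain ⟨θ, hθ, hne'⟩ := exists_iteratedFDeriv_smul_ne_zero hW hr (hKW hp) v k hne
    have hcont : ContinuousAt
        (fun q : Cn n × Cn n ↦ |iteratedFDeriv ℝ k r q.1 (fun _ ↦ θ • q.2)|) (p, v) := by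
      refine ContinuousAt.abs ?_
      have h1 : ContinuousAt (fun q : Cn n × Cn n ↦ iteratedFDeriv ℝ k r q.1) (p, v) :=
        ContinuousAt.comp (f := Prod.fst) (g := iteratedFDeriv ℝ k r)
          (differentiableAt_iteratedFDeriv_of_isOpen hW hr k (hKW hp)).continuousAt
          continuousAt_fst
      have h2 : ContinuousAt (fun q : Cn n × Cn n ↦ fun _ : Fin k ↦ θ • q.2) (p, v) := by fun_prop
      exact h1.eval h2
    have hpos : 0 < |iteratedFDeriv ℝ k r p (fun _ ↦ θ • v)| := abs_pos.2 hne'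
    have hev := hcont.eventually (lt_mem_nhds (half_lt_self hpos))
    exact ⟨_, mem_nhdsWithin_of_mem_nhds hev, _, half_pos hpos,
      fun q hq ↦ ⟨θ, hθ, k, hk, le_of_lt hq⟩⟩

/-- Taylor expansion of `r` along real lines issued from points of `K`, with uniform remainder. -/
theorem exists_line_taylor_bound {r : Cn n → ℝ} {W K : Set (Cn n)} (hW : IsOpen W)
    (hr : ContDiffOn ℝ (⊤ : ℕ∞) r W) (hK : IsCompact K) {d : ℝ}
    (hdW : Metric.cthickening d K ⊆ W) (N : ℕ) :
    ∃ L : ℝ, 0 < L ∧ ∀ p ∈ K, ∀ w : Cn n, ‖w‖ = 1 → ∀ t ∈ Icc 0 d,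
      |r (p + t • w) - ∑ k ∈ Finset.range N,
        iteratedFDeriv ℝ k r p (fun _ ↦ w) / k.factorial * t ^ k| ≤ L * t ^ N := by
  obtain ⟨L, hL⟩ := hK.cthickening.exists_bound_of_continuousOn (f := iteratedFDeriv ℝ N r)
    ((contDiffOn_iteratedFDeriv_of_isOpen hW hr N).continuousOn.mono hdW)
  refine ⟨max L 1, by positivity, fun p hp w hw t ht ↦ ?_⟩
  have hmem : ∀ s ∈ Icc 0 d, p + s • w ∈ Metric.cthickening d K := by
    intro s hs
    refine Metric.closedBall_subset_cthickening hp d ?_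
    simpa [norm_smul, hw, abs_of_nonneg hs.1] using hs.2
  have key := taylor_bound_of_hasDerivAt (ρ := d) (L := max L 1) N
    (fun k s ↦ iteratedFDeriv ℝ k r (p + s • w) (fun _ ↦ w)) ?_ ?_ t ht
  · simpa using key
  · intro k s hs
    have hd := differentiableAt_iteratedFDeriv_of_isOpen hW hr k (hdW (hmem s hs))
    have hline : HasDerivAt (fun s : ℝ ↦ p + s • w) w s := by
      simpa using ((hasDerivAt_id s).smul_const w).const_add p
    have h1 : HasFDerivAt (fun y ↦ iteratedFDeriv ℝ k r y (fun _ ↦ w))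
        (fderiv ℝ (fun y ↦ iteratedFDeriv ℝ k r y (fun _ ↦ w)) (p + s • w)) (p + s • w) :=
      (DifferentiableAt.continuousMultilinear_apply_const hd _).hasFDerivAt
    have h2 := h1.comp_hasDerivAt s hline
    rw [fderiv_continuousMultilinear_apply_const_apply hd] at h2
    rw [iteratedFDeriv_succ_apply_left]
    exact h2
  · intro s hs
    have h := (iteratedFDeriv ℝ N r (p + s • w)).le_opNorm (fun _ ↦ w)
    simp only [hw, Finset.prod_const_one, mul_one] at h
    exact h.trans <| (hL _ (hmem s hs)).trans (le_max_left _ _)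

/-- Doubling property of finite type functions along complex lines: control of `r` on a small
disc gives control on a larger concentric disc, and bounds the radius of the disc. -/
theorem exists_doubling {r : Cn n → ℝ} {W K : Set (Cn n)} (hW : IsOpen W)
    (hr : ContDiffOn ℝ (⊤ : ℕ∞) r W) (hK : IsCompact K) {d : ℝ} (hd : 0 < d)
    (hdW : Metric.cthickening d K ⊆ W) (M : ℕ)
    (hfin : ∀ p ∈ K, ∀ v : Cn n, ‖v‖ = 1 →
      ∃ k ≤ M, iteratedFDeriv ℝ k (fun lam : ℂ ↦ r (p + lam • v)) 0 ≠ 0)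
    {A : ℝ} (hA : 1 ≤ A) :
    ∃ C δ₀ : ℝ, 1 ≤ C ∧ 0 < δ₀ ∧ A * δ₀ ≤ d ∧ ∀ p ∈ K, ∀ x : Cn n, x ≠ 0 → ‖x‖ ≤ δ₀ → ∀ ε : ℝ,
      (∀ lam : ℂ, ‖lam‖ ≤ 1 → |r (p + lam • x)| ≤ ε) →
        ‖x‖ ^ M ≤ C * ε ∧ ∀ lam : ℂ, ‖lam‖ ≤ A → |r (p + lam • x)| ≤ C * ε := by
  have hKW : K ⊆ W := (Metric.self_subset_cthickening K).trans hdW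
  obtain ⟨L, hL, hT⟩ := exists_line_taylor_bound hW hr hK hdW (M + 1)
  obtain ⟨D, hD, hco⟩ := exists_coeff_bound (M + 1)
  obtain ⟨c₀, hc₀, htype⟩ := exists_uniform_type_bound hW hr hK hKW M hfin
  set c : ℝ := c₀ / M.factorial with hc_def
  have hc : 0 < c := by positivity
  set B : ℝ := 1 + L * (2 * D / c) with hB
  have hB1 : 0 < B := by positivity
  refine ⟨1 + 2 * D / c + A ^ (M + 1) * ((M + 1) * (D * B) + L * (2 * D / c)),
    min (min 1 (d / A)) (c / (2 * D * L)), ?_, by positivity, ?_, ?_⟩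
  · have : 0 ≤ 2 * D / c + A ^ (M + 1) * ((M + 1) * (D * B) + L * (2 * D / c)) := by positivity
    linarith
  · calc A * min (min 1 (d / A)) (c / (2 * D * L)) ≤ A * (d / A) := by
          gcongr
          exact (min_le_left _ _).trans (min_le_right _ _)
      _ = d := by field_simp
  intro p hp x hx0 hxδ ε hε
  set δ := ‖x‖ with hδ
  have hδ0 : 0 < δ := norm_pos_iff.2 hx0
  have hδ1 : δ ≤ 1 := hxδ.trans ((min_le_left _ _).trans (min_le_left _ _))
  have hδd : A * δ ≤ d := by
    have := hxδ.trans ((min_le_left _ _).trans (min_le_right _ _))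
    rw [le_div_iff₀ (by positivity)] at this
    linarith
  have hδc : D * (L * δ) ≤ c / 2 := by
    have := hxδ.trans (min_le_right _ _)
    rw [le_div_iff₀ (by positivity)] at this
    linarith
  have hδd' : δ ≤ d := by nlinarith
  have hε0 : 0 ≤ ε := (abs_nonneg _).trans (hε 0 (by simp))
  set v : Cn n := δ⁻¹ • x with hv
  have hv1 : ‖v‖ = 1 := by
    rw [hv, norm_smul, norm_inv, Real.norm_of_nonneg hδ0.le, ← hδ, inv_mul_cancel₀ hδ0.ne']
  have hxv : x = δ • v := by rw [hv, smul_smul, mul_inv_cancel₀ hδ0.ne', one_smul]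
  have hsm : ∀ (s : ℝ) (θ : ℂ), ((s : ℂ) * θ) • x = (s * δ) • (θ • v) := by
    intro s θ
    rw [hxv, ← Complex.coe_smul, ← Complex.coe_smul, smul_smul, smul_smul]
    congr 1
    push_cast
    ring
  have hpow : L * δ ^ (M + 1) = (L * δ) * δ ^ M := by ring
  have hcoef : ∀ θ : ℂ, ‖θ‖ = 1 → ∀ k ≤ M,
      |iteratedFDeriv ℝ k r p (fun _ ↦ θ • v) / k.factorial| * δ ^ k ≤
        D * (ε + L * δ ^ (M + 1)) := by
    intro θ hθ k hk
    have := hco (fun k ↦ iteratedFDeriv ℝ k r p (fun _ ↦ θ • v) / (k : ℕ).factorial * δ ^ (k : ℕ))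
      (ε + L * δ ^ (M + 1)) ?_ ⟨k, Nat.lt_succ_of_le hk⟩
    · rwa [abs_mul, abs_of_nonneg (pow_nonneg hδ0.le _)] at this
    intro t ht
    have h1 := hT p hp (θ • v) (by rw [norm_smul, hθ, hv1, one_mul]) (t * δ)
      ⟨mul_nonneg ht.1 hδ0.le, by nlinarith [ht.1, ht.2]⟩
    have h2 := hε ((t : ℂ) * θ) (by
      rw [norm_mul, hθ, mul_one, Complex.norm_real, Real.norm_of_nonneg ht.1]; exact ht.2)
    rw [hsm] at h2
    have h3 : ∑ k : Fin (M + 1), iteratedFDeriv ℝ k r p (fun _ ↦ θ • v) / (k : ℕ).factorial *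
        δ ^ (k : ℕ) * t ^ (k : ℕ) = ∑ k ∈ Finset.range (M + 1),
        iteratedFDeriv ℝ k r p (fun _ ↦ θ • v) / k.factorial * (t * δ) ^ k := by
      rw [Finset.sum_range]
      refine Finset.sum_congr rfl fun k _ ↦ ?_
      rw [mul_pow]; ring
    rw [h3]
    have h4 : (t * δ) ^ (M + 1) ≤ δ ^ (M + 1) :=
      pow_le_pow_left₀ (mul_nonneg ht.1 hδ0.le) (by nlinarith [ht.2]) _
    have h5 := mul_le_mul_of_nonneg_left h4 hL.le
    rw [abs_le] at h1 h2 ⊢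
    constructor <;> linarith [h1.1, h1.2, h2.1, h2.2]
  have hδM : δ ^ M ≤ 2 * D / c * ε := by
    obtain ⟨θ, hθ, k, hk, hb⟩ := htype p hp v hv1
    have h1 := hcoef θ hθ k hk
    have h2 : c * δ ^ M ≤
        |iteratedFDeriv ℝ k r p (fun _ ↦ θ • v) / k.factorial| * δ ^ k := by
      refine mul_le_mul ?_ (pow_le_pow_of_le_one hδ0.le hδ1 hk) (by positivity) (abs_nonneg _)
      rw [abs_div, hc_def, Nat.abs_cast]
      gcongr
    have h3 : D * (L * δ ^ (M + 1)) ≤ c / 2 * δ ^ M := by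
      rw [hpow, ← mul_assoc]
      exact mul_le_mul_of_nonneg_right hδc (by positivity)
    rw [div_mul_eq_mul_div, le_div_iff₀ hc]
    nlinarith
  have hδM1 : δ ^ (M + 1) ≤ 2 * D / c * ε := by
    refine le_trans ?_ hδM
    exact pow_le_pow_of_le_one hδ0.le hδ1 (Nat.le_succ _)
  have hBε : ε + L * δ ^ (M + 1) ≤ B * ε := by
    have := mul_le_mul_of_nonneg_left hδM1 hL.le
    rw [hB]; linarith
  refine ⟨hδM.trans (mul_le_mul_of_nonneg_right ?_ hε0), fun lam hlam ↦ ?_⟩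
  · have : 0 ≤ 1 + A ^ (M + 1) * ((M + 1) * (D * B) + L * (2 * D / c)) := by positivity
    linarith
  obtain ⟨θ, hθ, hz⟩ : ∃ θ : ℂ, ‖θ‖ = 1 ∧ lam = ((‖lam‖ : ℝ) : ℂ) * θ := by
    rcases eq_or_ne lam 0 with rfl | hz
    · exact ⟨1, by simp, by simp⟩
    · have : (‖lam‖ : ℂ) ≠ 0 := by simpa using hz
      exact ⟨lam / ‖lam‖, by simp [hz], by field_simp⟩
  rw [hz, hsm]
  set t := ‖lam‖ with ht
  have ht0 : 0 ≤ t := norm_nonneg _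
  have h1 := hT p hp (θ • v) (by rw [norm_smul, hθ, hv1, one_mul]) (t * δ)
      ⟨mul_nonneg ht0 hδ0.le, by nlinarith⟩
  have hAk : ∀ k ≤ M + 1, t ^ k ≤ A ^ (M + 1) := fun k hk ↦
    (pow_le_pow_left₀ ht0 hlam k).trans (pow_le_pow_right₀ hA hk)
  have h2 : |∑ k ∈ Finset.range (M + 1),
      iteratedFDeriv ℝ k r p (fun _ ↦ θ • v) / k.factorial * (t * δ) ^ k| ≤
      ∑ k ∈ Finset.range (M + 1), A ^ (M + 1) * (D * (B * ε)) := by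
    refine (Finset.abs_sum_le_sum_abs _ _).trans (Finset.sum_le_sum fun k hk ↦ ?_)
    have hk' : k ≤ M := Nat.lt_succ_iff.1 (Finset.mem_range.1 hk)
    rw [abs_mul, abs_of_nonneg (by positivity : 0 ≤ (t * δ) ^ k), mul_pow]
    have h3 := (hcoef θ hθ k hk').trans (mul_le_mul_of_nonneg_left hBε hD.le)
    calc |iteratedFDeriv ℝ k r p (fun _ ↦ θ • v) / k.factorial| * (t ^ k * δ ^ k)
        = t ^ k * (|iteratedFDeriv ℝ k r p (fun _ ↦ θ • v) / k.factorial| * δ ^ k) := by ring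
      _ ≤ A ^ (M + 1) * (D * (B * ε)) := by
        refine mul_le_mul (hAk k (by omega)) h3 (by positivity) (by positivity)
  have h3 : L * (t * δ) ^ (M + 1) ≤ A ^ (M + 1) * (L * (2 * D / c * ε)) := by
    rw [mul_pow]
    calc L * (t ^ (M + 1) * δ ^ (M + 1)) = t ^ (M + 1) * (L * δ ^ (M + 1)) := by ring
      _ ≤ A ^ (M + 1) * (L * (2 * D / c * ε)) :=
        mul_le_mul (hAk _ le_rfl) (mul_le_mul_of_nonneg_left hδM1 hL.le) (by positivity)
          (by positivity)
  rw [Finset.sum_const, Finset.card_range, nsmul_eq_mul] at h2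
  push_cast at h2
  have h4 : 0 ≤ (1 + 2 * D / c) * ε := by positivity
  have h5 := abs_add_le (∑ k ∈ Finset.range (M + 1),
    iteratedFDeriv ℝ k r p (fun _ ↦ θ • v) / k.factorial * (t * δ) ^ k)
    (r (p + (t * δ) • θ • v) - ∑ k ∈ Finset.range (M + 1),
    iteratedFDeriv ℝ k r p (fun _ ↦ θ • v) / k.factorial * (t * δ) ^ k)
  rw [add_sub_cancel] at h5
  have h6 := h5.trans (add_le_add h2 (h1.trans h3))
  refine h6.trans (sub_nonneg.1 (h4.trans_eq ?_))
  ring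

end Doubling

section Disc

variable {n : ℕ}

/-- `|r| ≤ ε` on the closed complex disc with centre `ζ` and radius vector `x`. -/
def DiscBound (r : Cn n → ℝ) (ζ x : Cn n) (ε : ℝ) : Prop :=
  ∀ lam : ℂ, ‖lam‖ ≤ 1 → |r (ζ + lam • x)| ≤ ε

variable {r : Cn n → ℝ} {W : Set (Cn n)} {ζ x y v : Cn n} {ε η d ρ : ℝ}

theorem DiscBound.mono (h : DiscBound r ζ x ε) (hε : ε ≤ η) : DiscBound r ζ x η :=
  fun lam hlam ↦ (h lam hlam).trans hε

theorem DiscBound.smul (h : DiscBound r ζ x ε) {μ : ℂ} (hμ : ‖μ‖ ≤ 1) :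
    DiscBound r ζ (μ • x) ε := by
  intro lam hlam
  rw [smul_smul]
  exact h _ (by rw [norm_mul]; exact mul_le_one₀ hlam (norm_nonneg _) hμ)

theorem discBound_of_norm_le (hlip : ∀ y : Cn n, ‖y‖ ≤ d → |r (ζ + y)| ≤ 2 * ‖y‖)
    (hx : ‖x‖ ≤ d) (hε : 2 * ‖x‖ ≤ ε) : DiscBound r ζ x ε := by
  intro lam hlam
  have h : ‖lam • x‖ ≤ ‖x‖ := by
    rw [norm_smul]; exact mul_le_of_le_one_left (norm_nonneg _) hlam
  linarith [hlip _ (h.trans hx)]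

theorem mem_of_norm_le_of_closedBall_subset (hball : Metric.closedBall ζ d ⊆ W) (hx : ‖x‖ ≤ d) :
    ζ + x ∈ W := hball (by simpa using hx)

/-- Around a zero of a convex function, upper bounds on symmetric sets are two-sided bounds. -/
theorem discBound_of_forall_le (hconv : ConvexOn ℝ W r) (hball : Metric.closedBall ζ d ⊆ W)
    (hζ : r ζ = 0) (hx : ‖x‖ ≤ d) (h : ∀ lam : ℂ, ‖lam‖ ≤ 1 → r (ζ + lam • x) ≤ ε) :
    DiscBound r ζ x ε := by
  intro lam hlam
  have hn : ∀ μ : ℂ, ‖μ‖ ≤ 1 → ζ + μ • x ∈ W := fun μ hμ ↦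
    mem_of_norm_le_of_closedBall_subset hball <| by
      rw [norm_smul]; exact (mul_le_of_le_one_left (norm_nonneg _) hμ).trans hx
  have hc := hconv.2 (hn lam hlam) (hn (-lam) (by rwa [norm_neg]))
    (by norm_num : (0 : ℝ) ≤ 1 / 2) (by norm_num : (0 : ℝ) ≤ 1 / 2) (by norm_num)
  have he : (1 / 2 : ℝ) • (ζ + lam • x) + (1 / 2 : ℝ) • (ζ + (-lam) • x) = ζ := by
    rw [neg_smul]; module
  rw [he, hζ, smul_eq_mul, smul_eq_mul] at hc
  have h1 := h lam hlam
  have h2 := h (-lam) (by rwa [norm_neg])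
  rw [abs_le]
  constructor <;> linarith

theorem DiscBound.sum (hconv : ConvexOn ℝ W r) (hball : Metric.closedBall ζ d ⊆ W)
    (hζ : r ζ = 0) {ι : Type*} {s : Finset ι} {a : ι → ℝ} {p : ι → Cn n} (ha : ∀ i ∈ s, 0 ≤ a i)
    (ha1 : ∑ i ∈ s, a i = 1) (hp : ∀ i ∈ s, ‖p i‖ ≤ d) (h : ∀ i ∈ s, DiscBound r ζ (p i) ε) :
    ‖∑ i ∈ s, a i • p i‖ ≤ d ∧ DiscBound r ζ (∑ i ∈ s, a i • p i) ε := by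
  have hnorm : ‖∑ i ∈ s, a i • p i‖ ≤ d := by
    have := (convex_closedBall (0 : Cn n) d).sum_mem ha ha1 (z := p) (by simpa using hp)
    simpa using this
  refine ⟨hnorm, discBound_of_forall_le hconv hball hζ hnorm fun lam hlam ↦ ?_⟩
  have hmem : ∀ i ∈ s, ζ + lam • p i ∈ W := fun i hi ↦
    mem_of_norm_le_of_closedBall_subset hball <| by
      rw [norm_smul]; exact (mul_le_of_le_one_left (norm_nonneg _) hlam).trans (hp i hi)
  have he : ζ + lam • ∑ i ∈ s, a i • p i = ∑ i ∈ s, a i • (ζ + lam • p i) := by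
    simp only [smul_add, Finset.sum_add_distrib, ← Finset.sum_smul, ha1, one_smul]
    rw [Finset.smul_sum]
    congr 1
    exact Finset.sum_congr rfl fun i _ ↦ smul_comm _ _ _
  rw [he]
  refine (hconv.map_sum_le ha ha1 hmem).trans ?_
  calc ∑ i ∈ s, a i • r (ζ + lam • p i) ≤ ∑ i ∈ s, a i * ε :=
        Finset.sum_le_sum fun i hi ↦
          mul_le_mul_of_nonneg_left ((le_abs_self _).trans (h i hi lam hlam)) (ha i hi)
    _ = ε := by rw [← Finset.sum_mul, ha1, one_mul]

theorem DiscBound.half_add (hconv : ConvexOn ℝ W r) (hball : Metric.closedBall ζ d ⊆ W)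
    (hζ : r ζ = 0) (hx : ‖x‖ ≤ d) (hy : ‖y‖ ≤ d) (h : DiscBound r ζ x ε)
    (h' : DiscBound r ζ y ε) :
    ‖(1 / 2 : ℝ) • (x + y)‖ ≤ d ∧ DiscBound r ζ ((1 / 2 : ℝ) • (x + y)) ε := by
  have := DiscBound.sum hconv hball hζ (s := Finset.univ) (a := fun _ : Fin 2 ↦ (1 / 2 : ℝ))
    (p := ![x, y]) (ε := ε) (by simp) (by simp) (by simp [Fin.forall_fin_two, hx, hy])
    (by simp [Fin.forall_fin_two, h, h'])
  simpa [Fin.sum_univ_two, smul_add] using this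

theorem lt_of_discBound (hnar : ∀ x : Cn n, ‖x‖ = ρ → ¬ DiscBound r ζ x ε) (hρ : 0 < ρ)
    (h : DiscBound r ζ x ε) : ‖x‖ < ρ := by
  by_contra! hlt
  have hx : 0 < ‖x‖ := hρ.trans_le hlt
  refine hnar (((ρ / ‖x‖ : ℝ) : ℂ) • x) ?_ (h.smul ?_)
  · rw [norm_smul, Complex.norm_real, Real.norm_of_nonneg (by positivity)]
    field_simp
  · rw [Complex.norm_real, Real.norm_of_nonneg (by positivity)]
    exact div_le_one_of_le₀ hlt hx.le

theorem discBound_smul_of_forall (hζ : r ζ = 0) {c : ℝ} {μ : ℂ}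
    (h : ∀ lam : ℂ, ‖lam‖ ≤ c → |r (ζ + lam • v) - r ζ| ≤ ε) (hμ : ‖μ‖ ≤ c) :
    DiscBound r ζ (μ • v) ε := by
  intro lam hlam
  have := h (lam * μ) (by
    rw [norm_mul]; exact (mul_le_of_le_one_left (norm_nonneg _) hlam).trans hμ)
  rwa [hζ, sub_zero, mul_smul] at this

theorem tauWidth_set_lt (hζ : r ζ = 0) (hnar : ∀ x : Cn n, ‖x‖ = ρ → ¬ DiscBound r ζ x ε)
    (hρ : 0 < ρ) (hv : ‖v‖ = 1) {c : ℝ}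
    (hc : c ∈ {c : ℝ | 0 < c ∧ ∀ lam : ℂ, ‖lam‖ ≤ c → |r (ζ + lam • v) - r ζ| ≤ ε}) : c < ρ := by
  have h := lt_of_discBound hnar hρ (discBound_smul_of_forall hζ hc.2 (μ := (c : ℂ))
    (by rw [Complex.norm_real, Real.norm_of_nonneg hc.1.le]))
  rwa [norm_smul, hv, mul_one, Complex.norm_real, Real.norm_of_nonneg hc.1.le] at h

theorem tauWidth_nonneg : 0 ≤ tauWidth r ζ v ε :=
  Real.sSup_nonneg fun _ hc ↦ hc.1.le

theorem tauWidth_le (hζ : r ζ = 0) (hnar : ∀ x : Cn n, ‖x‖ = ρ → ¬ DiscBound r ζ x ε)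
    (hρ : 0 < ρ) (hv : ‖v‖ = 1) : tauWidth r ζ v ε ≤ ρ :=
  Real.sSup_le (fun _ hc ↦ (tauWidth_set_lt hζ hnar hρ hv hc).le) hρ.le

theorem le_tauWidth (hζ : r ζ = 0) (hnar : ∀ x : Cn n, ‖x‖ = ρ → ¬ DiscBound r ζ x ε)
    (hρ : 0 < ρ) (hv : ‖v‖ = 1) {μ : ℂ} (h : DiscBound r ζ (μ • v) ε) :
    ‖μ‖ ≤ tauWidth r ζ v ε := by
  rcases eq_or_ne μ 0 with rfl | hμ
  · simpa using tauWidth_nonneg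
  refine le_csSup ⟨ρ, fun c hc ↦ (tauWidth_set_lt hζ hnar hρ hv hc).le⟩
    ⟨norm_pos_iff.2 hμ, fun lam hlam ↦ ?_⟩
  have := h (lam / μ) (by
    rw [norm_div]; exact div_le_one_of_le₀ hlam (norm_nonneg _))
  rwa [smul_smul, div_mul_cancel₀ _ hμ, ← sub_zero (r _), ← hζ] at this

theorem discBound_of_le_tauWidth (hcont : ContinuousOn r W) (hW : IsOpen W)
    (hball : Metric.closedBall ζ d ⊆ W) (hζ : r ζ = 0)
    (hnar : ∀ x : Cn n, ‖x‖ = ρ → ¬ DiscBound r ζ x ε) (hρ : 0 < ρ) (hρd : ρ ≤ d) (hε : 0 ≤ ε)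
    (hv : ‖v‖ = 1) {μ : ℂ} (hμ : ‖μ‖ ≤ tauWidth r ζ v ε) : DiscBound r ζ (μ • v) ε := by
  have hlt : ∀ μ : ℂ, ‖μ‖ < tauWidth r ζ v ε → DiscBound r ζ (μ • v) ε := by
    intro μ hμ
    rcases Set.eq_empty_or_nonempty
      {c : ℝ | 0 < c ∧ ∀ lam : ℂ, ‖lam‖ ≤ c → |r (ζ + lam • v) - r ζ| ≤ ε} with he | hne
    · rw [tauWidth, he, Real.sSup_empty] at hμ
      exact absurd hμ (norm_nonneg _).not_gt
    · obtain ⟨c, hc, hlt⟩ := exists_lt_of_lt_csSup hne hμ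
      exact discBound_smul_of_forall hζ hc.2 hlt.le
  rcases hμ.lt_or_eq with h | h
  · exact hlt μ h
  rcases eq_or_ne μ 0 with rfl | hμ0
  · intro lam _
    simpa [hζ] using hε
  intro lam hlam
  have hmem : ζ + lam • μ • v ∈ W := mem_of_norm_le_of_closedBall_subset hball <| by
    rw [norm_smul, norm_smul, hv, mul_one]
    exact (mul_le_of_le_one_left (norm_nonneg _) hlam).trans
      (hμ.trans ((tauWidth_le hζ hnar hρ hv).trans hρd))
  have hat : ContinuousAt r (ζ + lam • μ • v) := hcont.continuousAt (hW.mem_nhds hmem)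
  have hline : Filter.Tendsto (fun s : ℝ ↦ ζ + lam • ((s : ℂ) * μ) • v)
      (nhdsWithin 1 (Iio 1)) (nhds (ζ + lam • μ • v)) := by
    have : Continuous (fun s : ℝ ↦ ζ + lam • ((s : ℂ) * μ) • v) := by fun_prop
    simpa using (this.tendsto 1).mono_left nhdsWithin_le_nhds
  refine le_of_tendsto (hat.tendsto.comp hline).abs ?_
  filter_upwards [Ioo_mem_nhdsLT (zero_lt_one (α := ℝ))] with s hs
  refine hlt _ ?_ lam hlam
  rw [norm_mul, Complex.norm_real, Real.norm_of_nonneg hs.1.le, ← h]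
  exact mul_lt_of_lt_one_left (norm_pos_iff.2 hμ0) hs.2

theorem IsExtremalBasis.tauWidth_le {u : Fin n → Cn n} (hu : IsExtremalBasis r ζ ε u)
    (hζ : r ζ = 0) (hnar : ∀ x : Cn n, ‖x‖ = ρ → ¬ DiscBound r ζ x ε) (hρ : 0 < ρ) {k : Fin n}
    (hk : (k : ℕ) ≠ 0) (hv : ‖v‖ = 1) (hperp : ∀ j < k, inner ℂ (u j) v = 0) :
    tauWidth r ζ v ε ≤ tauWidth r ζ (u k) ε := by
  rw [hu.2.2 k hk]
  refine le_csSup ⟨ρ, ?_⟩ ⟨v, hv, hperp, rfl⟩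
  rintro t ⟨w, hw, -, rfl⟩
  exact _root_.tauWidth_le hζ hnar hρ hw

/-- First order characterization of convexity. -/
theorem inner_gradient_le_of_convexOn (hconv : ConvexOn ℝ W r) (hζW : ζ ∈ W) (hyW : ζ + y ∈ W)
    (hdiff : DifferentiableAt ℝ r ζ) : inner ℝ (gradient r ζ) y ≤ r (ζ + y) - r ζ := by
  have hg : HasDerivAt (fun s : ℝ ↦ r (ζ + s • y)) (inner ℝ (gradient r ζ) y) 0 := by
    have h1 : HasFDerivAt r (InnerProductSpace.toDual ℝ (Cn n) (gradient r ζ))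
        (ζ + (0 : ℝ) • y) := by
      simpa using hdiff.hasGradientAt.hasFDerivAt
    have h2 : HasDerivAt (fun s : ℝ ↦ ζ + s • y) y 0 := by
      simpa using ((hasDerivAt_id (0 : ℝ)).smul_const y).const_add ζ
    simpa [Function.comp_def] using h1.comp_hasDerivAt 0 h2
  have hc : ConvexOn ℝ (Icc (0 : ℝ) 1) (fun s : ℝ ↦ r (ζ + s • y)) := by
    have := hconv.comp_affineMap (AffineMap.lineMap ζ (ζ + y) : ℝ →ᵃ[ℝ] (Cn n))
    have he : (r ∘ (AffineMap.lineMap ζ (ζ + y) : ℝ →ᵃ[ℝ] (Cn n))) = fun s : ℝ ↦ r (ζ + s • y) := by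
      ext s; simp [AffineMap.lineMap_apply, add_comm]
    rw [he] at this
    refine this.subset (fun s hs ↦ ?_) (convex_Icc 0 1)
    exact hconv.1.lineMap_mem hζW hyW hs
  have := hc.le_slope_of_hasDerivAt (by simp) (by simp) one_pos hg
  simpa [slope] using this

end Disc

section Polydisc

variable {n : ℕ} {r : Cn n → ℝ} {W : Set (Cn n)} {ζ ζ' x w : Cn n} {ε η η₁ d ρ : ℝ}
  {u v : Fin n → Cn n}

/-- Points close to the polydisc of size `ε` lie in discs controlled by a multiple of `ε`. -/
theorem discBound_sub_of_mem_polydisc (hcont : ContinuousOn r W) (hW : IsOpen W)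
    (hconv : ConvexOn ℝ W r) (hball : Metric.closedBall ζ ρ ⊆ W) (hζ : r ζ = 0)
    (hlip : ∀ y : Cn n, ‖y‖ ≤ ρ → |r (ζ + y)| ≤ 2 * ‖y‖) (hρ : 0 < ρ) (hε : 0 ≤ ε)
    (hερ : 4 * ε ≤ ρ) (hnar : ∀ x : Cn n, ‖x‖ = ρ → ¬ DiscBound r ζ x ε)
    (hdb : ∀ x : Cn n, ‖x‖ ≤ ρ → DiscBound r ζ x (8 * ε) →
      ∀ lam : ℂ, ‖lam‖ ≤ (n + 1) * 2 ^ (n + 1) → |r (ζ + lam • x)| ≤ η₁)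
    (hu : Orthonormal ℂ u) (hζ' : ζ' ∈ polydisc r ζ ε u) (hw : ‖w - ζ'‖ ≤ 4 * ε) :
    ‖(2 ^ (n + 1) : ℝ) • (w - ζ)‖ ≤ (n + 1) * 2 ^ (n + 1) * ρ ∧
      DiscBound r ζ ((2 ^ (n + 1) : ℝ) • (w - ζ)) η₁ := by
  obtain ⟨lam, hlam, rfl⟩ := hζ'
  have hn : (0 : ℝ) < n + 1 := by positivity
  set p : Option (Fin n) → Cn n := fun o ↦
    o.elim (w - (ζ + ∑ k, lam k • u k)) (fun k ↦ lam k • u k) with hp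
  have hsum : ∑ o, (1 / (n + 1) : ℝ) • p o = (1 / (n + 1) : ℝ) • (w - ζ) := by
    rw [← Finset.smul_sum, Fintype.sum_option]
    simp only [hp, Option.elim]
    congr 1
    abel
  obtain ⟨h1, h2⟩ := DiscBound.sum hconv hball hζ (s := Finset.univ)
    (a := fun _ : Option (Fin n) ↦ (1 / (n + 1) : ℝ)) (p := p) (ε := 8 * ε)
    (fun _ _ ↦ by positivity) (by simp; field_simp)
    (by
      rintro (_ | k) -
      · exact hw.trans hερ
      · simp only [hp, Option.elim]
        rw [norm_smul, hu.1 k, mul_one]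
        exact (hlam k).trans (tauWidth_le hζ hnar hρ (hu.1 k)))
    (by
      rintro (_ | k) -
      · exact discBound_of_norm_le hlip (hw.trans hερ) (by simp only [hp, Option.elim]; linarith)
      · exact (discBound_of_le_tauWidth hcont hW hball hζ hnar hρ le_rfl hε (hu.1 k)
          (hlam k)).mono (by linarith))
  rw [hsum] at h1 h2
  refine ⟨?_, fun l hl ↦ ?_⟩
  · rw [norm_smul, Real.norm_of_nonneg (by positivity), one_div, inv_mul_le_iff₀ hn] at h1
    rw [norm_smul, Real.norm_of_nonneg (by positivity)]
    calc (2 : ℝ) ^ (n + 1) * ‖w - ζ‖ ≤ 2 ^ (n + 1) * ((n + 1) * ρ) := by gcongr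
      _ = _ := by ring
  · have h3 := hdb _ h1 h2 (((n + 1) * 2 ^ (n + 1) : ℝ) * l) (by
      rw [norm_mul, Complex.norm_real, Real.norm_of_nonneg (by positivity)]
      exact mul_le_of_le_one_right (by positivity) hl)
    convert h3 using 4
    rw [← Complex.coe_smul, ← Complex.coe_smul, smul_smul, smul_smul]
    congr 1
    have : (n + 1 : ℂ) ≠ 0 := by exact_mod_cast hn.ne'
    push_cast
    field_simp

theorem real_inner_eq_re_inner_complex (a b : Cn n) : inner ℝ a b = (inner ℂ a b).re := by
  simp [PiLp.inner_apply]

/-- In the complex normal direction the value of `r` controls the displacement. -/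
theorem norm_inner_le_of_discBound (hconv : ConvexOn ℝ W r) (hball : Metric.closedBall ζ d ⊆ W)
    (hd : 0 ≤ d) (hζ : r ζ = 0) (hdiff : DifferentiableAt ℝ r ζ)
    (hgrad : 2 / 3 ≤ ‖gradient r ζ‖) {e : Cn n} (he : ‖e‖ = 1) {c : ℂ}
    (hc : gradient r ζ = c • e) (hx : ‖x‖ ≤ d) (h : DiscBound r ζ x η) :
    2 * ‖inner ℂ e x‖ ≤ 3 * η := by
  set m := inner ℂ e x with hm
  rcases eq_or_ne m 0 with h0 | h0
  · have := (abs_nonneg _).trans (h 0 (by simp))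
    rw [h0, norm_zero]; linarith
  have hcn : 2 / 3 ≤ ‖c‖ := by rwa [hc, norm_smul, he, mul_one] at hgrad
  have hc0 : c ≠ 0 := norm_pos_iff.1 (by linarith)
  set z := (starRingEnd ℂ) c * m with hz
  have hz0 : z ≠ 0 := mul_ne_zero (by simpa using hc0) h0
  have hzn : ‖z‖ = ‖c‖ * ‖m‖ := by rw [hz, norm_mul, RCLike.norm_conj]
  set θ : ℂ := (starRingEnd ℂ) z / ‖z‖ with hθ
  have hzn0 : (‖z‖ : ℂ) ≠ 0 := by simpa using hz0
  have hθ1 : ‖θ‖ = 1 := by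
    rw [hθ, norm_div, RCLike.norm_conj, Complex.norm_real, norm_norm,
      div_self (norm_ne_zero_iff.2 hz0)]
  have hin : inner ℝ (gradient r ζ) (θ • x) = ‖z‖ := by
    rw [real_inner_eq_re_inner_complex, hc, inner_smul_left, inner_smul_right, ← hm,
      show (starRingEnd ℂ) c * (θ * m) = θ * z by rw [hz]; ring, hθ, div_mul_eq_mul_div,
      mul_comm, Complex.mul_conj, Complex.normSq_eq_norm_sq, Complex.ofReal_pow, sq,
      mul_div_assoc, div_self hzn0, mul_one, Complex.ofReal_re]
  have hmem : ζ + θ • x ∈ W := mem_of_norm_le_of_closedBall_subset hball <| by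
    rwa [norm_smul, hθ1, one_mul]
  have h1 := inner_gradient_le_of_convexOn hconv (hball (Metric.mem_closedBall_self hd)) hmem hdiff
  have h2 := (le_abs_self _).trans (h θ hθ1.le)
  rw [hin, hζ, hzn] at h1
  nlinarith [norm_nonneg m]

theorem norm_inner_smul_le_of_orthonormal {e : Cn n} (he : ‖e‖ = 1) (x : Cn n) :
    ‖inner ℂ e x • e‖ ≤ ‖x‖ := by
  rw [norm_smul, he, mul_one]
  simpa [he] using norm_inner_le_norm (𝕜 := ℂ) e x

/-- A disc controlled by `η` on a fixed multiple of `x` puts `ζ + x` in the extremal polydisc. -/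
theorem add_mem_polydisc_of_discBound (hcont : ContinuousOn r W) (hW : IsOpen W)
    (hconv : ConvexOn ℝ W r) (hball : Metric.closedBall ζ d ⊆ W) (hζ : r ζ = 0)
    (hdiff : DifferentiableAt ℝ r ζ) (hgrad : 2 / 3 ≤ ‖gradient r ζ‖)
    (hlip : ∀ y : Cn n, ‖y‖ ≤ d → |r (ζ + y)| ≤ 2 * ‖y‖) (hρ : 0 < ρ) (hρd : ρ ≤ d)
    (hnar : ∀ x : Cn n, ‖x‖ = ρ → ¬ DiscBound r ζ x η) (hη : 3 * η₁ ≤ η)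
    (hv : IsExtremalBasis r ζ η v) (hx : ‖(2 ^ (n + 1) : ℝ) • x‖ ≤ d)
    (h : DiscBound r ζ ((2 ^ (n + 1) : ℝ) • x) η₁) : ζ + x ∈ polydisc r ζ η v := by
  have ho := hv.1
  have hη₁ : 0 ≤ η₁ := (abs_nonneg _).trans (h 0 (by simp))
  have hη0 : 0 ≤ η := by linarith
  set s : ℕ → ℝ := fun k ↦ 2 ^ (n + 1 - k) with hs
  set μ : Fin n → ℂ := fun k ↦ inner ℂ (v k) x with hμ
  set y : ℕ → Cn n := fun k ↦
    x - ∑ i ∈ Finset.univ.filter (fun i : Fin n ↦ (i : ℕ) < k), μ i • v i with hy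
  have hy0 : y 0 = x := by simp [hy]
  have hs1 : ∀ k, 1 ≤ s k := fun k ↦ one_le_pow₀ one_le_two
  have hyperp : ∀ k j : Fin n, j < k → inner ℂ (v j) (y k) = 0 := by
    intro k j hj
    rw [hy, inner_sub_right, ho.inner_right_sum _ (by simpa using hj), sub_self]
  have hyk : ∀ k : Fin n, inner ℂ (v k) (y k) = μ k := by
    intro k
    rw [hy, inner_sub_right, inner_sum, Finset.sum_eq_zero, sub_zero]
    intro i hi
    have hi' : i < k := by simpa using hi
    rw [inner_smul_right, ho.2 hi'.ne', mul_zero]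
  have hysucc : ∀ k : Fin n, y (k + 1) = y k - μ k • v k := by
    intro k
    have : Finset.univ.filter (fun i : Fin n ↦ (i : ℕ) < k + 1) =
        insert k (Finset.univ.filter (fun i : Fin n ↦ (i : ℕ) < k)) := by
      ext i
      simp only [Finset.mem_filter, Finset.mem_univ, true_and, Finset.mem_insert, Fin.ext_iff]
      omega
    simp only [hy]
    rw [this, Finset.sum_insert (by simp)]
    abel
  have hsmul : ∀ (a : ℝ) (b : ℂ) (z : Cn n), a • b • z = ((a : ℂ) * b) • z := by
    intro a b z
    rw [← Complex.coe_smul, smul_smul]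
  have hstep : ∀ k : Fin n, ‖s k • y k‖ ≤ d → DiscBound r ζ (s k • y k) η →
      DiscBound r ζ (s k • μ k • v k) η := by
    intro k hkd hkη
    have hle : ‖μ k • v k‖ ≤ ‖y k‖ := by
      rw [← hyk k]; exact norm_inner_smul_le_of_orthonormal (ho.1 k) _
    by_cases hk0 : (k : ℕ) = 0
    · obtain ⟨c, -, hc⟩ := hv.2.1
      have h1 := norm_inner_le_of_discBound hconv hball (hρ.le.trans hρd) hζ hdiff hgrad (ho.1 k)
        (hc k hk0) hx h
      refine discBound_of_norm_le hlip ?_ (le_trans ?_ hη)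
      · refine le_trans ?_ hkd
        rw [norm_smul, norm_smul (s k)]
        gcongr
      · rw [← Complex.coe_smul, inner_smul_right, norm_mul] at h1
        rw [norm_smul, norm_smul, ho.1 k, mul_one]
        simpa [hs, hk0, hμ] using h1
    · rcases eq_or_ne (y k) 0 with hyz | hyz
      · have : μ k • v k = 0 := by simpa [hyz] using hle
        rw [this, smul_zero]
        intro l _
        simpa [hζ] using hη0
      have hyp : 0 < ‖y k‖ := norm_pos_iff.2 hyz
      set z : Cn n := ((‖y k‖⁻¹ : ℝ) : ℂ) • y k with hz
      have hz1 : ‖z‖ = 1 := by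
        rw [hz, norm_smul, Complex.norm_real, norm_inv, norm_norm, inv_mul_cancel₀ hyp.ne']
      have hsz : s k • y k = ((s k * ‖y k‖ : ℝ) : ℂ) • z := by
        rw [hz, smul_smul, ← Complex.coe_smul]
        congr 1
        have : (‖y k‖ : ℂ) ≠ 0 := by exact_mod_cast hyp.ne'
        push_cast
        field_simp
      rw [hsz] at hkη
      have h1 := le_tauWidth hζ hnar hρ hz1 hkη
      have h2 := hv.tauWidth_le hζ hnar hρ hk0 hz1 (fun j hj ↦ by
        rw [hz, inner_smul_right, hyperp k j hj, mul_zero])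
      rw [hsmul]
      refine discBound_of_le_tauWidth hcont hW hball hζ hnar hρ hρd hη0 (ho.1 k) ?_
      refine le_trans ?_ (h1.trans h2)
      rw [norm_mul, Complex.norm_real, Complex.norm_real, norm_mul, norm_norm]
      gcongr
      simpa [norm_smul, ho.1 k] using hle
  have hind : ∀ k ≤ n, ‖s k • y k‖ ≤ d ∧ DiscBound r ζ (s k • y k) η := by
    intro k
    induction k with
    | zero =>
      intro _
      rw [hy0]
      exact ⟨hx, h.mono (by linarith)⟩
    | succ k ih =>
      intro hk
      obtain ⟨h1, h2⟩ := ih (by omega)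
      have h3 := hstep ⟨k, hk⟩ h1 h2
      have h4 : ‖s k • μ ⟨k, hk⟩ • v ⟨k, hk⟩‖ ≤ d := by
        refine le_trans ?_ h1
        rw [norm_smul, norm_smul (s k)]
        have := norm_inner_smul_le_of_orthonormal (ho.1 ⟨k, hk⟩) (y k)
        rw [hyk ⟨k, hk⟩] at this
        gcongr
      have h5 := DiscBound.half_add hconv hball hζ h1 (y := (-1 : ℂ) • s k • μ ⟨k, hk⟩ • v ⟨k, hk⟩)
        (by rwa [norm_smul, norm_neg, norm_one, one_mul]) h2 (h3.smul (by simp))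
      have h6 : s (k + 1) • y (k + 1) =
          (1 / 2 : ℝ) • (s k • y k + (-1 : ℂ) • s k • μ ⟨k, hk⟩ • v ⟨k, hk⟩) := by
        have hsk : s k = 2 * s (k + 1) := by
          simp only [hs]
          rw [← pow_succ', show n + 1 - (k + 1) + 1 = n + 1 - k by omega]
        rw [hysucc ⟨k, hk⟩, hsk, neg_one_smul]
        module
      rw [h6]
      exact h5
  refine ⟨μ, fun k ↦ ?_, ?_⟩
  · obtain ⟨h1, h2⟩ := hind k k.2.le
    have h3 := hstep k h1 h2
    rw [hsmul] at h3
    refine le_trans ?_ (le_tauWidth hζ hnar hρ (ho.1 k) h3)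
    rw [norm_mul, Complex.norm_real, Real.norm_of_nonneg (by linarith [hs1 k])]
    exact le_mul_of_one_le_left (norm_nonneg _) (hs1 k)
  · congr 1
    have hspan := ho.linearIndependent.span_eq_top_of_card_eq_finrank' (by simp)
    have := (OrthonormalBasis.mk ho hspan.ge).sum_repr' x
    simpa [hμ] using this.symm

end Polydisc

section Flow

variable {n : ℕ} {r : Cn n → ℝ} {W U K Ω : Set (Cn n)}

/-- The normalized gradient field, along which `r` grows at unit speed. -/
noncomputable def unitSpeedField (r : Cn n → ℝ) (z : Cn n) : Cn n :=
  (‖gradient r z‖ ^ 2)⁻¹ • gradient r z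

theorem norm_gradient (z : Cn n) : ‖gradient r z‖ = ‖fderiv ℝ r z‖ :=
  LinearIsometryEquiv.norm_map _ _

theorem norm_unitSpeedField_le {z : Cn n} (h : 2 / 3 ≤ ‖gradient r z‖) :
    ‖unitSpeedField r z‖ ≤ 3 / 2 := by
  have h0 : 0 < ‖gradient r z‖ := by linarith
  rw [unitSpeedField, norm_smul, norm_inv, norm_pow, norm_norm, sq, mul_inv,
    mul_assoc, inv_mul_cancel₀ h0.ne', mul_one, inv_le_comm₀ h0 (by norm_num)]
  linarith

theorem fderiv_unitSpeedField {z : Cn n} (hz : DifferentiableAt ℝ r z)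
    (h : 2 / 3 ≤ ‖gradient r z‖) : fderiv ℝ r z (unitSpeedField r z) = 1 := by
  have h0 : 0 < ‖gradient r z‖ := by linarith
  have h1 : fderiv ℝ r z (gradient r z) = ‖gradient r z‖ ^ 2 := by
    have h2 := hz.hasGradientAt.hasFDerivAt.fderiv
    rw [← real_inner_self_eq_norm_sq, ← InnerProductSpace.toDual_apply_apply, ← h2]
  rw [unitSpeedField, map_smul, h1, smul_eq_mul, inv_mul_cancel₀ (by positivity)]

theorem contDiffOn_unitSpeedField (hW : IsOpen W) (hr : ContDiffOn ℝ (⊤ : ℕ∞) r W)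
    (hU : U ⊆ W) (hgrad : ∀ z ∈ U, 2 / 3 ≤ ‖gradient r z‖) :
    ContDiffOn ℝ 1 (unitSpeedField r) U := by
  have h1 : ContDiffOn ℝ 1 (fderiv ℝ r) U :=
    ((hr.fderiv_of_isOpen hW (m := ((⊤ : ℕ∞) : WithTop ℕ∞)) (by simp)).of_le
      (by exact_mod_cast le_top)).mono hU
  have h2 : ContDiffOn ℝ 1 (gradient r) U :=
    (InnerProductSpace.toDual ℝ (Cn n)).symm.contDiff.comp_contDiffOn h1
  refine ((h2.norm_sq ℝ).inv fun z hz ↦ ?_).smul h2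
  have := hgrad z hz
  positivity

/-- Integral curves of `σ V` move at speed less than `2` and change `r` at rate `σ`. -/
theorem integral_curve_bounds (hdiff : ∀ z ∈ U, DifferentiableAt ℝ r z)
    (hgrad : ∀ z ∈ U, 2 / 3 ≤ ‖gradient r z‖) {p : Cn n} {d T σ : ℝ}
    (hball : Metric.closedBall p d ⊆ U) (hσ : |σ| = 1) {y : ℝ → Cn n} (hy0 : y 0 = p)
    (hyc : ContinuousOn y (Icc 0 T))
    (hy : ∀ s ∈ Ico 0 T, HasDerivWithinAt y (σ • unitSpeedField r (y s)) (Ici s) s)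
    (hT : 2 * T ≤ d) :
    ∀ s ∈ Icc 0 T, ‖y s - p‖ ≤ 2 * s ∧ r (y s) = r p + σ * s := by
  have hnorm : ∀ s ∈ Icc 0 T, ‖y s - p‖ ≤ 2 * s := by
    intro s hs
    refine image_norm_le_of_norm_deriv_right_lt_deriv_boundary (f := fun s ↦ y s - p)
      (f' := fun s ↦ σ • unitSpeedField r (y s)) (B := fun s ↦ 2 * s) (B' := fun _ ↦ 2)
      (hyc.sub continuousOn_const) (fun s hs ↦ (hy s hs).sub_const p) (by simp [hy0])
      (fun s ↦ by simpa using (hasDerivAt_id s).const_mul 2) ?_ hs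
    intro s hs hsB
    have hmem : y s ∈ U := hball (by
      rw [mem_closedBall_iff_norm]
      have h1 : ‖y s - p‖ = 2 * s := hsB
      linarith [hs.2])
    rw [norm_smul, Real.norm_eq_abs, hσ, one_mul]
    linarith [norm_unitSpeedField_le (hgrad _ hmem)]
  have hmem : ∀ s ∈ Icc 0 T, y s ∈ U := fun s hs ↦ hball (by
    rw [mem_closedBall_iff_norm]
    linarith [hnorm s hs, hs.2])
  have hconst : ∀ s ∈ Icc 0 T, r (y s) - σ * s = r (y 0) - σ * 0 := by
    refine constant_of_has_deriv_right_zero (f := fun s ↦ r (y s) - σ * s) ?_ fun s hs ↦ ?_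
    · refine ContinuousOn.sub (fun s hs ↦ ?_) (by fun_prop)
      exact (hdiff _ (hmem s hs)).continuousAt.comp_continuousWithinAt (hyc s hs)
    · have hsU := hmem s (Ico_subset_Icc_self hs)
      have h1 := (hdiff _ hsU).hasFDerivAt.comp_hasDerivWithinAt s (hy s hs)
      rw [map_smul, fderiv_unitSpeedField (hdiff _ hsU) (hgrad _ hsU), smul_eq_mul, mul_one] at h1
      have h2 : HasDerivWithinAt (fun s : ℝ ↦ σ * s) σ (Ici s) s := by
        simpa using ((hasDerivAt_id s).const_mul σ).hasDerivWithinAt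
      have h3 := h1.sub h2
      rwa [sub_self] at h3
  intro s hs
  have := hconst s hs
  rw [hy0] at this
  exact ⟨hnorm s hs, by linarith⟩

/-- The backward gradient curve through a point near the zero set reaches the zero set. -/
theorem exists_flow_preimage (hdiff : ∀ z ∈ U, DifferentiableAt ℝ r z)
    (hgrad : ∀ z ∈ U, 2 / 3 ≤ ‖gradient r z‖) {d t : ℝ} {L : NNReal}
    (hball : ∀ ζ ∈ U, r ζ = 0 → Metric.closedBall ζ d ⊆ U)
    (hlip : ∀ ζ ∈ U, r ζ = 0 → LipschitzOnWith L (unitSpeedField r) (Metric.closedBall ζ d))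
    (ht : 0 < t) (htd : 4 * t ≤ d) {ζ₀ z : Cn n} (hζ₀ : ζ₀ ∈ U) (hrζ₀ : r ζ₀ = 0)
    (hz : ‖z - ζ₀‖ ≤ d / 2) (hrz : r z = -t) {φ : Cn n → ℝ → Cn n}
    (hφ0 : ∀ ζ ∈ U, r ζ = 0 → φ ζ 0 = ζ)
    (hφ : ∀ ζ ∈ U, r ζ = 0 → ContinuousOn (φ ζ) (Icc 0 t) ∧ ∀ s ∈ Ico 0 t,
      HasDerivWithinAt (φ ζ) ((-1 : ℝ) • unitSpeedField r (φ ζ s)) (Ici s) s) :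
    ∃ ζ' ∈ U, r ζ' = 0 ∧ ‖z - ζ'‖ ≤ 2 * t ∧ φ ζ' t = z := by
  have hd : 0 < d := by linarith
  have hsub : Metric.closedBall z (d / 2) ⊆ Metric.closedBall ζ₀ d := by
    refine Metric.closedBall_subset_closedBall' ?_
    rw [dist_eq_norm]; linarith
  have hzU : Metric.closedBall z (d / 2) ⊆ U := hsub.trans (hball ζ₀ hζ₀ hrζ₀)
  have hPL : IsPicardLindelof (fun _ : ℝ ↦ unitSpeedField r)
      (⟨0, le_rfl, ht.le⟩ : Icc (0 : ℝ) t) z (d / 2).toNNReal 0 (3 / 2) L := by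
    refine IsPicardLindelof.of_time_independent (fun x hx ↦ ?_) ?_ ?_
    · rw [Real.coe_toNNReal _ (by positivity)] at hx
      simpa using norm_unitSpeedField_le (hgrad x (hzU hx))
    · rw [Real.coe_toNNReal _ (by positivity)]
      exact (hlip ζ₀ hζ₀ hrζ₀).mono hsub
    · rw [Real.coe_toNNReal _ (by positivity)]
      simp [ht.le]
      linarith
  obtain ⟨y, hy0, hy⟩ := hPL.exists_eq_forall_mem_Icc_hasDerivWithinAt (x := z) (by simp)
  simp only at hy0
  have hyc : ContinuousOn y (Icc 0 t) := fun s hs ↦ (hy s hs).continuousWithinAt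
  have hyb := integral_curve_bounds hdiff hgrad (σ := 1) hzU (by simp) hy0 hyc (fun s hs ↦ by
    rw [one_smul]
    exact (hy s (Ico_subset_Icc_self hs)).mono_of_mem_nhdsWithin
      (Icc_mem_nhdsGE_of_mem hs)) (by linarith)
  obtain ⟨hyt, hryt⟩ := hyb t ⟨ht.le, le_rfl⟩
  have hytU : y t ∈ U := hzU (by rw [mem_closedBall_iff_norm]; linarith)
  have hryt0 : r (y t) = 0 := by rw [hryt, hrz]; ring
  refine ⟨y t, hytU, hryt0, by rwa [norm_sub_rev], ?_⟩
  obtain ⟨hφc, hφd⟩ := hφ (y t) hytU hryt0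
  have hφb := integral_curve_bounds hdiff hgrad (σ := -1) (hball _ hytU hryt0) (by simp)
    (hφ0 _ hytU hryt0) hφc hφd (by linarith)
  have hrev : ∀ s ∈ Icc 0 t, t - s ∈ Icc 0 t := fun s hs ↦ ⟨by linarith [hs.2], by linarith [hs.1]⟩
  have huniq := ODE_solution_unique_of_mem_Icc_right
    (v := fun _ x ↦ (-1 : ℝ) • unitSpeedField r x) (s := fun _ ↦ Metric.closedBall (y t) d)
    (K := L) (f := φ (y t)) (g := fun s ↦ y (t - s)) (a := 0) (b := t) ?_ hφc hφd ?_ ?_ ?_ ?_ ?_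
  · have := huniq (right_mem_Icc.2 ht.le)
    simpa [hy0] using this
  · intro s _
    refine LipschitzOnWith.of_dist_le_mul fun a ha b hb ↦ ?_
    rw [dist_eq_norm, ← smul_sub, norm_smul, norm_neg, norm_one, one_mul, ← dist_eq_norm]
    exact (hlip _ hytU hryt0).dist_le_mul a ha b hb
  · intro s hs
    rw [mem_closedBall_iff_norm]
    linarith [(hφb s (Ico_subset_Icc_self hs)).1, hs.2]
  · exact hyc.comp (by fun_prop) hrev
  · intro s hs
    have h1 := (hy (t - s) (hrev s (Ico_subset_Icc_self hs))).scomp s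
      (((hasDerivAt_id s).const_sub t).hasDerivWithinAt (s := Icc 0 t)) hrev
    exact h1.mono_of_mem_nhdsWithin (Icc_mem_nhdsGE_of_mem hs)
  · intro s hs
    have h1 := (hyb (t - s) (hrev s (Ico_subset_Icc_self hs))).1
    rw [mem_closedBall_iff_norm]
    have h2 : ‖y (t - s) - y t‖ ≤ ‖y (t - s) - z‖ + ‖y t - z‖ := by
      rw [← norm_sub_rev z (y t)]
      exact norm_sub_le_norm_sub_add_norm_sub _ _ _
    linarith [hs.1]
  · rw [hφ0 _ hytU hryt0]; simp

end Flow

section Domain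

variable {n : ℕ} {r : Cn n → ℝ} {W Ω : Set (Cn n)}

theorem zeroSet_subset_closure (hconv : ConvexOn ℝ W r) (hΩne : Ω.Nonempty)
    (hΩdef : Ω = {z ∈ W | r z < 0}) : {z ∈ W | r z = 0} ⊆ closure Ω := by
  rintro z ⟨hzW, hz⟩
  obtain ⟨z₀, hz₀⟩ := hΩne
  obtain ⟨hz₀W, hrz₀⟩ : z₀ ∈ {z ∈ W | r z < 0} := hΩdef ▸ hz₀
  have hlim : Filter.Tendsto (fun t : ℝ ↦ (1 - t) • z + t • z₀) (nhdsWithin 0 (Ioi 0))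
      (nhds z) := by
    have : Continuous (fun t : ℝ ↦ (1 - t) • z + t • z₀) := by fun_prop
    simpa using (this.tendsto 0).mono_left nhdsWithin_le_nhds
  refine mem_closure_of_tendsto hlim ?_
  filter_upwards [Ioo_mem_nhdsGT (zero_lt_one (α := ℝ))] with t ht
  rw [hΩdef]
  have h1 : 0 ≤ 1 - t := by linarith [ht.2]
  refine ⟨hconv.1 hzW hz₀W h1 ht.1.le (by ring), ?_⟩
  refine (hconv.2 hzW hz₀W h1 ht.1.le (by ring)).trans_lt ?_
  rw [hz, smul_zero, zero_add, smul_eq_mul]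
  exact mul_neg_of_pos_of_neg ht.1 hrz₀

theorem isCompact_zeroSet (hconv : ConvexOn ℝ W r) (hcont : ContinuousOn r W)
    (hΩbdd : Bornology.IsBounded Ω) (hΩne : Ω.Nonempty) (hWΩ : closure Ω ⊆ W)
    (hΩdef : Ω = {z ∈ W | r z < 0}) : IsCompact {z ∈ W | r z = 0} := by
  have he : {z ∈ W | r z = 0} = closure Ω ∩ r ⁻¹' {0} := by
    ext z
    exact ⟨fun h ↦ ⟨zeroSet_subset_closure hconv hΩne hΩdef h, h.2⟩, fun h ↦ ⟨hWΩ h.1, h.2⟩⟩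
  rw [he]
  exact hΩbdd.isCompact_closure.of_isClosed_subset
    ((hcont.mono hWΩ).preimage_isClosed_of_isClosed isClosed_closure isClosed_singleton)
    inter_subset_left

/-- Points of `Ω` where `r` is small are close to the zero set of `r`. -/
theorem exists_near_zeroSet (hcont : ContinuousOn r W) (hW : IsOpen W)
    (hΩbdd : Bornology.IsBounded Ω) (hWΩ : closure Ω ⊆ W)
    (hΩdef : Ω = {z ∈ W | r z < 0}) {δ : ℝ} (hδ : 0 < δ) :
    ∃ τ : ℝ, 0 < τ ∧ ∀ z ∈ Ω, -τ < r z → ∃ ζ ∈ {z ∈ W | r z = 0}, dist z ζ < δ := by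
  have hle : ∀ z ∈ closure Ω, r z ≤ 0 := by
    intro z hz
    by_contra! hlt
    have hev := (hcont.continuousAt (hW.mem_nhds (hWΩ hz))).eventually (lt_mem_nhds hlt)
    obtain ⟨w, hw, hwΩ⟩ := mem_closure_iff_nhds.1 hz _ hev
    rw [hΩdef] at hwΩ
    exact lt_asymm hw hwΩ.2
  set S := closure Ω \ Metric.thickening δ {z ∈ W | r z = 0} with hS
  have hScpt : IsCompact S := hΩbdd.isCompact_closure.diff Metric.isOpen_thickening
  rcases S.eq_empty_or_nonempty with he | hne
  · refine ⟨1, one_pos, fun z hz _ ↦ ?_⟩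
    by_contra hcon
    have : z ∈ S := ⟨subset_closure hz, fun h ↦ hcon (Metric.mem_thickening_iff.1 h)⟩
    simp [he] at this
  · obtain ⟨z₁, hz₁, hmax⟩ := hScpt.exists_isMaxOn hne
      (hcont.mono (sdiff_subset.trans hWΩ))
    have hneg : r z₁ < 0 := by
      refine (hle z₁ hz₁.1).lt_of_ne fun h0 ↦ hz₁.2 ?_
      exact Metric.self_subset_thickening hδ _ ⟨hWΩ hz₁.1, h0⟩
    refine ⟨-r z₁, by linarith, fun z hz hrz ↦ ?_⟩
    by_contra hcon
    have : z ∈ S := ⟨subset_closure hz, fun h ↦ hcon (Metric.mem_thickening_iff.1 h)⟩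
    have := hmax this
    simp only [mem_ofPred_eq] at this
    linarith

theorem abs_le_two_mul_norm {U : Set (Cn n)} (hdiff : ∀ z ∈ U, DifferentiableAt ℝ r z)
    (hgrad : ∀ z ∈ U, ‖gradient r z‖ ≤ 3 / 2) {ζ : Cn n} {d : ℝ}
    (hball : Metric.closedBall ζ d ⊆ U) (hζ : r ζ = 0) {y : Cn n} (hy : ‖y‖ ≤ d) :
    |r (ζ + y)| ≤ 2 * ‖y‖ := by
  have h := (convex_closedBall ζ d).norm_image_sub_le_of_norm_fderiv_le (𝕜 := ℝ) (f := r)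
    (C := 3 / 2)
    (fun z hz ↦ hdiff z (hball hz)) (fun z hz ↦ by
      rw [← norm_gradient]; exact hgrad z (hball hz))
    (Metric.mem_closedBall_self ((norm_nonneg _).trans hy)) (y := ζ + y) (by simpa using hy)
  rw [hζ, sub_zero, add_sub_cancel_left, Real.norm_eq_abs] at h
  linarith [norm_nonneg y]

end Domain

section Engulfing

variable {n : ℕ} {r : Cn n → ℝ} {W U K : Set (Cn n)}

theorem exists_lipschitzOnWith_closedBall {V : Cn n → Cn n} (hU : IsOpen U)
    (hV : ContDiffOn ℝ 1 V U) (hK : IsCompact K) {d : ℝ} (hdU : Metric.cthickening d K ⊆ U) :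
    ∃ L : NNReal, ∀ ζ ∈ K, LipschitzOnWith L V (Metric.closedBall ζ d) := by
  obtain ⟨L, hL⟩ := (hK.cthickening (r := d)).exists_bound_of_continuousOn
    ((hV.continuousOn_fderiv_of_isOpen hU le_rfl).mono hdU)
  refine ⟨L.toNNReal, fun ζ hζ ↦ ?_⟩
  have hsub := Metric.closedBall_subset_cthickening hζ d
  refine (convex_closedBall ζ d).lipschitzOnWith_of_nnnorm_fderiv_le (𝕜 := ℝ)
    (fun z hz ↦ ?_) fun z hz ↦ ?_
  · exact (hV.contDiffAt (hU.mem_nhds (hdU (hsub hz)))).differentiableAt one_ne_zero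
  · rw [← NNReal.coe_le_coe, coe_nnnorm]
    exact (hL z (hsub hz)).trans (Real.le_coe_toNNReal L)

/-- The polydisc of size `ε` is engulfed, with room to spare, by the one of size `C₁ * ε`,
whatever the extremal bases. -/
theorem exists_polydisc_engulfing (hW : IsOpen W) (hr : ContDiffOn ℝ (⊤ : ℕ∞) r W)
    (hconv : ConvexOn ℝ W r) (hK : IsCompact K) (hK0 : ∀ ζ ∈ K, r ζ = 0) {d : ℝ} (hd : 0 < d)
    (hdU : Metric.cthickening d K ⊆ U) (hUW : U ⊆ W)
    (hgrad : ∀ z ∈ U, ‖gradient r z‖ ∈ Icc (2 / 3 : ℝ) (3 / 2)) (M : ℕ)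
    (hfin : ∀ p ∈ K, ∀ v : Cn n, ‖v‖ = 1 →
      ∃ k ≤ M, iteratedFDeriv ℝ k (fun lam : ℂ ↦ r (p + lam • v)) 0 ≠ 0) :
    ∃ C₁ τ : ℝ, 1 < C₁ ∧ 0 < τ ∧ ∀ ζ ∈ K, ∀ ε : ℝ, 0 < ε → ε < τ →
      ∀ u v : Fin n → Cn n, Orthonormal ℂ u → IsExtremalBasis r ζ (C₁ * ε) v →
        ∀ ζ' ∈ polydisc r ζ ε u, ∀ w : Cn n, ‖w - ζ'‖ ≤ 4 * ε →
          w ∈ polydisc r ζ (C₁ * ε) v := by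
  have hA : (1 : ℝ) ≤ (n + 1) * 2 ^ (n + 1) := one_le_mul_of_one_le_of_one_le
    (by linarith [n.cast_nonneg (α := ℝ)]) (one_le_pow₀ one_le_two)
  obtain ⟨C, ρ, hC, hρ, hρd, hdoub⟩ := exists_doubling hW hr hK hd (hdU.trans hUW) M hfin hA
  have hρd' : ρ ≤ d := (le_mul_of_one_le_left hρ.le hA).trans hρd
  refine ⟨24 * C, min (ρ / 4) (ρ ^ M / (24 * C ^ 2)), by linarith, by positivity, ?_⟩
  intro ζ hζ ε hε hετ u v hu hv ζ' hζ' w hw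
  have hε1 : 4 * ε ≤ ρ := by linarith [hετ.le.trans (min_le_left _ _)]
  have hε2 : C * (24 * C * ε) < ρ ^ M := by
    have := (lt_div_iff₀ (by positivity)).1 (hετ.trans_le (min_le_right _ _))
    linarith
  have hballU : Metric.closedBall ζ d ⊆ U :=
    (Metric.closedBall_subset_cthickening hζ d).trans hdU
  have hdiff : ∀ z ∈ U, DifferentiableAt ℝ r z := fun z hz ↦
    (hr.contDiffAt (hW.mem_nhds (hUW hz))).differentiableAt (by simp)
  have hζU : ζ ∈ U := hballU (Metric.mem_closedBall_self hd.le)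
  have hlip : ∀ y : Cn n, ‖y‖ ≤ d → |r (ζ + y)| ≤ 2 * ‖y‖ := fun y hy ↦
    abs_le_two_mul_norm hdiff (fun z hz ↦ (hgrad z hz).2) hballU (hK0 ζ hζ) hy
  have hnar : ∀ x : Cn n, ‖x‖ = ρ → ¬ DiscBound r ζ x (24 * C * ε) := by
    intro x hx hdisc
    have hx0 : x ≠ 0 := norm_pos_iff.1 (hx ▸ hρ)
    have := (hdoub ζ hζ x hx0 hx.le _ hdisc).1
    rw [hx] at this
    linarith
  have hdb : ∀ x : Cn n, ‖x‖ ≤ ρ → DiscBound r ζ x (8 * ε) →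
      ∀ lam : ℂ, ‖lam‖ ≤ (n + 1) * 2 ^ (n + 1) → |r (ζ + lam • x)| ≤ C * (8 * ε) := by
    intro x hx hdisc
    rcases eq_or_ne x 0 with rfl | hx0
    · intro lam _
      rw [smul_zero, add_zero, hK0 ζ hζ, abs_zero]
      positivity
    · exact (hdoub ζ hζ x hx0 hx _ hdisc).2
  obtain ⟨h1, h2⟩ := discBound_sub_of_mem_polydisc hr.continuousOn hW hconv
    ((Metric.closedBall_subset_closedBall hρd').trans (hballU.trans hUW)) (hK0 ζ hζ)
    (fun y hy ↦ hlip y (hy.trans hρd')) hρ hε.le hε1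
    (fun x hx h ↦ hnar x hx (h.mono (by nlinarith))) hdb hu hζ' hw
  rw [← add_sub_cancel ζ w]
  exact add_mem_polydisc_of_discBound hr.continuousOn hW hconv (hballU.trans hUW) (hK0 ζ hζ)
    (hdiff ζ hζU) (hgrad ζ hζU).1 hlip hρ hρd' hnar (by linarith) hv (h1.trans hρd) h2

end Engulfing

/-- On a smoothly bounded convex domain of finite type, the flow tents
(generated by the negative normalized gradient flow of the defining function) and the
projection tents (generated by the nearest-point projection) are equivalent: there are
constants `C₁ > 1` and `τ₂ > 0`, depending only on `r` and `n` and independent of the chosen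
extremal bases, with `T_ε^{flow}(ζ) ⊆ T_{C₁ε}(ζ)` and `T_ε(ζ) ⊆ T_{C₁ε}^{flow}(ζ)`. -/
theorem flow_tent_equiv_proj_tent (n : ℕ) (hn : 2 ≤ n)
    (Ω W : Set (EuclideanSpace ℂ (Fin n)))
    (hΩopen : IsOpen Ω) (hΩbdd : Bornology.IsBounded Ω) (hΩconv : Convex ℝ Ω)
    (hΩne : Ω.Nonempty)
    (hWopen : IsOpen W) (hWconv : Convex ℝ W) (hWΩ : closure Ω ⊆ W)
    (r : EuclideanSpace ℂ (Fin n) → ℝ)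
    (hrsmooth : ContDiffOn ℝ (⊤ : ℕ∞) r W) (hrconv : ConvexOn ℝ W r)
    (hΩdef : Ω = {z ∈ W | r z < 0})
    (hgrad : ∀ z ∈ W, r z = 0 → gradient r z ≠ 0)
    (M : ℕ)
    (hfinType : ∀ p ∈ W, r p = 0 → ∀ v : EuclideanSpace ℂ (Fin n), ‖v‖ = 1 →
      ∃ k ≤ M, iteratedFDeriv ℝ k (fun lam : ℂ => r (p + lam • v)) 0 ≠ 0)
    (U : Set (EuclideanSpace ℂ (Fin n))) (hUopen : IsOpen U)
    (hbU : {z ∈ W | r z = 0} ⊆ U) (hUW : U ⊆ W)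
    (hUnorm : ∀ z ∈ U, ‖gradient r z‖ ∈ Set.Icc (2 / 3 : ℝ) (3 / 2))
    (proj : EuclideanSpace ℂ (Fin n) → EuclideanSpace ℂ (Fin n))
    (hproj : ∀ z ∈ U, proj z ∈ {w ∈ W | r w = 0} ∧
      (∀ w ∈ {w ∈ W | r w = 0}, dist z (proj z) ≤ dist z w) ∧
      (∀ w ∈ {w ∈ W | r w = 0},
        (∀ w' ∈ {w ∈ W | r w = 0}, dist z w ≤ dist z w') → w = proj z))
    (t₀ : ℝ) (ht₀ : 0 < t₀)
    (φ : EuclideanSpace ℂ (Fin n) → ℝ → EuclideanSpace ℂ (Fin n))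
    (hφ0 : ∀ ζ ∈ {z ∈ W | r z = 0}, φ ζ 0 = ζ)
    (hODE : ∀ ζ ∈ {z ∈ W | r z = 0}, ∀ t ∈ Set.Ico (0 : ℝ) t₀,
      HasDerivWithinAt (fun s => φ ζ s)
        (-(‖gradient r (φ ζ t)‖ ^ 2)⁻¹ • gradient r (φ ζ t)) (Set.Ico 0 t₀) t) :
    ∃ C₁ τ₂ : ℝ, 1 < C₁ ∧ 0 < τ₂ ∧
      ∀ B : EuclideanSpace ℂ (Fin n) → ℝ → Fin n → EuclideanSpace ℂ (Fin n),
        (∀ ξ ∈ {z ∈ W | r z = 0}, ∀ ε : ℝ, 0 < ε → IsExtremalBasis r ξ ε (B ξ ε)) →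
        ∀ ζ ∈ {z ∈ W | r z = 0}, ∀ ε : ℝ, 0 < ε → ε < τ₂ →
          -- `T_ε^{flow}(ζ) ⊆ T_{C₁ε}(ζ)`
          ({z | ∃ ζ' ∈ polydisc r ζ ε (B ζ ε) ∩ {w ∈ W | r w = 0},
              ∃ t ∈ Set.Ioo (0 : ℝ) ε, z = φ ζ' t} ⊆
            {z | z ∈ Ω ∩ U ∧
              proj z ∈ polydisc r ζ (C₁ * ε) (B ζ (C₁ * ε)) ∩ {w ∈ W | r w = 0} ∧
              r z ∈ Set.Ioo (-(C₁ * ε)) 0}) ∧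
          -- `T_ε(ζ) ⊆ T_{C₁ε}^{flow}(ζ)`
          ({z | z ∈ Ω ∩ U ∧
              proj z ∈ polydisc r ζ ε (B ζ ε) ∩ {w ∈ W | r w = 0} ∧
              r z ∈ Set.Ioo (-ε) 0} ⊆
            {z | ∃ ζ' ∈ polydisc r ζ (C₁ * ε) (B ζ (C₁ * ε)) ∩ {w ∈ W | r w = 0},
              ∃ t ∈ Set.Ioo (0 : ℝ) (C₁ * ε), z = φ ζ' t}) := by
  have hcont := hrsmooth.continuousOn
  have hdiff : ∀ z ∈ U, DifferentiableAt ℝ r z := fun z hz ↦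
    (hrsmooth.contDiffAt (hWopen.mem_nhds (hUW hz))).differentiableAt (by simp)
  have hgradU : ∀ z ∈ U, 2 / 3 ≤ ‖gradient r z‖ := fun z hz ↦ (hUnorm z hz).1
  have hK := isCompact_zeroSet hrconv hcont hΩbdd hΩne hWΩ hΩdef
  obtain ⟨d, hd, hdU⟩ := hK.exists_cthickening_subset_open hUopen hbU
  have hball : ∀ ζ ∈ U, r ζ = 0 → Metric.closedBall ζ d ⊆ U := fun ζ hζ h0 ↦
    (Metric.closedBall_subset_cthickening (E := {z ∈ W | r z = 0}) ⟨hUW hζ, h0⟩ d).trans hdU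
  obtain ⟨L, hL⟩ := exists_lipschitzOnWith_closedBall hUopen
    (contDiffOn_unitSpeedField hWopen hrsmooth hUW hgradU) hK hdU
  obtain ⟨C₁, τ, hC₁, hτ, hengulf⟩ := exists_polydisc_engulfing hWopen hrsmooth hrconv hK
    (fun ζ hζ ↦ hζ.2) hd hdU hUW hUnorm M (fun p hp ↦ hfinType p hp.1 hp.2)
  obtain ⟨τ', hτ', hnear⟩ := exists_near_zeroSet hcont hWopen hΩbdd hWΩ hΩdef (half_pos hd)
  have hflow : ∀ t < t₀, ∀ ζ ∈ U, r ζ = 0 → ContinuousOn (φ ζ) (Icc 0 t) ∧ ∀ s ∈ Ico 0 t,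
      HasDerivWithinAt (φ ζ) ((-1 : ℝ) • unitSpeedField r (φ ζ s)) (Ici s) s := by
    intro t ht ζ hζ h0
    have hsub : Icc 0 t ⊆ Ico 0 t₀ := Icc_subset_Ico_right ht
    have hode := hODE ζ ⟨hUW hζ, h0⟩
    refine ⟨fun s hs ↦ (hode s (hsub hs)).continuousWithinAt.mono hsub, fun s hs ↦ ?_⟩
    have hs' := hsub (Ico_subset_Icc_self hs)
    rw [unitSpeedField, smul_smul, neg_one_mul]
    exact (hode s hs').mono_of_mem_nhdsWithin (Ico_mem_nhdsGE_of_mem hs')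
  refine ⟨C₁, min (min τ τ') (min t₀ (d / 4)), hC₁, by positivity, ?_⟩
  intro B hB ζ hζ ε hε hετ
  obtain ⟨⟨hετ₁, hετ₂⟩, hεt₀, hεd⟩ : (ε < τ ∧ ε < τ') ∧ ε < t₀ ∧ ε < d / 4 := by
    simpa only [lt_min_iff] using hετ
  have hεC : ε < C₁ * ε := lt_mul_of_one_lt_left hε hC₁
  have hcore := hengulf ζ hζ ε hε hετ₁ (B ζ ε) (B ζ (C₁ * ε)) (hB ζ hζ ε hε).1
    (hB ζ hζ _ (hε.trans hεC))
  constructor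
  · rintro z ⟨ζ', ⟨hζ'P, hζ'⟩, t, ⟨ht, htε⟩, rfl⟩
    have hζ'U := hbU hζ'
    obtain ⟨hφc, hφd⟩ := hflow t (htε.trans hεt₀) ζ' hζ'U hζ'.2
    obtain ⟨hdist, hrz⟩ := integral_curve_bounds hdiff hgradU (σ := -1) (hball ζ' hζ'U hζ'.2)
      (by simp) (hφ0 ζ' hζ') hφc hφd (by linarith) t ⟨ht.le, le_rfl⟩
    rw [hζ'.2] at hrz
    have hzU : φ ζ' t ∈ U := hball ζ' hζ'U hζ'.2 (by rw [mem_closedBall_iff_norm]; linarith)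
    obtain ⟨hp, hpmin, -⟩ := hproj _ hzU
    refine ⟨⟨?_, hzU⟩, ⟨hcore ζ' hζ'P _ ?_, hp⟩, by linarith, by linarith⟩
    · rw [hΩdef]
      exact ⟨hUW hzU, by linarith⟩
    · have h1 := hpmin ζ' hζ'
      have h2 := dist_triangle_left (proj (φ ζ' t)) ζ' (φ ζ' t)
      rw [← dist_eq_norm] at hdist ⊢
      linarith
  · rintro z ⟨⟨hzΩ, hzU⟩, ⟨hpP, hp⟩, hrz₁, hrz₂⟩
    obtain ⟨ζ₀, hζ₀, hzζ₀⟩ := hnear z hzΩ (by linarith)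
    obtain ⟨ζ', hζ'U, hζ'0, hdist, hφz⟩ := exists_flow_preimage (t := -r z) hdiff hgradU hball
      (fun ζ hζ h0 ↦ hL ζ ⟨hUW hζ, h0⟩) (by linarith) (by linarith) (hbU hζ₀) hζ₀.2
      (by rw [← dist_eq_norm]; exact hzζ₀.le) (by ring)
      (fun ζ hζ h0 ↦ hφ0 ζ ⟨hUW hζ, h0⟩) (hflow _ (by linarith))
    have hζ'K : ζ' ∈ {w ∈ W | r w = 0} := ⟨hUW hζ'U, hζ'0⟩
    refine ⟨ζ', ⟨hcore _ hpP _ ?_, hζ'K⟩, -r z, ⟨by linarith, by linarith⟩, hφz.symm⟩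
    have h1 := (hproj z hzU).2.1 ζ' hζ'K
    have h2 := dist_triangle_left ζ' (proj z) z
    rw [← dist_eq_norm] at hdist ⊢
    linarith
end

section
/- With the notation of the context, there exist constants 𝔠 > 0 and 0 < δ, ε₀ < 1 (depending only on κ and D), families D_k (k ∈ ℤ) of measurable subsets of X, and a point c(Q) ∈ X for each Q ∈ D := ⋃_{k∈ℤ} D_k, such that: (1) for each k ∈ ℤ, X = ⋃_{Q ∈ D_k} Q; (2) if Q₁, Q₂ ∈ D and Q₁ ∩ Q₂ ≠ ∅ then Q₁ ⊆ Q₂ or Q₂ ⊆ Q₁; (3) every Q ∈ D_k contains at least one member of D_{k+1}; (4) every Q ∈ D_k is contained in exactly one member of D_{k−1}; (5) if Q' ∈ D_{k+1}, Q ∈ D_k and Q' ⊆ Q, then μ(Q') ≥ ε₀ μ(Q); (6) for every Q ∈ D_k, B(c(Q), δ^k) ⊆ Q ⊆ B(c(Q), 𝔠 δ^k). -/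
open Set MeasureTheory
open scoped ENNReal

section Chains

theorem exists_nat_chain {β : Type*} (P : ℕ → β → Prop) (R : ℕ → β → β → Prop) (b : β)
    (hb : P 0 b) (step : ∀ n a, P n a → ∃ a', P (n + 1) a' ∧ R n a a') :
    ∃ f : ℕ → β, f 0 = b ∧ ∀ n, P n (f n) ∧ R n (f n) (f (n + 1)) := by
  choose! s hs using step
  let f : ℕ → β := fun n => Nat.rec b (fun n a => s n a) n
  have hP : ∀ n, P n (f n) := by
    intro n
    induction n with
    | zero => exact hb
    | succ n ih => exact (hs n _ ih).1
  exact ⟨f, rfl, fun n => ⟨hP n, (hs n _ (hP n)).2⟩⟩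

theorem exists_int_chain {β : Type*} (P : ℤ → β → Prop) (R : ℤ → β → β → Prop) (b : β)
    (hb : P 0 b) (up : ∀ k a, P k a → ∃ a', P (k + 1) a' ∧ R k a a')
    (down : ∀ k a, P (k + 1) a → ∃ a', P k a' ∧ R k a' a) :
    ∃ f : ℤ → β, ∀ k, P k (f k) ∧ R k (f k) (f (k + 1)) := by
  obtain ⟨f, hf0, hf⟩ := exists_nat_chain (fun n => P n) (fun n => R n) b (by simpa using hb)
    (fun n a h => by simpa using up n a h)
  obtain ⟨g, hg0, hg⟩ := exists_nat_chain (fun n => P (-n)) (fun n a a' => R (-(n + 1)) a' a) b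
    (by simpa using hb) (fun n a h => by
      have h' : P (-((n : ℤ) + 1) + 1) a := by
        have e : -((n : ℤ) + 1) + 1 = -n := by ring
        rwa [e]
      simpa using down _ a h')
  let F : ℤ → β := fun k => if 0 ≤ k then f k.toNat else g (-k).toNat
  have hF : ∀ n : ℕ, F n = f n := fun n => by simp [F]
  have hG : ∀ n : ℕ, F (-n) = g n := by
    intro n
    rcases Nat.eq_zero_or_pos n with rfl | hn
    · simp [F, hf0, hg0]
    · simp [F, hn.ne']
  refine ⟨F, fun k => ?_⟩
  obtain ⟨n, rfl | rfl⟩ : ∃ n : ℕ, k = n ∨ k = -((n : ℤ) + 1) := by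
    rcases le_or_gt 0 k with h | h
    · exact ⟨k.toNat, Or.inl (by omega)⟩
    · exact ⟨(-k - 1).toNat, Or.inr (by omega)⟩
  · have e : ((n : ℤ) + 1) = ((n + 1 : ℕ) : ℤ) := by push_cast; rfl
    rw [e, hF, hF]
    exact hf n
  · have e : (-((n : ℤ) + 1)) = -((n + 1 : ℕ) : ℤ) := by push_cast; rfl
    have e' : (-((n : ℤ) + 1) + 1) = -(n : ℤ) := by ring
    rw [e', e, hG, hG]
    refine ⟨(hg (n + 1)).1, ?_⟩
    have := (hg n).2
    rwa [e] at this

end Chains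

section Selection

theorem exists_measurable_selection {X ι : Type*} [MeasurableSpace X] [Nonempty X] {A : Set ι}
    (hA : A.Countable) (G : ι → Set X) (hG : ∀ a ∈ A, MeasurableSet (G a))
    (hcov : ∀ x, ∃ a ∈ A, x ∈ G a) :
    ∃ f : X → ι, (∀ x, f x ∈ A) ∧ (∀ x, x ∈ G (f x)) ∧ ∀ a, MeasurableSet (f ⁻¹' {a}) := by
  classical
  have hne : A.Nonempty := by
    obtain ⟨a, ha, -⟩ := hcov (Classical.arbitrary X)
    exact ⟨a, ha⟩
  obtain ⟨u, rfl⟩ := hA.exists_eq_range hne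
  have hu : ∀ x, ∃ n, x ∈ G (u n) := fun x => by simpa using hcov x
  refine ⟨fun x => u (Nat.find (hu x)), fun x => mem_range_self _,
    fun x => Nat.find_spec (hu x), fun a => ?_⟩
  have hm : Measurable fun x => Nat.find (hu x) :=
    measurable_find hu fun n => hG _ (mem_range_self n)
  exact hm (MeasurableSet.of_discrete (s := u ⁻¹' {a}))

theorem exists_forall_mem_of_antitone {ι X : Type*} {S : Set ι} (hS : S.Finite)
    (E : ℕ → ι → Set X) (hE : ∀ m i, i ∈ S → E (m + 1) i ⊆ E m i) {x : X}
    (hx : ∀ m, ∃ i ∈ S, x ∈ E m i) : ∃ i ∈ S, ∀ m, x ∈ E m i := by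
  by_contra! hcon
  choose! m hm using hcon
  obtain ⟨M, hM⟩ := (hS.image m).bddAbove
  obtain ⟨i, hi, hxi⟩ := hx M
  have anti : Antitone fun n => E n i := antitone_nat_of_succ_le fun n => hE n i hi
  exact hm i hi (anti (hM (mem_image_of_mem m hi)) hxi)

end Selection

section Nets

variable {X : Type*}

/-- `A` is a maximal `r`-separated set for `ρ`, recorded through its separation and covering
properties. -/
structure IsNet (ρ : X → X → ℝ) (r : ℝ) (A : Set X) : Prop where
  separated : A.Pairwise fun x y => r ≤ ρ x y
  exists_lt : ∀ x, ∃ a ∈ A, ρ a x < r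

theorem exists_isNet {ρ : X → X → ℝ} (hself : ∀ x, ρ x x = 0) (hsymm : ∀ x y, ρ x y = ρ y x)
    {r : ℝ} (hr : 0 < r) : ∃ A, IsNet ρ r A := by
  obtain ⟨A, hA⟩ := zorn_subset {A : Set X | A.Pairwise fun x y => r ≤ ρ x y} (by
    intro c hc hchain
    exact ⟨⋃₀ c, (pairwise_sUnion hchain.directedOn).2 fun s hs => hc hs,
      fun s hs => subset_sUnion_of_mem hs⟩)
  refine ⟨A, hA.prop, fun x => ?_⟩
  by_contra! hcon
  have hins : insert x A ∈ {A : Set X | A.Pairwise fun x y => r ≤ ρ x y} := by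
    refine hA.prop.insert fun b hb _ => ⟨?_, hcon b hb⟩
    rw [hsymm]
    exact hcon b hb
  have hxA : x ∈ A := hA.le_of_ge hins (subset_insert x A) (mem_insert x A)
  have := hcon x hxA
  rw [hself] at this
  exact absurd hr this.not_gt

theorem IsNet.exists_parent {ρ : X → X → ℝ} {κ r : ℝ} {A : Set X} (hA : IsNet ρ r A)
    (hκ : 1 ≤ κ) (hsymm : ∀ x y, ρ x y = ρ y x)
    (htri : ∀ x y z, ρ x y ≤ κ * (ρ x z + ρ z y)) (hr : 0 < r) (x : X) :
    ∃ a ∈ A, ρ a x < r ∧ ∀ b ∈ A, ρ b x < r / (2 * κ) → a = b := by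
  by_cases h : ∃ b ∈ A, ρ b x < r / (2 * κ)
  · obtain ⟨a, ha, hax⟩ := h
    refine ⟨a, ha, hax.trans_le (div_le_self hr.le (by linarith)), fun b hb hbx => ?_⟩
    by_contra hne
    have h1 : r ≤ ρ a b := hA.separated ha hb hne
    have h2 := htri a b x
    rw [hsymm x b] at h2
    have h3 : κ * (ρ a x + ρ b x) < κ * (r / (2 * κ) + r / (2 * κ)) := by gcongr
    have h4 : κ * (r / (2 * κ) + r / (2 * κ)) = r := by field_simp; ring
    linarith
  · push Not at h
    obtain ⟨a, ha, hax⟩ := hA.exists_lt x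
    exact ⟨a, ha, hax, fun b hb hbx => absurd hbx (h b hb).not_gt⟩

theorem measure_ball_le_pow_mul [MeasurableSpace X] {ρ : X → X → ℝ} {μ : Measure X} {D : ℝ≥0∞}
    (hdoub : ∀ x t, 0 < t → μ {y | ρ x y < 2 * t} ≤ D * μ {y | ρ x y < t}) (x : X) {t : ℝ}
    (ht : 0 < t) (n : ℕ) : μ {y | ρ x y < 2 ^ n * t} ≤ D ^ n * μ {y | ρ x y < t} := by
  induction n with
  | zero => simp
  | succ n ih =>
    calc μ {y | ρ x y < 2 ^ (n + 1) * t} = μ {y | ρ x y < 2 * (2 ^ n * t)} := by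
          rw [pow_succ', mul_assoc]
      _ ≤ D * μ {y | ρ x y < 2 ^ n * t} := hdoub x _ (by positivity)
      _ ≤ D * (D ^ n * μ {y | ρ x y < t}) := by gcongr
      _ = D ^ (n + 1) * μ {y | ρ x y < t} := by rw [pow_succ', mul_assoc]

theorem IsNet.finite_inter_ball [MeasurableSpace X] {ρ : X → X → ℝ} {μ : Measure X} {κ r : ℝ}
    {D : ℝ≥0∞} {A : Set X} (hA : IsNet ρ r A) (hκ : 1 ≤ κ) (hr : 0 < r) (hD : D ≠ ∞)
    (hsymm : ∀ x y, ρ x y = ρ y x) (htri : ∀ x y z, ρ x y ≤ κ * (ρ x z + ρ z y))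
    (hmeas : ∀ x t, MeasurableSet {y | ρ x y < t})
    (hpos : ∀ x t, 0 < t → 0 < μ {y | ρ x y < t})
    (hfin : ∀ x t, 0 < t → μ {y | ρ x y < t} ≠ ∞)
    (hdoub : ∀ x t, 0 < t → μ {y | ρ x y < 2 * t} ≤ D * μ {y | ρ x y < t}) (x : X) {R : ℝ}
    (hR : 0 < R) : {a ∈ A | ρ a x < R}.Finite := by
  set s : ℝ := r / (2 * κ) with hs
  have hκ0 : 0 < κ := by linarith
  have hs0 : 0 < s := by positivity
  obtain ⟨n, hn⟩ := pow_unbounded_of_one_lt (2 * κ * R / s) (one_lt_two (α := ℝ))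
  rw [div_lt_iff₀ hs0] at hn
  set S : Set X := {a ∈ A | ρ a x < R} with hS
  have hsub : ∀ a ∈ S, {y | ρ x y < R} ⊆ {y | ρ a y < 2 ^ n * s} := by
    intro a ha y hy
    have h1 := htri a y x
    have h2 : κ * (ρ a x + ρ x y) ≤ κ * (R + R) := by
      have := ha.2.le
      have : ρ x y ≤ R := le_of_lt hy
      gcongr
    change ρ a y < 2 ^ n * s
    linarith
  have hlow : ∀ a ∈ S, μ {y | ρ x y < R} / D ^ n ≤ μ {y | ρ a y < s} := by
    intro a ha
    refine ENNReal.div_le_of_le_mul' ?_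
    exact (measure_mono (hsub a ha)).trans (measure_ball_le_pow_mul hdoub a hs0 n)
  have hdisj : Pairwise (Function.onFun Disjoint fun a : S => {y | ρ (a : X) y < s}) := by
    intro a b hab
    refine Set.disjoint_left.2 fun y hay hby => ?_
    have h1 : r ≤ ρ (a : X) b := hA.separated a.2.1 b.2.1 (fun h => hab (Subtype.ext h))
    have h2 := htri a b y
    rw [hsymm y b] at h2
    have h3 : κ * (ρ (a : X) y + ρ (b : X) y) < κ * (s + s) := by
      have : ρ (a : X) y < s := hay
      have : ρ (b : X) y < s := hby
      gcongr
    have h4 : κ * (s + s) = r := by rw [hs]; field_simp; ring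
    linarith
  have hunion : μ (⋃ a : S, {y | ρ (a : X) y < s}) ≠ ∞ := by
    refine ne_top_of_le_ne_top (hfin x (κ * (R + s)) (by positivity)) (measure_mono ?_)
    refine iUnion_subset fun a y hy => ?_
    have h1 := htri x y a
    have h2 : ρ x a < R := by rw [hsymm]; exact a.2.2
    have h3 : κ * (ρ x a + ρ (a : X) y) < κ * (R + s) := by
      have : ρ (a : X) y < s := hy
      gcongr
    exact h1.trans_lt h3
  have hε : 0 < μ {y | ρ x y < R} / D ^ n :=
    ENNReal.div_pos (hpos x R hR).ne' (ENNReal.pow_ne_top hD)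
  have hfinite := Measure.finite_const_le_meas_of_disjoint_iUnion μ hε
    (fun a : S => hmeas a s) hdisj hunion
  have huniv : {a : S | μ {y | ρ x y < R} / D ^ n ≤ μ {y | ρ (a : X) y < s}} = univ :=
    eq_univ_of_forall fun a => hlow a a.2
  rw [huniv] at hfinite
  exact Set.finite_coe_iff.1 (Set.finite_univ_iff.1 hfinite)

end Nets

section Cubes

variable {X : Type*} {ρ : X → X → ℝ} {κ δ : ℝ} {r : ℤ → ℝ} {A : ℤ → Set X} {p : ℤ → X → X}

/-- Nets `A k` at the geometric scales `r k`, together with maps `p k` sending a point of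
`A (k + 1)` to its parent in `A k`. -/
structure IsDyadicTree (ρ : X → X → ℝ) (κ δ : ℝ) (r : ℤ → ℝ) (A : ℤ → Set X) (p : ℤ → X → X) :
    Prop where
  scale_pos : ∀ k, 0 < r k
  scale_succ : ∀ k, r (k + 1) = δ * r k
  net : ∀ k, IsNet ρ (r k) (A k)
  parent_mem : ∀ k x, p k x ∈ A k
  parent_lt : ∀ k x, ρ (p k x) x < r k
  parent_eq : ∀ k x, ∀ a ∈ A k, ρ a x < r k / (2 * κ) → p k x = a

/-- The points that lie within `2 * κ * r (k + m)` of some descendant of `a ∈ A k` in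
generation `k + m`. -/
def approxCube (ρ : X → X → ℝ) (κ : ℝ) (r : ℤ → ℝ) (A : ℤ → Set X) (p : ℤ → X → X) :
    ℕ → ℤ → X → Set X
  | 0, k, a => {x | ρ a x < 2 * κ * r k}
  | m + 1, k, a => ⋃ b ∈ {b ∈ A (k + 1) | p k b = a}, approxCube ρ κ r A p m (k + 1) b

theorem mem_approxCube_succ {m : ℕ} {k : ℤ} {a x : X} :
    x ∈ approxCube ρ κ r A p (m + 1) k a ↔
      ∃ b, (b ∈ A (k + 1) ∧ p k b = a) ∧ x ∈ approxCube ρ κ r A p m (k + 1) b := by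
  simp [approxCube]

theorem measurableSet_approxCube [MeasurableSpace X] (hA : ∀ k, (A k).Countable)
    (hmeas : ∀ x t, MeasurableSet {y | ρ x y < t})
    (m : ℕ) (k : ℤ) (a : X) :
    MeasurableSet (approxCube ρ κ r A p m k a) := by
  induction m generalizing k a with
  | zero => exact hmeas _ _
  | succ m ih =>
    exact MeasurableSet.biUnion ((hA (k + 1)).mono (sep_subset _ _)) fun b _ => ih _ _

namespace IsDyadicTree

theorem approxCube_succ_subset (T : IsDyadicTree ρ κ δ r A p)
    (hκ : 1 ≤ κ) (hδ : 8 * κ ^ 3 * δ ≤ 1) (htri : ∀ x y z, ρ x y ≤ κ * (ρ x z + ρ z y))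
    (m : ℕ) (k : ℤ) (a : X) :
    approxCube ρ κ r A p (m + 1) k a ⊆ approxCube ρ κ r A p m k a := by
  induction m generalizing k a with
  | zero =>
    intro x hx
    obtain ⟨b, ⟨-, rfl⟩, hxb⟩ := mem_approxCube_succ.1 hx
    have hbx : ρ b x < 2 * κ * r (k + 1) := hxb
    rw [T.scale_succ] at hbx
    have hr := T.scale_pos k
    have h1 := htri (p k b) x b
    have h2 := T.parent_lt k b
    have h3 : κ * (ρ (p k b) b + ρ b x) < κ * (r k + 2 * κ * (δ * r k)) := by gcongr
    have hκδ : 2 * κ * δ ≤ 1 := by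
      rcases le_or_gt δ 0 with h | h
      · nlinarith
      · have : κ ≤ κ ^ 3 := le_self_pow₀ hκ (by norm_num)
        nlinarith
    have h4 : 2 * κ * δ * r k ≤ 1 * r k := by gcongr
    change ρ (p k b) x < 2 * κ * r k
    nlinarith
  | succ m ih =>
    intro x hx
    obtain ⟨b, hb, hx⟩ := mem_approxCube_succ.1 hx
    exact mem_approxCube_succ.2 ⟨b, hb, ih _ _ hx⟩

theorem eq_of_mem_approxCube_one (T : IsDyadicTree ρ κ δ r A p)
    (hκ : 1 ≤ κ) (hδ : 8 * κ ^ 3 * δ ≤ 1) (htri : ∀ x y z, ρ x y ≤ κ * (ρ x z + ρ z y))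
    (hsymm : ∀ x y, ρ x y = ρ y x) {k : ℤ} {a a' x : X}
    (ha : a ∈ A k) (hax : ρ a x < r k / (4 * κ ^ 2)) (hx : x ∈ approxCube ρ κ r A p 1 k a') :
    a' = a := by
  obtain ⟨b, ⟨-, rfl⟩, hxb⟩ := mem_approxCube_succ.1 hx
  have hbx : ρ b x < 2 * κ * r (k + 1) := hxb
  rw [T.scale_succ] at hbx
  have hr := T.scale_pos k
  have hκ0 : 0 < κ := by linarith
  refine T.parent_eq k b a ha ?_
  have h1 := htri a b x
  rw [hsymm x b] at h1
  have h2 : κ * (ρ a x + ρ b x) < κ * (r k / (4 * κ ^ 2) + 2 * κ * (δ * r k)) := by gcongr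
  have h3 : 2 * κ * (δ * r k) ≤ r k / (4 * κ ^ 2) := by
    rw [le_div_iff₀ (by positivity)]
    calc 2 * κ * (δ * r k) * (4 * κ ^ 2) = 8 * κ ^ 3 * δ * r k := by ring
      _ ≤ 1 * r k := by gcongr
      _ = r k := one_mul _
  calc ρ a b < κ * (r k / (4 * κ ^ 2) + 2 * κ * (δ * r k)) := h1.trans_lt h2
    _ ≤ κ * (r k / (4 * κ ^ 2) + r k / (4 * κ ^ 2)) := by gcongr
    _ = r k / (2 * κ) := by field_simp; ring

theorem exists_mem_approxCube (T : IsDyadicTree ρ κ δ r A p) (hκ : 1 ≤ κ) (m : ℕ) (k : ℤ) (x : X) :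
    ∃ a ∈ A k, x ∈ approxCube ρ κ r A p m k a := by
  induction m generalizing k with
  | zero =>
    obtain ⟨a, ha, hax⟩ := (T.net k).exists_lt x
    refine ⟨a, ha, hax.trans_le ?_⟩
    nlinarith [T.scale_pos k]
  | succ m ih =>
    obtain ⟨b, hb, hx⟩ := ih (k + 1)
    exact ⟨p k b, T.parent_mem k b, mem_approxCube_succ.2 ⟨b, ⟨hb, rfl⟩, hx⟩⟩

theorem exists_forall_mem_approxCube (T : IsDyadicTree ρ κ δ r A p)
    (hκ : 1 ≤ κ) (hδ : 8 * κ ^ 3 * δ ≤ 1) (htri : ∀ x y z, ρ x y ≤ κ * (ρ x z + ρ z y))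
    (hfin : ∀ k x R, 0 < R → {a ∈ A k | ρ a x < R}.Finite) {k : ℤ} {x : X} {S : Set X}
    (hS : S ⊆ A k) (hx : ∀ m, ∃ a ∈ S, x ∈ approxCube ρ κ r A p m k a) :
    ∃ a ∈ S, ∀ m, x ∈ approxCube ρ κ r A p m k a := by
  have hR : 0 < 2 * κ * r k := by have := T.scale_pos k; positivity
  have hanti : ∀ a, Antitone fun m => approxCube ρ κ r A p m k a := fun a =>
    antitone_nat_of_succ_le fun m => T.approxCube_succ_subset hκ hδ htri m k a
  have hS' : {a ∈ S | ρ a x < 2 * κ * r k}.Finite :=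
    (hfin k x _ hR).subset fun a ha => ⟨hS ha.1, ha.2⟩
  obtain ⟨a, ha, h⟩ := exists_forall_mem_of_antitone hS'
    (fun m a => approxCube ρ κ r A p m k a)
    (fun m a _ => T.approxCube_succ_subset hκ hδ htri m k a) (x := x) (fun m => by
      obtain ⟨a, ha, hax⟩ := hx m
      exact ⟨a, ⟨ha, hanti a (Nat.zero_le m) hax⟩, hax⟩)
  exact ⟨a, ha.1, h⟩

/-- A measurable choice, for every point and every generation, of a cube centre, compatible with
the parent maps. -/
theorem exists_address [MeasurableSpace X] [Nonempty X] (T : IsDyadicTree ρ κ δ r A p)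
    (hκ : 1 ≤ κ) (hδ : 8 * κ ^ 3 * δ ≤ 1) (htri : ∀ x y z, ρ x y ≤ κ * (ρ x z + ρ z y))
    (hA : ∀ k, (A k).Countable)
    (hfin : ∀ k x R, 0 < R → {a ∈ A k | ρ a x < R}.Finite)
    (hmeas : ∀ x t, MeasurableSet {y | ρ x y < t}) :
    ∃ σ : ℤ → X → X, (∀ k x, σ k x ∈ A k) ∧ (∀ k x, p k (σ (k + 1) x) = σ k x) ∧
      (∀ k x m, x ∈ approxCube ρ κ r A p m k (σ k x)) ∧
      ∀ k a, MeasurableSet (σ k ⁻¹' {a}) := by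
  let F : ℤ → X → Set X := fun k a => ⋂ m, approxCube ρ κ r A p m k a
  have hF : ∀ k a, MeasurableSet (F k a) := fun k a =>
    MeasurableSet.iInter fun m => measurableSet_approxCube hA hmeas m k a
  let P : ℤ → (X → X) → Prop := fun k g =>
    (∀ x, g x ∈ A k) ∧ (∀ x, x ∈ F k (g x)) ∧ ∀ a, MeasurableSet (g ⁻¹' {a})
  obtain ⟨g, hg⟩ : ∃ g, P 0 g := by
    refine exists_measurable_selection (hA 0) (F 0) (fun a _ => hF 0 a) fun x => ?_
    obtain ⟨a, ha, h⟩ := T.exists_forall_mem_approxCube hκ hδ htri hfin subset_rfl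
      fun m => T.exists_mem_approxCube hκ m 0 x
    exact ⟨a, ha, mem_iInter.2 h⟩
  suffices h : ∃ σ : ℤ → X → X, ∀ k, P k (σ k) ∧ ∀ x, p k (σ (k + 1) x) = σ k x by
    obtain ⟨σ, hσ⟩ := h
    exact ⟨σ, fun k => (hσ k).1.1, fun k => (hσ k).2, fun k x => mem_iInter.1 ((hσ k).1.2.1 x),
      fun k => (hσ k).1.2.2⟩
  refine exists_int_chain P (fun k g g' => ∀ x, p k (g' x) = g x) g hg ?_ ?_
  · intro k g hg
    obtain ⟨f, hfA, hfG, hfm⟩ := exists_measurable_selection (hA (k + 1))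
      (fun b => g ⁻¹' {p k b} ∩ F (k + 1) b) (fun b _ => (hg.2.2 _).inter (hF _ _)) fun x => by
        obtain ⟨b, hb, h⟩ := T.exists_forall_mem_approxCube hκ hδ htri hfin
          (S := {b ∈ A (k + 1) | p k b = g x}) (sep_subset _ _)
          fun m => mem_approxCube_succ.1 (mem_iInter.1 (hg.2.1 x) (m + 1))
        exact ⟨b, hb.1, hb.2.symm, mem_iInter.2 h⟩
    exact ⟨f, ⟨hfA, fun x => (hfG x).2, hfm⟩, fun x => (hfG x).1.symm⟩
  · intro k g hg
    refine ⟨fun x => p k (g x), ⟨fun x => T.parent_mem k _, fun x => mem_iInter.2 fun m => ?_,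
      fun a => ?_⟩, fun x => rfl⟩
    · exact T.approxCube_succ_subset hκ hδ htri m k _
        (mem_approxCube_succ.2 ⟨g x, ⟨hg.1 x, rfl⟩, mem_iInter.1 (hg.2.1 x) m⟩)
    · have : (fun x => p k (g x)) ⁻¹' {a} = ⋃ b ∈ {b ∈ A (k + 1) | p k b = a}, g ⁻¹' {b} := by
        ext x
        simp [hg.1 x]
      rw [this]
      exact MeasurableSet.biUnion ((hA (k + 1)).mono (sep_subset _ _)) fun b _ => hg.2.2 b

end IsDyadicTree

theorem eq_of_eq_of_le {σ : ℤ → X → X} (hσ : ∀ k x, p k (σ (k + 1) x) = σ k x) {k l : ℤ}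
    (hkl : k ≤ l) {x y : X} (h : σ l x = σ l y) : σ k x = σ k y := by
  induction l, hkl using Int.leInduction with
  | base => exact h
  | succ l _ ih => exact ih (by rw [← hσ l x, ← hσ l y, h])

theorem exists_isDyadicTree (hself : ∀ x, ρ x x = 0) (hsymm : ∀ x y, ρ x y = ρ y x)
    (htri : ∀ x y z, ρ x y ≤ κ * (ρ x z + ρ z y)) (hκ : 1 ≤ κ) (hr : ∀ k, 0 < r k)
    (hrs : ∀ k, r (k + 1) = δ * r k) : ∃ A p, IsDyadicTree ρ κ δ r A p := by
  choose A hA using fun k => exists_isNet hself hsymm (hr k)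
  choose p hpA hp hpe using fun k => (hA k).exists_parent hκ hsymm htri (hr k)
  exact ⟨A, p, hr, hrs, hA, hpA, hp, hpe⟩

theorem countable_of_finite_inter_ball [Nonempty X] {A : Set X}
    (hfin : ∀ x R, 0 < R → {a ∈ A | ρ a x < R}.Finite) : A.Countable := by
  obtain ⟨x⟩ := ‹Nonempty X›
  refine (countable_iUnion fun n : ℕ => (hfin x (n + 1) (by positivity)).countable).mono
    fun a ha => mem_iUnion.2 ?_
  obtain ⟨n, hn⟩ := exists_nat_gt (ρ a x)
  exact ⟨n, ha, by linarith⟩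

end Cubes

/-- Hytönen–Kairema dyadic decomposition of a space of homogeneous type:
a quasimetric space with a doubling measure admits a system of dyadic cubes with constants
depending only on the quasitriangle constant `κ` and the doubling constant `D`. -/
theorem hytonen_kairema_dyadic (κ D : ℝ) (hκ : 1 ≤ κ) (hD : 0 < D) :
    ∃ c𝔠 δ ε₀ : ℝ, 0 < c𝔠 ∧ 0 < δ ∧ δ < 1 ∧ 0 < ε₀ ∧ ε₀ < 1 ∧
      ∀ (X : Type) (_ : MeasurableSpace X) (_ : Nonempty X) (ρ : X → X → ℝ)
        (μ : Measure X),
        (∀ x y : X, 0 ≤ ρ x y) →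
        (∀ x y : X, ρ x y = 0 ↔ x = y) →
        (∀ x y : X, ρ x y = ρ y x) →
        (∀ x y z : X, ρ x y ≤ κ * (ρ x z + ρ z y)) →
        (∀ (x : X) (t : ℝ), MeasurableSet {y : X | ρ x y < t}) →
        (∀ (x : X) (t : ℝ), 0 < t →
          0 < μ {y : X | ρ x y < 2 * t} ∧
          μ {y : X | ρ x y < 2 * t} ≤ ENNReal.ofReal D * μ {y : X | ρ x y < t} ∧
          μ {y : X | ρ x y < t} < ⊤) →
        ∃ (𝒟 : ℤ → Set (Set X)) (c : ℤ → Set X → X),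
          (∀ k : ℤ, ∀ Q ∈ 𝒟 k, MeasurableSet Q) ∧
          -- (1) each generation covers X
          (∀ (k : ℤ) (x : X), ∃ Q ∈ 𝒟 k, x ∈ Q) ∧
          -- (2) any two cubes are nested or disjoint
          (∀ (k l : ℤ), ∀ Q₁ ∈ 𝒟 k, ∀ Q₂ ∈ 𝒟 l, (Q₁ ∩ Q₂).Nonempty →
            Q₁ ⊆ Q₂ ∨ Q₂ ⊆ Q₁) ∧
          -- (3) every cube has at least one child
          (∀ (k : ℤ), ∀ Q ∈ 𝒟 k, ∃ Q' ∈ 𝒟 (k + 1), Q' ⊆ Q) ∧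
          -- (4) every cube has exactly one parent
          (∀ (k : ℤ), ∀ Q ∈ 𝒟 k, ∃! Q' : Set X, Q' ∈ 𝒟 (k - 1) ∧ Q ⊆ Q') ∧
          -- (5) children have comparable measure
          (∀ (k : ℤ), ∀ Q ∈ 𝒟 k, ∀ Q' ∈ 𝒟 (k + 1), Q' ⊆ Q →
            ENNReal.ofReal ε₀ * μ Q ≤ μ Q') ∧
          -- (6) sandwich property
          (∀ (k : ℤ), ∀ Q ∈ 𝒟 k,
            {y : X | ρ (c k Q) y < δ ^ k} ⊆ Q ∧
            Q ⊆ {y : X | ρ (c k Q) y < c𝔠 * δ ^ k}) := by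
  have hκ0 : 0 < κ := by linarith
  obtain ⟨N, hN⟩ := pow_unbounded_of_one_lt (128 * κ ^ 7) (one_lt_two (α := ℝ))
  set δ : ℝ := 1 / (8 * κ ^ 3) with hδdef
  have hδ0 : 0 < δ := by positivity
  have hδ : 8 * κ ^ 3 * δ = 1 := by rw [hδdef]; field_simp
  have hδ1 : δ < 1 := by
    rw [hδdef, div_lt_one (by positivity)]
    linarith [one_le_pow₀ hκ (n := 3)]
  set D' : ℝ := max D 2 with hD'
  have hD'1 : 1 < D' := lt_of_lt_of_le one_lt_two (le_max_right D 2)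
  have hD'0 : 0 < D' := by linarith
  refine ⟨8 * κ ^ 3, δ, (D' ^ (N + 1))⁻¹, by positivity, hδ0, hδ1, by positivity,
    inv_lt_one_of_one_lt₀ (one_lt_pow₀ hD'1 (by simp)), ?_⟩
  intro X _ _ ρ μ _ hzero hsymm htri hmeas hμ
  have hself : ∀ x, ρ x x = 0 := fun x => (hzero x x).2 rfl
  have hdoub : ∀ x t, 0 < t →
      μ {y | ρ x y < 2 * t} ≤ ENNReal.ofReal D' * μ {y | ρ x y < t} := fun x t ht =>
    (hμ x t ht).2.1.trans (by gcongr; exact le_max_left D 2)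
  have hpos : ∀ x t, 0 < t → 0 < μ {y | ρ x y < t} := fun x t ht => by
    have h := (hμ x (t / 2) (by positivity)).1
    rwa [mul_div_cancel₀ t two_ne_zero] at h
  have hfinμ : ∀ x t, 0 < t → μ {y | ρ x y < t} ≠ ∞ := fun x t ht => (hμ x t ht).2.2.ne
  let r : ℤ → ℝ := fun k => 4 * κ ^ 2 * δ ^ k
  have hδk : ∀ k : ℤ, 0 < δ ^ k := fun k => zpow_pos hδ0 k
  have hr : ∀ k, 0 < r k := fun k => by have := hδk k; positivity
  have hrs : ∀ k, r (k + 1) = δ * r k := fun k => by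
    simp only [r, zpow_add_one₀ hδ0.ne']
    ring
  obtain ⟨A, p, T⟩ := exists_isDyadicTree hself hsymm htri hκ hr hrs
  have hfin : ∀ k x R, 0 < R → {a ∈ A k | ρ a x < R}.Finite := fun k x R hR =>
    (T.net k).finite_inter_ball hκ (hr k) ENNReal.ofReal_ne_top hsymm htri hmeas hpos hfinμ
      hdoub x hR
  have hA : ∀ k, (A k).Countable := fun k => countable_of_finite_inter_ball (hfin k)
  obtain ⟨σ, hσA, hσp, hσE, hσm⟩ := T.exists_address hκ hδ.le htri hA hfin hmeas
  have hinner : ∀ k, ∀ a ∈ A k, ∀ x, ρ a x < δ ^ k → σ k x = a := fun k a ha x hx =>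
    T.eq_of_mem_approxCube_one hκ hδ.le htri hsymm ha
      (by simp only [r]; rwa [mul_div_cancel_left₀ _ (by positivity)]) (hσE k x 1)
  have houter : ∀ k x, ρ (σ k x) x < 8 * κ ^ 3 * δ ^ k := fun k x => by
    have h : ρ (σ k x) x < 2 * κ * (4 * κ ^ 2 * δ ^ k) := hσE k x 0
    linarith
  have hcenter : ∀ k, ∀ a ∈ A k, σ k a = a := fun k a ha =>
    hinner k a ha a (by rw [hself]; exact hδk k)
  let 𝒟 : ℤ → Set (Set X) := fun k => {Q | ∃ a ∈ A k, σ k ⁻¹' {a} = Q}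
  choose! c hcA hcQ using fun (k : ℤ) (Q : Set X) (hQ : Q ∈ 𝒟 k) => hQ
  have hmem : ∀ k x, σ k ⁻¹' {σ k x} ∈ 𝒟 k := fun k x => ⟨σ k x, hσA k x, rfl⟩
  have hQeq : ∀ k, ∀ Q ∈ 𝒟 k, ∀ x ∈ Q, Q = σ k ⁻¹' {σ k x} := by
    rintro k _ ⟨a, -, rfl⟩ x rfl
    rfl
  have hnonempty : ∀ k, ∀ Q ∈ 𝒟 k, Q.Nonempty := by
    rintro k _ ⟨a, ha, rfl⟩
    exact ⟨a, hcenter k a ha⟩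
  have hmono : ∀ k l x, k ≤ l → σ l ⁻¹' {σ l x} ⊆ σ k ⁻¹' {σ k x} := fun k l x hkl y hy =>
    eq_of_eq_of_le hσp hkl hy
  have hball : ∀ k, ∀ Q ∈ 𝒟 k, {y | ρ (c k Q) y < δ ^ k} ⊆ Q := fun k Q hQ y hy => by
    rw [← hcQ k Q hQ]
    exact hinner k _ (hcA k Q hQ) y hy
  have hQball : ∀ k, ∀ Q ∈ 𝒟 k, Q ⊆ {y | ρ (c k Q) y < 8 * κ ^ 3 * δ ^ k} := by
    intro k Q hQ y hy
    rw [← hcQ k Q hQ] at hy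
    have h : σ k y = c k Q := hy
    rw [mem_ofPred_eq, ← h]
    exact houter k y
  refine ⟨𝒟, c, ?_, fun k x => ⟨_, hmem k x, rfl⟩, ?_, ?_, ?_, ?_,
    fun k Q hQ => ⟨hball k Q hQ, hQball k Q hQ⟩⟩
  · rintro k _ ⟨a, -, rfl⟩
    exact hσm k a
  · rintro k l Q₁ hQ₁ Q₂ hQ₂ ⟨x, hx₁, hx₂⟩
    rw [hQeq k Q₁ hQ₁ x hx₁, hQeq l Q₂ hQ₂ x hx₂]
    rcases le_total k l with h | h
    · exact Or.inr (hmono k l x h)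
    · exact Or.inl (hmono l k x h)
  · intro k Q hQ
    obtain ⟨x, hx⟩ := hnonempty k Q hQ
    refine ⟨_, hmem (k + 1) x, ?_⟩
    rw [hQeq k Q hQ x hx]
    exact hmono k (k + 1) x (by omega)
  · intro k Q hQ
    obtain ⟨x, hx⟩ := hnonempty k Q hQ
    refine ⟨_, ⟨hmem (k - 1) x, ?_⟩, fun Q' hQ' => hQeq _ Q' hQ'.1 x (hQ'.2 hx)⟩
    rw [hQeq k Q hQ x hx]
    exact hmono (k - 1) k x (by omega)
  · intro k Q hQ Q' hQ' hsub
    set b := c (k + 1) Q' with hb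
    have hδ1k := hδk (k + 1)
    have hbQ : b ∈ Q := hsub (hball (k + 1) Q' hQ' (by rw [mem_ofPred_eq, hself]; exact hδ1k))
    have hQb : Q ⊆ {y | ρ b y < 2 ^ N * δ ^ (k + 1)} := by
      intro y hy
      have h1 := htri b y (c k Q)
      have h2 : ρ (c k Q) b < 8 * κ ^ 3 * δ ^ k := hQball k Q hQ hbQ
      have h3 : ρ (c k Q) y < 8 * κ ^ 3 * δ ^ k := hQball k Q hQ hy
      rw [hsymm b (c k Q)] at h1
      have h4 : κ * (ρ (c k Q) b + ρ (c k Q) y) <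
          κ * (8 * κ ^ 3 * δ ^ k + 8 * κ ^ 3 * δ ^ k) := by gcongr
      have h5 : κ * (8 * κ ^ 3 * δ ^ k + 8 * κ ^ 3 * δ ^ k) = 128 * κ ^ 7 * δ ^ (k + 1) := by
        rw [zpow_add_one₀ hδ0.ne']
        linear_combination (-16 * κ ^ 4 * δ ^ k) * hδ
      have h6 : 128 * κ ^ 7 * δ ^ (k + 1) ≤ 2 ^ N * δ ^ (k + 1) := by gcongr
      change ρ b y < _
      linarith
    have hD'N : D' ^ N ≤ D' ^ (N + 1) := pow_le_pow_right₀ hD'1.le (Nat.le_succ N)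
    have hμQ : μ Q ≤ ENNReal.ofReal (D' ^ (N + 1)) * μ Q' :=
      calc μ Q ≤ μ {y | ρ b y < 2 ^ N * δ ^ (k + 1)} := measure_mono hQb
        _ ≤ ENNReal.ofReal D' ^ N * μ {y | ρ b y < δ ^ (k + 1)} :=
          measure_ball_le_pow_mul hdoub b hδ1k N
        _ = ENNReal.ofReal (D' ^ N) * μ {y | ρ b y < δ ^ (k + 1)} := by
          rw [ENNReal.ofReal_pow hD'0.le]
        _ ≤ ENNReal.ofReal (D' ^ (N + 1)) * μ Q' := by
          gcongr
          exact hball (k + 1) Q' hQ'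
    calc ENNReal.ofReal (D' ^ (N + 1))⁻¹ * μ Q
        ≤ ENNReal.ofReal (D' ^ (N + 1))⁻¹ * (ENNReal.ofReal (D' ^ (N + 1)) * μ Q') := by gcongr
      _ = μ Q' := by
        rw [← mul_assoc, ← ENNReal.ofReal_mul (by positivity),
          inv_mul_cancel₀ (by positivity), ENNReal.ofReal_one, one_mul]
end
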